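/- For every integer n ≥ 3 there exists ε₁ = ε₁(n) > 0 such that the following holds: if K ⊆ ℝⁿ is a C¹ ε₁-perturbation of a ball, then (∫_{∂K} ‖II‖₁ dH^{n-1})^{1/(n-2)} / Per(K)^{1/(n-1)} ≥ ((n-1)·H^{n-1}(S^{n-1}))^{1/(n-2)} / Per(B₁)^{1/(n-1)}, where B₁ is the unit ball of ℝⁿ. -/

import Mathlib

open MeasureTheory Metric Set Real
open scoped ENNReal RealInnerProductSpace

noncomputable section

abbrev Euc (n : ℕ) := EuclideanSpace ℝ (Fin n)

/-- Divergence of a vector field on Euclidean space: trace of its Fréchet derivative. -/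
def divg {n : ℕ} (W : Euc n → Euc n) (x : Euc n) : ℝ :=
  LinearMap.trace ℝ (Euc n) (fderiv ℝ W x).toLinearMap

/-- A bounded domain with smooth boundary, encoded by a smooth defining function `F`:
the domain is `{F < 0}` and its boundary is `{F = 0}`, on which `0` is a regular value. -/
structure SmoothBody (n : ℕ) where
  F : Euc n → ℝ
  smooth : ContDiff ℝ (⊤ : ℕ∞) F
  bounded : Bornology.IsBounded {x : Euc n | F x ≤ 0}
  connected : IsConnected {x : Euc n | F x < 0}
  regular : ∀ x : Euc n, F x = 0 → gradient F x ≠ 0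

namespace SmoothBody

variable {n : ℕ} (K : SmoothBody n)

/-- The (open) domain `K`. -/
def body : Set (Euc n) := {x : Euc n | K.F x < 0}

/-- The boundary `∂K`. -/
def bdry : Set (Euc n) := {x : Euc n | K.F x = 0}

/-- The outer unit normal to `∂K` (extended to a neighbourhood as the normalized
gradient of the defining function). -/
def normal (x : Euc n) : Euc n := ‖gradient K.F x‖⁻¹ • gradient K.F x

/-- The mean curvature of `∂K` (trace of the second fundamental form with respect to the
outer unit normal), computed as the divergence of the unit normal field. -/
def meanCurv (x : Euc n) : ℝ := divg K.normal x

/-- The orthogonal projection onto the hyperplane orthogonal to `ν`, as a linear map. -/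
def tangentProj (ν : Euc n) : Euc n →ₗ[ℝ] Euc n :=
  LinearMap.id - LinearMap.smulRight (innerSL ℝ ν).toLinearMap ν

/-- The shape operator (Weingarten map) of `∂K` at `x`, extended by `0` on the normal
direction: `P ∘ Dν ∘ P` with `P` the orthogonal projection on the tangent space
`(ν x)^⊥` of `∂K`. Its eigenvalues are the principal curvatures of `∂K` together
with one extra `0`. -/
def shapeOp (x : Euc n) : Euc n →ₗ[ℝ] Euc n :=
  (tangentProj (K.normal x)) ∘ₗ (fderiv ℝ K.normal x).toLinearMap ∘ₗ (tangentProj (K.normal x))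

/-- The nuclear norm `‖II‖₁` of the second fundamental form of `∂K` at `x`: the sum of the
absolute values of the principal curvatures (eigenvalues of the shape operator). -/
def nuclearNormII (x : Euc n) : ℝ :=
  let M := LinearMap.toMatrix (EuclideanSpace.basisFun (Fin n) ℝ).toBasis
      (EuclideanSpace.basisFun (Fin n) ℝ).toBasis (K.shapeOp x)
  if h : M.IsHermitian then ∑ i, |h.eigenvalues i| else 0

/-- The perimeter of `K`: the `(n-1)`-dimensional Hausdorff measure of `∂K`. -/
def perim : ℝ := (μH[(n : ℝ) - 1] K.bdry).toReal

/-- `K` is a `C¹` `ε`-perturbation of a ball: for some `x̄ ∈ ℝⁿ`, the outer unit normal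
satisfies `|ν(x) - (x - x̄)/|x - x̄|| ≤ ε` for every `x ∈ ∂K`. -/
def IsPerturbedBall (ε : ℝ) : Prop :=
  ∃ c : Euc n, ∀ x ∈ K.bdry, ‖K.normal x - ‖x - c‖⁻¹ • (x - c)‖ ≤ ε

end SmoothBody

/-- The area of the unit sphere `S^{n-1} ⊆ ℝⁿ`, i.e. its `(n-1)`-dimensional Hausdorff
measure (which is also the perimeter of the unit ball `B₁`). -/
def sphereArea (n : ℕ) : ℝ := (μH[(n : ℝ) - 1] (sphere (0 : Euc n) 1)).toReal

open Filter Topology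
open scoped NNReal

/-! ### Hausdorff measure under almost isometric maps -/

theorem hausdorffMeasure_image_le_of_dist_le {α Y Z : Type*} [MetricSpace Y] [MeasurableSpace Y]
    [BorelSpace Y] [MetricSpace Z] [MeasurableSpace Z] [BorelSpace Z] {d : ℝ} (hd : 0 ≤ d)
    (f : α → Y) (g : α → Z) (s : Set α) (K : ℝ≥0)
    (h : ∀ x ∈ s, ∀ y ∈ s, dist (f x) (f y) ≤ K * dist (g x) (g y)) :
    μH[d] (f '' s) ≤ (K : ℝ≥0∞) ^ d * μH[d] (g '' s) := by
  classical
  rcases s.eq_empty_or_nonempty with rfl | ⟨a, ha⟩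
  · simp
  have : Nonempty α := ⟨a⟩
  have hinv : ∀ x ∈ s, Function.invFunOn g s (g x) ∈ s ∧ g (Function.invFunOn g s (g x)) = g x :=
    fun x hx => Function.invFunOn_pos ⟨x, hx, rfl⟩
  have hL : LipschitzOnWith K (fun z => f (Function.invFunOn g s z)) (g '' s) := by
    refine LipschitzOnWith.of_dist_le_mul ?_
    rintro _ ⟨x, hx, rfl⟩ _ ⟨y, hy, rfl⟩
    have := h _ (hinv x hx).1 _ (hinv y hy).1
    rwa [(hinv x hx).2, (hinv y hy).2] at this
  have himg : f '' s ⊆ (fun z => f (Function.invFunOn g s z)) '' (g '' s) := by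
    rintro _ ⟨x, hx, rfl⟩
    refine ⟨g x, ⟨x, hx, rfl⟩, ?_⟩
    have := h _ (hinv x hx).1 _ hx
    rw [(hinv x hx).2, dist_self, mul_zero] at this
    exact dist_le_zero.1 this
  exact (measure_mono himg).trans (hL.hausdorffMeasure_image_le hd)

/-- The hyperplane orthogonal to `θ`. -/
abbrev hyper {n : ℕ} (θ : Euc n) : Submodule ℝ (Euc n) := (ℝ ∙ θ)ᗮ

theorem finrank_hyper {n : ℕ} (hn : 1 ≤ n) {θ : Euc n} (hθ : ‖θ‖ = 1) :
    (Module.finrank ℝ (hyper θ) : ℝ) = (n : ℝ) - 1 := by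
  have h0 : θ ≠ 0 := by rintro rfl; simp at hθ
  obtain ⟨m, rfl⟩ : ∃ m, n = m + 1 := ⟨n - 1, by omega⟩
  have : Fact (Module.finrank ℝ (Euc (m + 1)) = m + 1) := ⟨by simp⟩
  have := Submodule.finrank_orthogonal_span_singleton (𝕜 := ℝ) (n := m) h0
  rw [this]; push_cast; ring

theorem isAddHaar_hyper {n : ℕ} (hn : 1 ≤ n) {θ : Euc n} (hθ : ‖θ‖ = 1) :
    (μH[(n : ℝ) - 1] : Measure (hyper θ)).IsAddHaarMeasure := by
  rw [← finrank_hyper hn hθ]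
  exact isAddHaarMeasure_hausdorffMeasure

theorem mem_hyper {n : ℕ} {θ x : Euc n} : x ∈ hyper θ ↔ ⟪θ, x⟫ = 0 := by
  rw [Submodule.mem_orthogonal_singleton_iff_inner_right]

/-- Linear map of `θ^⊥` which stretches all lengths as `e ↦ e + ⟪p, e⟫ θ` does. -/
def stretch {n : ℕ} (θ : Euc n) (p : hyper θ) (a : ℝ) : hyper θ →ₗ[ℝ] hyper θ :=
  a • LinearMap.transvection (((1 + √(1 + ‖p‖ ^ 2))⁻¹) • (innerSL ℝ p).toLinearMap) p

theorem stretch_apply {n : ℕ} (θ : Euc n) (p : hyper θ) (a : ℝ) (e : hyper θ) :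
    stretch θ p a e = a • (e + ((1 + √(1 + ‖p‖ ^ 2))⁻¹ * ⟪p, e⟫) • p) := by
  simp [stretch, LinearMap.transvection]

theorem norm_stretch_sq {n : ℕ} (θ : Euc n) (p : hyper θ) (a : ℝ) (e : hyper θ) :
    ‖stretch θ p a e‖ ^ 2 = a ^ 2 * (‖e‖ ^ 2 + ⟪p, e⟫ ^ 2) := by
  rw [stretch_apply, norm_smul, mul_pow, norm_add_sq_real, norm_smul, inner_smul_right,
    real_inner_comm p e]
  set t := ⟪p, e⟫
  set s := ‖p‖
  have h1 : √(1 + s ^ 2) ^ 2 = 1 + s ^ 2 := Real.sq_sqrt (by positivity)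
  set k := √(1 + s ^ 2)
  have hk : 0 ≤ k := Real.sqrt_nonneg _
  have hk' : 1 + k ≠ 0 := by positivity
  rw [mul_pow, Real.norm_eq_abs, sq_abs, Real.norm_eq_abs, sq_abs]
  have hs : s ^ 2 = k ^ 2 - 1 := by linarith
  rw [hs]
  field_simp
  ring

theorem det_stretch {n : ℕ} (hn : 1 ≤ n) {θ : Euc n} (hθ : ‖θ‖ = 1) (p : hyper θ) (a : ℝ) :
    LinearMap.det (stretch θ p a) = a ^ (n - 1) * √(1 + ‖p‖ ^ 2) := by
  have hf : Module.finrank ℝ (hyper θ) = n - 1 := by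
    have := finrank_hyper hn hθ
    have h2 : ((n - 1 : ℕ) : ℝ) = (n : ℝ) - 1 := by push_cast [hn]; ring
    rw [← h2] at this
    exact_mod_cast this
  rw [stretch, LinearMap.det_smul, LinearMap.transvection.det, hf]
  congr 1
  simp only [LinearMap.smul_apply, ContinuousLinearMap.coe_coe, innerSL_apply_apply, smul_eq_mul,
    real_inner_self_eq_norm_sq]
  set s := ‖p‖
  have h1 : √(1 + s ^ 2) ^ 2 = 1 + s ^ 2 := Real.sq_sqrt (by positivity)
  set k := √(1 + s ^ 2)
  have hk : 0 ≤ k := Real.sqrt_nonneg _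
  have hk' : 1 + k ≠ 0 := by positivity
  have hs : s ^ 2 = k ^ 2 - 1 := by linarith
  rw [hs]
  field_simp
  ring

theorem hausdorffMeasure_stretch_image {n : ℕ} (hn : 1 ≤ n) {θ : Euc n} (hθ : ‖θ‖ = 1)
    (p : hyper θ) {a : ℝ} (ha : 0 < a) (s : Set (hyper θ)) :
    μH[(n : ℝ) - 1] (stretch θ p a '' s)
      = ENNReal.ofReal (a ^ (n - 1) * √(1 + ‖p‖ ^ 2)) * μH[(n : ℝ) - 1] s := by
  have := isAddHaar_hyper hn hθ
  rw [Measure.addHaar_image_linearMap, det_stretch hn hθ, abs_of_nonneg (by positivity)]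

/-! ### Radial graphs over the sphere and the area formula -/

/-- Positively `0`-homogeneous functions, smooth away from the origin. -/
structure RadialFun {n : ℕ} (U : Euc n → ℝ) : Prop where
  smooth : ∀ x, x ≠ 0 → ContDiffAt ℝ (⊤ : ℕ∞) U x
  hom : ∀ t : ℝ, 0 < t → ∀ x, U (t • x) = U x

/-- The map onto the radial graph of `exp U` centred at `c`. -/
def radialMap {n : ℕ} (c : Euc n) (U : Euc n → ℝ) (x : Euc n) : Euc n := c + exp (U x) • x

theorem inner_gradient_eq {n : ℕ} (f : Euc n → ℝ) (x v : Euc n) :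
    ⟪gradient f x, v⟫ = fderiv ℝ f x v := by
  rw [← toDual_gradient, InnerProductSpace.toDual_apply_apply]

theorem ne_zero_of_norm_one {n : ℕ} {θ : Euc n} (hθ : ‖θ‖ = 1) : θ ≠ 0 := by
  rintro rfl; simp at hθ

namespace RadialFun

variable {n : ℕ} {U : Euc n → ℝ}

theorem differentiableAt (hU : RadialFun U) {x : Euc n} (hx : x ≠ 0) : DifferentiableAt ℝ U x :=
  (hU.smooth x hx).differentiableAt (by simp)

theorem fderiv_self (hU : RadialFun U) {x : Euc n} (hx : x ≠ 0) : fderiv ℝ U x x = 0 := by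
  have h1 : HasDerivAt (fun t : ℝ => U (t • x)) (fderiv ℝ U x x) 1 := by
    have h2 : HasFDerivAt U (fderiv ℝ U x) ((1 : ℝ) • x) := by
      rw [one_smul]; exact (hU.differentiableAt hx).hasFDerivAt
    have h3 : HasDerivAt (fun t : ℝ => t • x) x 1 := by
      simpa using (hasDerivAt_id (1 : ℝ)).smul_const x
    exact h2.comp_hasDerivAt 1 h3
  have h4 : HasDerivAt (fun t : ℝ => U (t • x)) 0 1 := by
    refine (hasDerivAt_const (1 : ℝ) (U x)).congr_of_eventuallyEq ?_
    filter_upwards [eventually_gt_nhds (zero_lt_one' ℝ)] with t ht using hU.hom t ht x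
  exact h1.unique h4

theorem inner_gradient_self (hU : RadialFun U) {x : Euc n} (hx : x ≠ 0) :
    ⟪gradient U x, x⟫ = 0 := by
  rw [inner_gradient_eq, hU.fderiv_self hx]

/-- The gradient as a vector of the hyperplane `θ^⊥`. -/
def tangentGrad (hU : RadialFun U) {θ : Euc n} (hθ : ‖θ‖ = 1) : hyper θ :=
  ⟨gradient U θ, mem_hyper.2 (by
    rw [real_inner_comm]; exact hU.inner_gradient_self (ne_zero_of_norm_one hθ))⟩

end RadialFun

/-- The Jacobian of the radial graph map. -/
def radialJac {n : ℕ} (U : Euc n → ℝ) (x : Euc n) : ℝ :=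
  exp (U x) ^ (n - 1) * √(1 + ‖gradient U x‖ ^ 2)

theorem radialJac_pos {n : ℕ} (U : Euc n → ℝ) (x : Euc n) : 0 < radialJac U x := by
  unfold radialJac; positivity

theorem hasStrictFDerivAt_radialMap {n : ℕ} (c : Euc n) {U : Euc n → ℝ} (hU : RadialFun U)
    {x : Euc n} (hx : x ≠ 0) :
    HasStrictFDerivAt (radialMap c U)
      (exp (U x) • (ContinuousLinearMap.id ℝ (Euc n))
        + (exp (U x) • fderiv ℝ U x).smulRight x) x := by
  have h1 : HasStrictFDerivAt U (fderiv ℝ U x) x :=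
    (hU.smooth x hx).hasStrictFDerivAt (by simp)
  have h2 := (h1.exp.smul (hasStrictFDerivAt_id x)).const_add c
  exact h2

set_option maxHeartbeats 1000000 in
theorem exists_bilipschitz_nhds {n : ℕ} (c : Euc n) {U : Euc n → ℝ} (hU : RadialFun U)
    {θ : Euc n} (hθ : ‖θ‖ = 1) {η : ℝ} (hη : 0 < η) :
    ∃ V ∈ 𝓝 θ, ∀ x ∈ V ∩ sphere 0 1, ∀ y ∈ V ∩ sphere 0 1,
      dist x y ≤ (1 + η) * dist ((hyper θ).orthogonalProjectionOnto x)
        ((hyper θ).orthogonalProjectionOnto y) ∧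
      dist (radialMap c U x) (radialMap c U y) ≤ (1 + η) *
        dist (stretch θ (hU.tangentGrad hθ) (exp (U θ)) ((hyper θ).orthogonalProjectionOnto x))
          (stretch θ (hU.tangentGrad hθ) (exp (U θ)) ((hyper θ).orthogonalProjectionOnto y)) ∧
      dist (stretch θ (hU.tangentGrad hθ) (exp (U θ)) ((hyper θ).orthogonalProjectionOnto x))
          (stretch θ (hU.tangentGrad hθ) (exp (U θ)) ((hyper θ).orthogonalProjectionOnto y))
        ≤ (1 + η) * dist (radialMap c U x) (radialMap c U y) := by
  have h0 : θ ≠ 0 := ne_zero_of_norm_one hθ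
  set a := exp (U θ) with ha
  have hapos : 0 < a := exp_pos _
  set p := hU.tangentGrad hθ with hp
  have hpc : (p : Euc n) = gradient U θ := rfl
  set η' := η / (1 + η) with hη'
  have hη'pos : 0 < η' := by positivity
  have hη'lt : η' < 1 := by rw [hη', div_lt_one (by positivity)]; linarith
  have hη1 : (1 + η) * (1 - η') = 1 := by rw [hη']; field_simp; ring
  have hη2 : η' ≤ η := by
    rw [hη']; exact div_le_self hη.le (by linarith)
  set δ := min (1 / 2) (η' * (a / (2 * (1 + a)))) with hδ
  have hδpos : 0 < δ := by positivity
  have hδ2 : δ ≤ 1 / 2 := min_le_left _ _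
  have hδ3 : 2 * (1 + a) * δ ≤ η' * a := by
    have : δ ≤ η' * (a / (2 * (1 + a))) := min_le_right _ _
    calc 2 * (1 + a) * δ ≤ 2 * (1 + a) * (η' * (a / (2 * (1 + a)))) := by gcongr
      _ = η' * a := by field_simp
  have hδ4 : δ ≤ η' := by
    have : a * (2 * δ) ≤ a * η' := by nlinarith
    have := le_of_mul_le_mul_left this hapos
    linarith
  have hS := hasStrictFDerivAt_radialMap c hU h0
  have hO := hS.isLittleO.def hδpos
  rw [nhds_prod_eq, Filter.eventually_iff, Filter.mem_prod_self_iff] at hO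
  obtain ⟨V, hV, hVO⟩ := hO
  refine ⟨V ∩ ball θ δ, inter_mem hV (ball_mem_nhds _ hδpos), ?_⟩
  rintro x ⟨⟨hxV, hxb⟩, hxS⟩ y ⟨⟨hyV, hyb⟩, hyS⟩
  have hxy : ‖radialMap c U x - radialMap c U y - (a • (x - y)
      + (a * fderiv ℝ U θ (x - y)) • θ)‖ ≤ δ * ‖x - y‖ := by
    have := hVO (Set.mk_mem_prod hxV hyV)
    simpa using this
  set G := (hyper θ).orthogonalProjectionOnto with hG
  set M := stretch θ p a with hM
  rw [dist_eq_norm, dist_eq_norm, dist_eq_norm, dist_eq_norm, ← map_sub, ← map_sub]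
  set z := x - y with hz
  set g := G z with hg
  have hx1 : ‖x‖ = 1 := by simpa using hxS
  have hy1 : ‖y‖ = 1 := by simpa using hyS
  -- decomposition of z
  have hzdec : z = (g : Euc n) + ⟪θ, z⟫ • θ := by
    have h1 := Submodule.starProjection_add_starProjection_orthogonal (K := ℝ ∙ θ) z
    have h2 : (ℝ ∙ θ).starProjection z = ⟪θ, z⟫ • θ := by
      rw [Submodule.starProjection_unit_singleton ℝ hθ]
    have h3 : ((ℝ ∙ θ)ᗮ).starProjection z = (g : Euc n) := rfl
    rw [h2, h3, add_comm] at h1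
    exact h1.symm
  set α := ⟪θ, z⟫ with hα
  have hαle : |α| ≤ δ * ‖z‖ := by
    have h1 : ⟪x + y, z⟫ = 0 := by
      rw [hz, inner_add_left, inner_sub_right, inner_sub_right, real_inner_self_eq_norm_sq,
        real_inner_self_eq_norm_sq, real_inner_comm x y, hx1, hy1]; ring
    have h2 : α = ⟪(1 / 2 : ℝ) • ((θ - x) + (θ - y)), z⟫ := by
      have : (1 / 2 : ℝ) • ((θ - x) + (θ - y)) = θ - (1 / 2 : ℝ) • (x + y) := by
        module
      rw [this, inner_sub_left, inner_smul_left, h1]; simp [hα]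
    rw [h2]
    refine (abs_real_inner_le_norm _ _).trans ?_
    gcongr
    rw [norm_smul]
    have h3 : ‖θ - x‖ ≤ δ := by
      rw [← dist_eq_norm, dist_comm]; exact (mem_ball.1 hxb).le
    have h4 : ‖θ - y‖ ≤ δ := by
      rw [← dist_eq_norm, dist_comm]; exact (mem_ball.1 hyb).le
    have h5 := norm_add_le (θ - x) (θ - y)
    rw [Real.norm_of_nonneg (by norm_num)]
    linarith
  have hzle : ‖z‖ ≤ ‖g‖ + δ * ‖z‖ := by
    calc ‖z‖ = ‖(g : Euc n) + α • θ‖ := by rw [← hzdec]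
      _ ≤ ‖(g : Euc n)‖ + ‖α • θ‖ := norm_add_le _ _
      _ ≤ ‖g‖ + δ * ‖z‖ := by
          rw [norm_smul, hθ, mul_one, Real.norm_eq_abs, Submodule.coe_norm]; gcongr
  have hz0 : 0 ≤ ‖z‖ := norm_nonneg _
  have hzg : ‖z‖ ≤ 2 * ‖g‖ := by nlinarith
  have hMg : a * ‖g‖ ≤ ‖M g‖ := by
    have h1 := norm_stretch_sq θ p a g
    refine le_of_sq_le_sq ?_ (norm_nonneg _)
    rw [hM, h1]; nlinarith [sq_nonneg (a * ⟪p, g⟫)]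
  have hLg : ‖a • (g : Euc n) + (a * fderiv ℝ U θ (g : Euc n)) • θ‖ = ‖M g‖ := by
    have h1 := norm_stretch_sq θ p a g
    have h2 : fderiv ℝ U θ (g : Euc n) = ⟪p, g⟫ := by
      rw [← inner_gradient_eq]; rfl
    have h3 : ⟪(g : Euc n), θ⟫ = 0 := by
      rw [real_inner_comm]; exact mem_hyper.1 g.2
    rw [← sq_eq_sq₀ (norm_nonneg _) (norm_nonneg _), hM, h1, norm_add_sq_real, norm_smul,
      norm_smul, inner_smul_left, inner_smul_right, h3, h2, hθ, Submodule.coe_norm,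
      Real.norm_eq_abs, Real.norm_eq_abs, mul_pow, mul_pow, sq_abs, sq_abs]
    ring
  have hfd : fderiv ℝ U θ z = fderiv ℝ U θ (g : Euc n) := by
    conv_lhs => rw [hzdec]
    rw [map_add, map_smul, hU.fderiv_self h0]; simp
  have hLz : a • z + (a * fderiv ℝ U θ z) • θ
      = (a • (g : Euc n) + (a * fderiv ℝ U θ (g : Euc n)) • θ) + (a * α) • θ := by
    rw [hfd]
    conv_lhs => rw [hzdec]
    module
  set D := radialMap c U x - radialMap c U y with hD
  have herr : ‖D - (a • (g : Euc n) + (a * fderiv ℝ U θ (g : Euc n)) • θ)‖ ≤ η' * ‖M g‖ := by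
    have h1 : D - (a • (g : Euc n) + (a * fderiv ℝ U θ (g : Euc n)) • θ)
        = (D - (a • z + (a * fderiv ℝ U θ z) • θ)) + (a * α) • θ := by
      rw [hLz]; module
    rw [h1]
    calc _ ≤ ‖D - (a • z + (a * fderiv ℝ U θ z) • θ)‖ + ‖(a * α) • θ‖ := norm_add_le _ _
      _ ≤ δ * ‖z‖ + a * (δ * ‖z‖) := by
          rw [norm_smul, hθ, mul_one, Real.norm_eq_abs, abs_mul, abs_of_pos hapos]; gcongr
      _ = (1 + a) * δ * ‖z‖ := by ring
      _ ≤ (1 + a) * δ * (2 * ‖g‖) := by gcongr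
      _ = (2 * (1 + a) * δ) * ‖g‖ := by ring
      _ ≤ (η' * a) * ‖g‖ := by gcongr
      _ = η' * (a * ‖g‖) := by ring
      _ ≤ η' * ‖M g‖ := by gcongr
  have hDle : ‖D‖ ≤ ‖M g‖ + η' * ‖M g‖ := by
    have := norm_add_le (D - (a • (g : Euc n) + (a * fderiv ℝ U θ (g : Euc n)) • θ))
      (a • (g : Euc n) + (a * fderiv ℝ U θ (g : Euc n)) • θ)
    rw [sub_add_cancel, hLg] at this
    linarith
  have hDge : ‖M g‖ ≤ ‖D‖ + η' * ‖M g‖ := by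
    have := norm_sub_norm_le (a • (g : Euc n) + (a * fderiv ℝ U θ (g : Euc n)) • θ) D
    have h2 := norm_sub_rev (a • (g : Euc n) + (a * fderiv ℝ U θ (g : Euc n)) • θ) D
    rw [h2, hLg] at this
    linarith
  have hMn : 0 ≤ ‖M g‖ := norm_nonneg _
  have hgG : G x - G y = g := by rw [hg, hz, map_sub]
  have h1η : 0 ≤ 1 + η := by linarith
  rw [hgG]
  refine ⟨?_, ?_, ?_⟩
  · have h1 : (1 - η') * ‖z‖ ≤ ‖g‖ := by nlinarith
    have h2 := mul_le_mul_of_nonneg_left h1 h1η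
    rwa [← mul_assoc, hη1, one_mul] at h2
  · have h1 := mul_le_mul_of_nonneg_right hη2 hMn
    linarith
  · have h1 : (1 - η') * ‖M g‖ ≤ ‖D‖ := by linarith
    have h2 := mul_le_mul_of_nonneg_left h1 h1η
    rwa [← mul_assoc, hη1, one_mul] at h2

/-- The surface measure of the unit sphere. -/
def sphM (n : ℕ) : Measure (Euc n) := μH[(n : ℝ) - 1].restrict (sphere 0 1)

theorem Measure.le_of_forall_nhds {X : Type*} [TopologicalSpace X] [SecondCountableTopology X]
    [MeasurableSpace X] [OpensMeasurableSpace X] {μ ν : Measure X}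
    (h : ∀ x, ∃ V ∈ 𝓝 x, ∀ A ⊆ V, MeasurableSet A → μ A ≤ ν A) : μ ≤ ν := by
  choose V hV hle using h
  obtain ⟨s, hs, hcov⟩ := TopologicalSpace.countable_cover_nhds
    (f := fun x => interior (V x)) (fun x => interior_mem_nhds.2 (hV x))
  rw [Measure.le_iff]
  intro A hA
  rcases s.eq_empty_or_nonempty with rfl | hne
  · simp only [mem_empty_iff_false, iUnion_of_empty, iUnion_empty] at hcov
    have : A = ∅ := by
      apply eq_empty_of_subset_empty; rw [hcov]; exact subset_univ _
    simp [this]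
  obtain ⟨e, rfl⟩ := hs.exists_eq_range hne
  have hU : (⋃ i, disjointed (fun i => interior (V (e i))) i) = univ := by
    rw [iUnion_disjointed]; simpa using hcov
  have hm : ∀ i, MeasurableSet (disjointed (fun i => interior (V (e i))) i) :=
    fun i => MeasurableSet.disjointed (fun i => isOpen_interior.measurableSet) i
  have hA' : A = ⋃ i, A ∩ disjointed (fun i => interior (V (e i))) i := by
    rw [← inter_iUnion, hU, inter_univ]
  have hd : Pairwise (Function.onFun Disjoint
      fun i => A ∩ disjointed (fun i => interior (V (e i))) i) := fun i j hij =>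
    (disjoint_disjointed _ hij).mono inter_subset_right inter_subset_right
  rw [hA', measure_iUnion hd (fun i => hA.inter (hm i)),
    measure_iUnion hd (fun i => hA.inter (hm i))]
  refine ENNReal.tsum_le_tsum fun i => ?_
  refine hle (e i) _ ?_ (hA.inter (hm i))
  exact inter_subset_right.trans ((disjointed_subset _ _).trans interior_subset)

theorem ENNReal.le_of_forall_one_lt_mul_le {a b : ℝ≥0∞} (d : ℝ)
    (h : ∀ η : ℝ≥0, 0 < η → a ≤ ((1 : ℝ≥0∞) + η) ^ d * b) : a ≤ b := by
  have h1 : Tendsto (fun η : ℝ≥0 => ((1 : ℝ≥0∞) + η) ^ d * b) (𝓝[>] 0) (𝓝 b) := by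
    have h2 : Tendsto (fun η : ℝ≥0 => ((1 : ℝ≥0∞) + η) ^ d) (𝓝[>] 0) (𝓝 1) := by
      have h3 : Tendsto (fun η : ℝ≥0 => ((1 : ℝ≥0∞) + η)) (𝓝 0) (𝓝 (1 + (0 : ℝ≥0))) :=
        (tendsto_const_nhds).add (ENNReal.continuous_coe.tendsto 0)
      have h4 := (ENNReal.continuous_rpow_const (y := d)).tendsto (1 + ((0 : ℝ≥0) : ℝ≥0∞))
      have h5 := (h4.comp h3).mono_left (nhdsWithin_le_nhds (s := Ioi 0))
      simpa [Function.comp_def] using h5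
    simpa using ENNReal.Tendsto.mul_const h2 (Or.inl one_ne_zero)
  refine ge_of_tendsto h1 ?_
  filter_upwards [self_mem_nhdsWithin] with η hη using h η hη

theorem RadialFun.continuousAt_gradient {n : ℕ} {U : Euc n → ℝ} (hU : RadialFun U) {x : Euc n}
    (hx : x ≠ 0) : ContinuousAt (gradient U) x := by
  have h1 : ContinuousAt (fderiv ℝ U) x :=
    ((hU.smooth x hx).fderiv_right (m := 0) (by simp)).continuousAt
  exact (InnerProductSpace.toDual ℝ (Euc n)).symm.continuous.continuousAt.comp h1

theorem RadialFun.continuousAt_radialJac {n : ℕ} {U : Euc n → ℝ} (hU : RadialFun U) {x : Euc n}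
    (hx : x ≠ 0) : ContinuousAt (radialJac U) x := by
  have h1 := hU.continuousAt_gradient hx
  have h2 := (hU.differentiableAt hx).continuousAt
  unfold radialJac
  exact ((Real.continuous_exp.continuousAt.comp h2).pow _).mul
    ((continuousAt_const.add (h1.norm.pow 2)).sqrt)

theorem RadialFun.zero {n : ℕ} : RadialFun (fun _ : Euc n => (0 : ℝ)) :=
  ⟨fun _ _ => contDiffAt_const, fun _ _ _ => rfl⟩

theorem sub_one_nonneg {n : ℕ} (hn : 1 ≤ n) : 0 ≤ (n : ℝ) - 1 := by
  have : (1 : ℝ) ≤ n := by exact_mod_cast hn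
  linarith

theorem hausdorffMeasure_projection_le {n : ℕ} (hn : 1 ≤ n) (θ : Euc n) (A : Set (Euc n)) :
    μH[(n : ℝ) - 1] ((hyper θ).orthogonalProjectionOnto '' A) ≤ μH[(n : ℝ) - 1] A := by
  have h := hausdorffMeasure_image_le_of_dist_le (sub_one_nonneg hn)
    (hyper θ).orthogonalProjectionOnto id A 1 (fun x _ y _ => by
      rw [NNReal.coe_one, one_mul, dist_eq_norm, ← map_sub, id, id, dist_eq_norm]
      exact Submodule.norm_orthogonalProjectionOnto_apply_le _ _)
  simpa using h

theorem sphM_univ_lt_top {n : ℕ} (hn : 1 ≤ n) : μH[(n : ℝ) - 1] (sphere (0 : Euc n) 1) < ∞ := by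
  refine (isCompact_sphere 0 1).measure_lt_top_of_nhdsWithin fun θ hθ => ?_
  have hθ1 : ‖θ‖ = 1 := by simpa using hθ
  obtain ⟨V, hV, h⟩ := exists_bilipschitz_nhds 0 RadialFun.zero hθ1 one_pos
  refine ⟨V ∩ sphere 0 1, inter_mem (mem_nhdsWithin_of_mem_nhds hV) self_mem_nhdsWithin, ?_⟩
  have h1 := hausdorffMeasure_image_le_of_dist_le (sub_one_nonneg hn) id
    (hyper θ).orthogonalProjectionOnto (V ∩ sphere 0 1) 2 (fun x hx y hy => by
      have := (h x hx y hy).1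
      norm_num at this ⊢
      exact this)
  rw [image_id] at h1
  refine h1.trans_lt (ENNReal.mul_lt_top (ENNReal.rpow_lt_top_of_nonneg (sub_one_nonneg hn)
    (by simp)) ?_)
  have := isAddHaar_hyper hn hθ1
  refine lt_of_le_of_lt (measure_mono ?_) (measure_closedBall_lt_top (x := (0 : hyper θ)) (r := 1))
  rintro _ ⟨x, hx, rfl⟩
  have hx1 : ‖x‖ = 1 := by simpa using hx.2
  rw [mem_closedBall_zero_iff]
  exact (Submodule.norm_orthogonalProjectionOnto_apply_le _ _).trans hx1.le

theorem sphereArea_pos {n : ℕ} (hn : 1 ≤ n) : 0 < sphereArea n := by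
  refine ENNReal.toReal_pos ?_ (sphM_univ_lt_top hn).ne
  obtain ⟨θ, hθ⟩ : ∃ θ : Euc n, ‖θ‖ = 1 := ⟨EuclideanSpace.single ⟨0, hn⟩ 1, by simp⟩
  have hh := isAddHaar_hyper hn hθ
  have h1 : ball (0 : hyper θ) 1 ⊆ (hyper θ).orthogonalProjectionOnto '' sphere 0 1 := by
    intro e he
    rw [mem_ball_zero_iff] at he
    have h3 : ⟪(e : Euc n), θ⟫ = 0 := by rw [real_inner_comm]; exact mem_hyper.1 e.2
    refine ⟨e + √(1 - ‖e‖ ^ 2) • θ, ?_, ?_⟩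
    · rw [mem_sphere_zero_iff_norm, ← sq_eq_sq₀ (norm_nonneg _) zero_le_one, norm_add_sq_real,
        norm_smul, inner_smul_right, h3, hθ, Real.norm_of_nonneg (Real.sqrt_nonneg _), mul_one,
        Real.sq_sqrt (by nlinarith [norm_nonneg e]), Submodule.coe_norm]
      ring
    · rw [map_add, map_smul, Submodule.orthogonalProjectionOnto_mem_subspace_eq_self]
      have : (hyper θ).orthogonalProjectionOnto θ = 0 := by
        rw [Submodule.orthogonalProjectionOnto_eq_zero_iff, Submodule.orthogonal_orthogonal]
        exact Submodule.mem_span_singleton_self θ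
      rw [this]; simp
  have h2 : 0 < μH[(n : ℝ) - 1] (ball (0 : hyper θ) 1) := measure_ball_pos _ _ one_pos
  exact (h2.trans_le ((measure_mono h1).trans (hausdorffMeasure_projection_le hn θ _))).ne'

theorem isFiniteMeasure_sphM {n : ℕ} (hn : 1 ≤ n) : IsFiniteMeasure (sphM n) :=
  ⟨by rw [sphM, Measure.restrict_apply_univ]; exact sphM_univ_lt_top hn⟩

theorem injective_radialMap {n : ℕ} (c : Euc n) {U : Euc n → ℝ} (hU : RadialFun U) :
    Function.Injective (radialMap c U) := by
  intro x y h
  have h1 : exp (U x) • x = exp (U y) • y := by simpa [radialMap] using h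
  have h2 : U x = U y := by
    rw [← hU.hom _ (exp_pos (U x)) x, h1, hU.hom _ (exp_pos _)]
  rw [h2] at h1
  exact smul_right_injective _ (exp_pos _).ne' h1

theorem RadialFun.continuousOn_radialMap {n : ℕ} (c : Euc n) {U : Euc n → ℝ} (hU : RadialFun U) :
    ContinuousOn (radialMap c U) {0}ᶜ := by
  intro x hx
  exact (hasStrictFDerivAt_radialMap c hU hx).hasFDerivAt.continuousAt.continuousWithinAt

theorem RadialFun.measurableSet_image {n : ℕ} (c : Euc n) {U : Euc n → ℝ} (hU : RadialFun U)
    (s : Set (Euc n)) (hs : MeasurableSet s) : MeasurableSet (radialMap c U '' s) := by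
  rw [← sdiff_union_inter s {0}, image_union]
  refine MeasurableSet.union ?_ ?_
  · refine (hs.diff (measurableSet_singleton 0)).image_of_continuousOn_injOn
      ((hU.continuousOn_radialMap c).mono fun x hx => hx.2) (injective_radialMap c hU).injOn
  · exact ((Set.finite_singleton (0 : Euc n)).subset inter_subset_right |>.image _).measurableSet

theorem RadialFun.area_formula_aux {n : ℕ} (hn : 1 ≤ n) (c : Euc n) {U : Euc n → ℝ}
    (hU : RadialFun U) {θ : Euc n} (hθ : ‖θ‖ = 1) (η : ℝ≥0) (hη : 0 < η) :
    ∃ V ∈ 𝓝 θ, ∀ A ⊆ V, MeasurableSet A →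
      μH[(n : ℝ) - 1] (radialMap c U '' (A ∩ sphere 0 1))
        ≤ (1 + η) ^ ((n : ℝ) - 1 + ((n : ℝ) - 1) + 1) * ∫⁻ x in A ∩ sphere 0 1, ENNReal.ofReal (radialJac U x) ∂μH[(n : ℝ) - 1] ∧
      ∫⁻ x in A ∩ sphere 0 1, ENNReal.ofReal (radialJac U x) ∂μH[(n : ℝ) - 1]
        ≤ (1 + η) ^ ((n : ℝ) - 1 + ((n : ℝ) - 1) + 1)
          * μH[(n : ℝ) - 1] (radialMap c U '' (A ∩ sphere 0 1)) := by
  have hd := sub_one_nonneg hn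
  set d := (n : ℝ) - 1
  have h0 : θ ≠ 0 := ne_zero_of_norm_one hθ
  have hη' : (0 : ℝ) < η := hη
  obtain ⟨V, hV, hVb⟩ := exists_bilipschitz_nhds c hU hθ hη'
  have hJθ := radialJac_pos U θ
  have hc := hU.continuousAt_radialJac h0
  have e0 : radialJac U θ < (1 + η) * radialJac U θ := by nlinarith
  have e1 : ∀ᶠ x in 𝓝 θ, radialJac U θ < (1 + η) * radialJac U x :=
    (continuousAt_const.mul hc).eventually (lt_mem_nhds e0)
  have e2 : ∀ᶠ x in 𝓝 θ, radialJac U x < (1 + η) * radialJac U θ :=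
    hc.eventually (gt_mem_nhds e0)
  refine ⟨V ∩ {x | radialJac U θ < (1 + η) * radialJac U x
    ∧ radialJac U x < (1 + η) * radialJac U θ}, inter_mem hV (e1.and e2), ?_⟩
  intro A hAV hA
  set B := A ∩ sphere (0 : Euc n) 1 with hB
  have hBm : MeasurableSet B := hA.inter isClosed_sphere.measurableSet
  have hBV : ∀ x ∈ B, x ∈ V ∩ sphere 0 1 := fun x hx => ⟨(hAV hx.1).1, hx.2⟩
  set G := (hyper θ).orthogonalProjectionOnto
  set M := stretch θ (hU.tangentGrad hθ) (exp (U θ)) with hM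
  have hcast : ((1 + η : ℝ≥0) : ℝ≥0∞) = 1 + η := by simp
  have hcast' : ((1 + η : ℝ≥0) : ℝ) = 1 + η := by simp
  have i1 : μH[d] (radialMap c U '' B) ≤ (1 + η) ^ d * μH[d] ((fun x => M (G x)) '' B) := by
    rw [← hcast]
    refine hausdorffMeasure_image_le_of_dist_le hd _ _ B _ fun x hx y hy => ?_
    rw [hcast']
    exact (hVb x (hBV x hx) y (hBV y hy)).2.1
  have i2 : μH[d] ((fun x => M (G x)) '' B) ≤ (1 + η) ^ d * μH[d] (radialMap c U '' B) := by
    rw [← hcast]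
    refine hausdorffMeasure_image_le_of_dist_le hd _ _ B _ fun x hx y hy => ?_
    rw [hcast']
    exact (hVb x (hBV x hx) y (hBV y hy)).2.2
  have i3 : μH[d] B ≤ (1 + η) ^ d * μH[d] (G '' B) := by
    rw [← hcast]
    have := hausdorffMeasure_image_le_of_dist_le hd id G B (1 + η) fun x hx y hy => by
      rw [hcast']
      exact (hVb x (hBV x hx) y (hBV y hy)).1
    rwa [image_id] at this
  have i4 : μH[d] (G '' B) ≤ μH[d] B := hausdorffMeasure_projection_le hn θ B
  have i5 : μH[d] ((fun x => M (G x)) '' B) = ENNReal.ofReal (radialJac U θ) * μH[d] (G '' B) := by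
    have : (fun x => M (G x)) '' B = M '' (G '' B) := by rw [image_image]
    rw [this, hM, hausdorffMeasure_stretch_image hn hθ _ (exp_pos _)]
    rfl
  have hof : ∀ t : ℝ, ENNReal.ofReal ((1 + η) * t) = (1 + η) * ENNReal.ofReal t := fun t => by
    rw [ENNReal.ofReal_mul (by positivity), ENNReal.ofReal_add zero_le_one (by positivity)]
    simp
  have i6 : ENNReal.ofReal (radialJac U θ) * μH[d] B
      ≤ (1 + η) * ∫⁻ x in B, ENNReal.ofReal (radialJac U x) ∂μH[d] := by
    rw [← lintegral_const_mul' _ _ (by simp), ← setLIntegral_const]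
    refine setLIntegral_mono' hBm fun x hx => ?_
    rw [← hof]
    exact ENNReal.ofReal_le_ofReal (hAV hx.1).2.1.le
  have i7 : ∫⁻ x in B, ENNReal.ofReal (radialJac U x) ∂μH[d]
      ≤ (1 + η) * (ENNReal.ofReal (radialJac U θ) * μH[d] B) := by
    rw [← mul_assoc, ← hof, ← setLIntegral_const]
    exact setLIntegral_mono' hBm fun x hx => ENNReal.ofReal_le_ofReal (hAV hx.1).2.2.le
  have k0 : (1 + (η : ℝ≥0∞)) ≠ 0 := by simp
  have k1 : (1 + (η : ℝ≥0∞)) ≠ ∞ := by simp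
  have k2 : (1 : ℝ≥0∞) ≤ 1 + η := le_self_add
  rw [ENNReal.rpow_add _ _ k0 k1, ENNReal.rpow_add _ _ k0 k1, ENNReal.rpow_one]
  have k3 : (1 : ℝ≥0∞) ≤ (1 + η) ^ d := by
    simpa using ENNReal.rpow_le_rpow k2 hd
  constructor
  · calc μH[d] (radialMap c U '' B) ≤ (1 + η) ^ d * (ENNReal.ofReal (radialJac U θ) * μH[d] B) := by
          refine i1.trans ?_; rw [i5]; gcongr
      _ ≤ (1 + η) ^ d * ((1 + η) * ∫⁻ x in B, ENNReal.ofReal (radialJac U x) ∂μH[d]) := by gcongr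
      _ = 1 * (1 + η) ^ d * (1 + η) * ∫⁻ x in B, ENNReal.ofReal (radialJac U x) ∂μH[d] := by ring
      _ ≤ _ := by gcongr
  · calc _ ≤ (1 + η) * (ENNReal.ofReal (radialJac U θ) * μH[d] B) := i7
      _ ≤ (1 + η) * (ENNReal.ofReal (radialJac U θ) * ((1 + η) ^ d * μH[d] (G '' B))) := by gcongr
      _ = (1 + η) ^ d * (1 + η) * μH[d] ((fun x => M (G x)) '' B) := by rw [i5]; ring
      _ ≤ (1 + η) ^ d * (1 + η) * ((1 + η) ^ d * μH[d] (radialMap c U '' B)) := by gcongr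
      _ = _ := by ring

/-- The area formula for radial graphs. -/
theorem RadialFun.area_formula {n : ℕ} (hn : 1 ≤ n) (c : Euc n) {U : Euc n → ℝ}
    (hU : RadialFun U) {A : Set (Euc n)} (hA : MeasurableSet A) :
    μH[(n : ℝ) - 1] (radialMap c U '' (A ∩ sphere 0 1))
      = ∫⁻ x in A, ENNReal.ofReal (radialJac U x) ∂sphM n := by
  have hS : MeasurableSet (sphere (0 : Euc n) 1) := isClosed_sphere.measurableSet
  set m1 : Measure (Euc n) :=
    (Measure.comap (radialMap c U) μH[(n : ℝ) - 1]).restrict (sphere 0 1) with hm1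
  set m2 : Measure (Euc n) :=
    (sphM n).withDensity fun x => ENNReal.ofReal (radialJac U x) with hm2
  have a1 : ∀ B, MeasurableSet B →
      m1 B = μH[(n : ℝ) - 1] (radialMap c U '' (B ∩ sphere 0 1)) := fun B hB => by
    rw [hm1, Measure.restrict_apply hB, Measure.comap_apply _ (injective_radialMap c hU)
      (hU.measurableSet_image c) _ (hB.inter hS)]
  have a2 : ∀ B, MeasurableSet B → m2 B
      = ∫⁻ x in B ∩ sphere 0 1, ENNReal.ofReal (radialJac U x) ∂μH[(n : ℝ) - 1] := fun B hB => by
    rw [hm2, withDensity_apply _ hB, sphM, Measure.restrict_restrict hB]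
  have hout : ∀ x : Euc n, x ∉ sphere (0 : Euc n) 1 → ∃ V ∈ 𝓝 x, ∀ B ⊆ V, MeasurableSet B →
      m1 B = 0 ∧ m2 B = 0 := fun x hx => by
    refine ⟨(sphere 0 1)ᶜ, isClosed_sphere.isOpen_compl.mem_nhds hx, fun B hB hBm => ?_⟩
    have : B ∩ sphere 0 1 = ∅ := by
      rw [← disjoint_iff_inter_eq_empty]; exact disjoint_left.2 fun y hy => hB hy
    rw [a1 B hBm, a2 B hBm, this]; simp
  have key : ∀ η : ℝ≥0, 0 < η →
      m1 ≤ ((1 + (η : ℝ≥0∞)) ^ ((n : ℝ) - 1 + ((n : ℝ) - 1) + 1)) • m2 ∧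
      m2 ≤ ((1 + (η : ℝ≥0∞)) ^ ((n : ℝ) - 1 + ((n : ℝ) - 1) + 1)) • m1 := fun η hη => by
    constructor <;> refine Measure.le_of_forall_nhds fun x => ?_
    all_goals
      by_cases hx : x ∈ sphere (0 : Euc n) 1
      · obtain ⟨V, hV, h⟩ := hU.area_formula_aux hn c (θ := x) (by simpa using hx) η hη
        refine ⟨V, hV, fun B hB hBm => ?_⟩
        rw [Measure.smul_apply, a1 B hBm, a2 B hBm]
        first | exact (h B hB hBm).1 | exact (h B hB hBm).2
      · obtain ⟨V, hV, h⟩ := hout x hx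
        refine ⟨V, hV, fun B hB hBm => ?_⟩
        first | rw [(h B hB hBm).1] | rw [(h B hB hBm).2]
        exact zero_le
  rw [← withDensity_apply _ hA, ← a1 A hA]
  refine le_antisymm (ENNReal.le_of_forall_one_lt_mul_le ((n : ℝ) - 1 + ((n : ℝ) - 1) + 1)
    fun η hη => (key η hη).1 A) (ENNReal.le_of_forall_one_lt_mul_le
      ((n : ℝ) - 1 + ((n : ℝ) - 1) + 1) fun η hη => (key η hη).2 A)

theorem RadialFun.continuousOn_compl {n : ℕ} {U : Euc n → ℝ} (hU : RadialFun U) :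
    ContinuousOn U {0}ᶜ := fun _ hx => (hU.differentiableAt hx).continuousAt.continuousWithinAt

theorem RadialFun.measurable_radialJac {n : ℕ} {U : Euc n → ℝ} (hU : RadialFun U) :
    Measurable (radialJac U) :=
  measurable_of_continuousOn_compl_singleton 0
    fun _ hx => (hU.continuousAt_radialJac hx).continuousWithinAt

theorem RadialFun.measurableEmbedding {n : ℕ} (c : Euc n) {U : Euc n → ℝ} (hU : RadialFun U) :
    MeasurableEmbedding (radialMap c U) :=
  ⟨injective_radialMap c hU, measurable_of_continuousOn_compl_singleton 0
    (hU.continuousOn_radialMap c), fun {s} hs => hU.measurableSet_image c s hs⟩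

/-- Change of variables for integrals over radial graphs. -/
theorem RadialFun.setIntegral_image {n : ℕ} (hn : 1 ≤ n) (c : Euc n) {U : Euc n → ℝ}
    (hU : RadialFun U) {E : Type*} [NormedAddCommGroup E] [NormedSpace ℝ E] (f : Euc n → E) :
    ∫ x in radialMap c U '' sphere 0 1, f x ∂μH[(n : ℝ) - 1]
      = ∫ x, radialJac U x • f (radialMap c U x) ∂sphM n := by
  have hS : MeasurableSet (sphere (0 : Euc n) 1) := isClosed_sphere.measurableSet
  have he := hU.measurableEmbedding c
  have h1 : (Measure.comap (radialMap c U) μH[(n : ℝ) - 1]).restrict (sphere 0 1)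
      = (sphM n).withDensity fun x => ENNReal.ofReal (radialJac U x) := by
    ext B hB
    rw [Measure.restrict_apply hB, he.comap_apply, withDensity_apply _ hB, hU.area_formula hn c hB]
  have h2 : (μH[(n : ℝ) - 1] : Measure (Euc n)).restrict (radialMap c U '' sphere 0 1)
      = ((sphM n).withDensity fun x => ENNReal.ofReal (radialJac U x)).map (radialMap c U) := by
    rw [← h1]
    ext B hB
    rw [Measure.restrict_apply hB, Measure.map_apply he.measurable hB,
      Measure.restrict_apply (he.measurable hB), he.comap_apply, inter_comm,
      image_inter_preimage _ _ _ |>.symm, inter_comm]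
  rw [h2, he.integral_map, integral_withDensity_eq_integral_toReal_smul
    hU.measurable_radialJac.ennreal_ofReal (by simp)]
  simp only [ENNReal.toReal_ofReal (radialJac_pos U _).le]

/-- The area of a radial graph. -/
theorem RadialFun.area {n : ℕ} (hn : 1 ≤ n) (c : Euc n) {U : Euc n → ℝ} (hU : RadialFun U) :
    (μH[(n : ℝ) - 1] (radialMap c U '' sphere 0 1)).toReal = ∫ x, radialJac U x ∂sphM n := by
  have h := hU.setIntegral_image hn c (fun _ => (1 : ℝ))
  simp only [smul_eq_mul, mul_one] at h
  rw [← h, setIntegral_const]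
  simp [Measure.real]

/-! ### Integration over the sphere -/

theorem integrable_sphM {n : ℕ} (hn : 1 ≤ n) {E : Type*} [NormedAddCommGroup E] [NormedSpace ℝ E]
    {f : Euc n → E} (hf : ContinuousOn f (sphere 0 1)) : Integrable f (sphM n) := by
  have : IntegrableOn f (sphere 0 1) μH[(n : ℝ) - 1] :=
    hf.integrableOn_of_subset_isCompact (isCompact_sphere 0 1) isClosed_sphere.measurableSet
      subset_rfl (sphM_univ_lt_top hn).ne
  exact this

theorem ae_sphM {n : ℕ} {p : Euc n → Prop} (h : ∀ x : Euc n, ‖x‖ = 1 → p x) :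
    ∀ᵐ x ∂sphM n, p x := by
  rw [sphM, ae_restrict_iff' isClosed_sphere.measurableSet]
  exact Eventually.of_forall fun x hx => h x (by simpa using hx)

theorem integral_sphM_congr {n : ℕ} {E : Type*} [NormedAddCommGroup E] [NormedSpace ℝ E]
    {f g : Euc n → E} (h : ∀ x : Euc n, ‖x‖ = 1 → f x = g x) :
    ∫ x, f x ∂sphM n = ∫ x, g x ∂sphM n := integral_congr_ae (ae_sphM h)

theorem integral_sphM_mono {n : ℕ} (hn : 1 ≤ n) {f g : Euc n → ℝ}
    (hf : ContinuousOn f (sphere 0 1)) (hg : ContinuousOn g (sphere 0 1))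
    (h : ∀ x : Euc n, ‖x‖ = 1 → f x ≤ g x) : ∫ x, f x ∂sphM n ≤ ∫ x, g x ∂sphM n :=
  integral_mono_ae (integrable_sphM hn hf) (integrable_sphM hn hg) (ae_sphM h)

theorem integral_sphM_const {n : ℕ} (r : ℝ) : ∫ _, r ∂sphM n = sphereArea n * r := by
  rw [sphM, setIntegral_const, smul_eq_mul]; rfl

/-- The rotation by the angle `t` in the plane spanned by `a` and `b`, as a linear map. -/
def planeRot {n : ℕ} (a b : Euc n) (t : ℝ) : Euc n →ₗ[ℝ] Euc n :=
  LinearMap.id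
    + (innerSL ℝ ((cos t - 1) • a - sin t • b)).toLinearMap.smulRight a
    + (innerSL ℝ ((cos t - 1) • b + sin t • a)).toLinearMap.smulRight b

theorem planeRot_apply {n : ℕ} (a b : Euc n) (t : ℝ) (x : Euc n) :
    planeRot a b t x = x + ((cos t - 1) * ⟪a, x⟫ - sin t * ⟪b, x⟫) • a
      + ((cos t - 1) * ⟪b, x⟫ + sin t * ⟪a, x⟫) • b := by
  simp [planeRot]

theorem norm_planeRot {n : ℕ} {a b : Euc n} (ha : ‖a‖ = 1) (hb : ‖b‖ = 1) (hab : ⟪a, b⟫ = 0)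
    (t : ℝ) (x : Euc n) : ‖planeRot a b t x‖ = ‖x‖ := by
  rw [← sq_eq_sq₀ (norm_nonneg _) (norm_nonneg _), planeRot_apply, norm_add_sq_real,
    norm_add_sq_real, inner_add_left, norm_smul, norm_smul, inner_smul_right, inner_smul_right,
    inner_smul_right, inner_smul_left, hab, ha, hb, real_inner_comm x a, real_inner_comm x b,
    mul_one, mul_one, Real.norm_eq_abs, Real.norm_eq_abs, sq_abs, sq_abs]
  linear_combination (⟪x, a⟫ ^ 2 + ⟪x, b⟫ ^ 2) * (sin_sq_add_cos_sq t)

theorem integral_sphM_comp_planeRot {n : ℕ} {a b : Euc n} (ha : ‖a‖ = 1) (hb : ‖b‖ = 1)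
    (hab : ⟪a, b⟫ = 0) (t : ℝ) (f : Euc n → ℝ) :
    ∫ x, f (planeRot a b t x) ∂sphM n = ∫ x, f x ∂sphM n := by
  let L : Euc n →ₗᵢ[ℝ] Euc n := ⟨planeRot a b t, norm_planeRot ha hb hab t⟩
  let e := L.toLinearIsometryEquiv rfl
  have h1 := (e.toIsometryEquiv.measurePreserving_hausdorffMeasure
    ((n : ℝ) - 1)).setIntegral_preimage_emb
    e.toHomeomorph.measurableEmbedding f (sphere 0 1)
  have h2 : e.toIsometryEquiv ⁻¹' sphere 0 1 = sphere 0 1 := by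
    ext x
    simp
  rw [h2] at h1
  exact h1

theorem hasDerivAt_planeRot {n : ℕ} (a b x : Euc n) (t : ℝ) :
    HasDerivAt (fun t => planeRot a b t x) ((-sin t * ⟪a, x⟫ - cos t * ⟪b, x⟫) • a
      + (-sin t * ⟪b, x⟫ + cos t * ⟪a, x⟫) • b) t := by
  simp only [planeRot_apply]
  have hc := (hasDerivAt_cos t).sub_const 1
  have hs := hasDerivAt_sin t
  have h1 := (((hc.mul_const ⟪a, x⟫).sub (hs.mul_const ⟪b, x⟫)).smul_const a).const_add x
  have h2 := ((hc.mul_const ⟪b, x⟫).add (hs.mul_const ⟪a, x⟫)).smul_const b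
  exact h1.add h2

theorem integral_fderiv_rotation {n : ℕ} (hn : 1 ≤ n) {a b : Euc n} (ha : ‖a‖ = 1) (hb : ‖b‖ = 1)
    (hab : ⟪a, b⟫ = 0) {f : Euc n → ℝ} (hf : ∀ x, x ≠ 0 → ContDiffAt ℝ 1 f x) :
    ∫ x, fderiv ℝ f x (⟪a, x⟫ • b - ⟪b, x⟫ • a) ∂sphM n = 0 := by
  have hS0 : ∀ x ∈ sphere (0 : Euc n) 1, x ≠ 0 := fun x hx =>
    ne_zero_of_norm_one (by simpa using hx)
  have hfc : ContinuousOn f (sphere 0 1) := fun x hx =>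
    (hf x (hS0 x hx)).continuousAt.continuousWithinAt
  have hdc : ContinuousOn (fderiv ℝ f) (sphere 0 1) := fun x hx =>
    ((hf x (hS0 x hx)).fderiv_right (m := 0) (by simp)).continuousAt.continuousWithinAt
  have hRc : ∀ t, Continuous (planeRot a b t) := fun t =>
    (planeRot a b t).continuous_of_finiteDimensional
  have hRS : ∀ t, MapsTo (planeRot a b t) (sphere 0 1) (sphere 0 1) := fun t x hx => by
    simpa [norm_planeRot ha hb hab] using hx
  obtain ⟨C, hC⟩ := (isCompact_sphere (0 : Euc n) 1).exists_bound_of_continuousOn hdc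
  set R' : ℝ → Euc n → Euc n := fun t x => (-sin t * ⟪a, x⟫ - cos t * ⟪b, x⟫) • a
      + (-sin t * ⟪b, x⟫ + cos t * ⟪a, x⟫) • b with hR'
  have hR'b : ∀ t x, ‖x‖ = 1 → ‖R' t x‖ ≤ 4 := fun t x hx => by
    have h1 : |⟪a, x⟫| ≤ 1 := by simpa [ha, hx] using abs_real_inner_le_norm a x
    have h2 : |⟪b, x⟫| ≤ 1 := by simpa [hb, hx] using abs_real_inner_le_norm b x
    have h3 := abs_sin_le_one t
    have h4 := abs_cos_le_one t
    have m : ∀ y z : ℝ, |y| ≤ 1 → |z| ≤ 1 → |y * z| ≤ 1 := fun y z hy hz => by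
      rw [abs_mul]; exact mul_le_one₀ hy (abs_nonneg _) hz
    have e1 := abs_le.1 (m _ _ h3 h1)
    have e2 := abs_le.1 (m _ _ h4 h2)
    have e3 := abs_le.1 (m _ _ h3 h2)
    have e4 := abs_le.1 (m _ _ h4 h1)
    refine (norm_add_le _ _).trans ?_
    rw [norm_smul, norm_smul, ha, hb, Real.norm_eq_abs, Real.norm_eq_abs]
    have e5 : |-sin t * ⟪a, x⟫ - cos t * ⟪b, x⟫| ≤ 2 := abs_le.2 ⟨by linarith, by linarith⟩
    have e6 : |-sin t * ⟪b, x⟫ + cos t * ⟪a, x⟫| ≤ 2 := abs_le.2 ⟨by linarith, by linarith⟩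
    linarith
  have key := hasDerivAt_integral_of_dominated_loc_of_deriv_le (μ := sphM n) (x₀ := (0 : ℝ))
    (F := fun t x => f (planeRot a b t x)) (F' := fun t x => fderiv ℝ f (planeRot a b t x) (R' t x))
    (bound := fun _ => C * 4) univ_mem
    (Eventually.of_forall fun t => (integrable_sphM hn
      (hfc.comp (hRc t).continuousOn (hRS t))).aestronglyMeasurable)
    (integrable_sphM hn (hfc.comp (hRc 0).continuousOn (hRS 0)))
    (integrable_sphM hn ((hdc.comp (hRc 0).continuousOn (hRS 0)).clm_apply
      (by simp only [hR']; fun_prop))).aestronglyMeasurable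
    (ae_sphM fun x hx t _ => by
      have hx' := hRS t (show x ∈ sphere 0 1 by simpa using hx)
      refine (ContinuousLinearMap.le_opNorm _ _).trans ?_
      exact mul_le_mul (hC _ hx') (hR'b t x hx) (norm_nonneg _) ((norm_nonneg _).trans (hC _ hx')))
    (integrable_sphM hn continuousOn_const)
    (ae_sphM fun x hx t _ => by
      have hx' := hRS t (show x ∈ sphere 0 1 by simpa using hx)
      exact ((hf _ (hS0 _ hx')).differentiableAt (by simp)).hasFDerivAt.comp_hasDerivAt t
        (hasDerivAt_planeRot a b x t))
  have h2 : (fun t => ∫ x, f (planeRot a b t x) ∂sphM n) = fun _ => ∫ x, f x ∂sphM n :=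
    funext fun t => integral_sphM_comp_planeRot ha hb hab t f
  have h3 := key.2
  rw [h2] at h3
  have h4 := h3.unique (hasDerivAt_const _ _)
  rw [← h4]
  refine integral_sphM_congr fun x _ => ?_
  have h5 : planeRot a b 0 x = x := by simp [planeRot_apply]
  simp only [hR', h5]
  congr 1
  simp [sub_eq_add_neg, add_comm]

theorem divg_eq_sum {n : ℕ} (X : Euc n → Euc n) (x : Euc n) :
    divg X x = ∑ i, fderiv ℝ X x (EuclideanSpace.single i 1) i := by
  rw [divg, LinearMap.trace_eq_sum_inner _ (EuclideanSpace.basisFun (Fin n) ℝ)]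
  simp [EuclideanSpace.inner_single_left]

theorem euc_eq_sum {n : ℕ} (x : Euc n) : x = ∑ i, x i • EuclideanSpace.single i (1 : ℝ) := by
  have := ((EuclideanSpace.basisFun (Fin n) ℝ).sum_repr x).symm
  simpa using this

/-- The divergence theorem on the sphere for tangential fields. -/
theorem integral_divg_eq_zero {n : ℕ} (hn : 1 ≤ n) {X : Euc n → Euc n}
    (hX : ∀ x, x ≠ 0 → ContDiffAt ℝ 1 X x) (ht : ∀ x, x ≠ 0 → ⟪X x, x⟫ = 0) :
    ∫ x, divg X x ∂sphM n = 0 := by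
  set e : Fin n → Euc n := fun i => EuclideanSpace.single i (1 : ℝ) with he
  have hcoord : ∀ i : Fin n, ContDiff ℝ 1 (fun x : Euc n => x i) := fun i => by fun_prop
  have hXj : ∀ (j : Fin n) x, x ≠ 0 → ContDiffAt ℝ 1 (fun x => X x j) x := fun j x hx =>
    (hcoord j).contDiffAt.comp x (hX x hx)
  have hfij : ∀ (i j : Fin n) x, x ≠ 0 → ContDiffAt ℝ 1 (fun x => x i * X x j) x :=
    fun i j x hx => (hcoord i).contDiffAt.mul (hXj j x hx)
  have hzero : ∀ i j : Fin n,
      ∫ x, fderiv ℝ (fun x => x i * X x j) x (x i • e j - x j • e i) ∂sphM n = 0 := by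
    intro i j
    by_cases hij : i = j
    · subst hij; simp
    · have := integral_fderiv_rotation hn (a := e i) (b := e j) (by simp [he]) (by simp [he])
        (by simp [he, EuclideanSpace.inner_single_left, hij]) (hfij i j)
      simpa [he, EuclideanSpace.inner_single_left] using this
  have hint : ∀ i j : Fin n, Integrable
      (fun x => fderiv ℝ (fun x => x i * X x j) x (x i • e j - x j • e i)) (sphM n) := by
    intro i j
    refine integrable_sphM hn fun x hx => ?_
    have hx0 : x ≠ 0 := ne_zero_of_norm_one (by simpa using hx)
    have h1 : ContinuousAt (fderiv ℝ (fun x => x i * X x j)) x :=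
      ((hfij i j x hx0).fderiv_right (m := 0) (by simp)).continuousAt
    exact (h1.clm_apply (by fun_prop)).continuousWithinAt
  have hsum : ∑ i, ∑ j, ∫ x, fderiv ℝ (fun x => x i * X x j) x (x i • e j - x j • e i) ∂sphM n
      = 0 :=
    Finset.sum_eq_zero fun i _ => Finset.sum_eq_zero fun j _ => hzero i j
  have hsw : ∫ x, ∑ i, ∑ j, fderiv ℝ (fun x => x i * X x j) x (x i • e j - x j • e i) ∂sphM n
      = 0 := by
    rw [integral_finsetSum _ fun i _ => integrable_finsetSum _ fun j _ => hint i j, ← hsum]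
    refine Finset.sum_congr rfl fun i _ => ?_
    rw [integral_finsetSum _ fun j _ => hint i j]
  rw [← hsw]
  refine integral_sphM_congr fun x hx => ?_
  have hx0 := ne_zero_of_norm_one hx
  have hXd : DifferentiableAt ℝ X x := (hX x hx0).differentiableAt (by simp)
  set T := fderiv ℝ X x with hT
  have hd : ∀ i j (v : Euc n), fderiv ℝ (fun x => x i * X x j) x v = x i * T v j + v i * X x j := by
    intro i j v
    have h1 : HasFDerivAt (fun x : Euc n => x i) (EuclideanSpace.proj i : Euc n →L[ℝ] ℝ) x :=
      (EuclideanSpace.proj i : Euc n →L[ℝ] ℝ).hasFDerivAt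
    have h2 : HasFDerivAt (fun x : Euc n => X x j)
        ((EuclideanSpace.proj j : Euc n →L[ℝ] ℝ) ∘L T) x :=
      (EuclideanSpace.proj j : Euc n →L[ℝ] ℝ).hasFDerivAt.comp x hXd.hasFDerivAt
    have h3 : HasFDerivAt (fun y : Euc n => y i * X y j) _ x := h1.mul h2
    rw [h3.fderiv]
    simp [mul_comm]
  have hTx : T x = ∑ i, x i • T (e i) := by
    conv_lhs => rw [euc_eq_sum x]
    simp [he]
  have hXx : ∑ j, x j * X x j = 0 := by
    have := ht x hx0
    rw [PiLp.inner_apply] at this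
    simpa [mul_comm] using this
  have hTxx : ∑ j, x j * T x j = 0 := by
    have h1 : HasFDerivAt (fun y => ⟪X y, y⟫) _ x := hXd.hasFDerivAt.inner ℝ (hasFDerivAt_id x)
    have h2 : HasFDerivAt (fun y => ⟪X y, y⟫) (0 : Euc n →L[ℝ] ℝ) x := by
      refine (hasFDerivAt_const (0 : ℝ) x).congr_of_eventuallyEq ?_
      filter_upwards [isOpen_ne.mem_nhds hx0] with y hy using ht y hy
    have h3 := congrArg (fun L : Euc n →L[ℝ] ℝ => L x) (h1.unique h2)
    simp [fderivInnerCLM_apply, ht x hx0] at h3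
    rw [PiLp.inner_apply] at h3
    simpa [mul_comm] using h3
  have hxx : ∑ i, x i * x i = 1 := by
    have := EuclideanSpace.real_norm_sq_eq x
    rw [hx] at this
    simpa [sq] using this.symm
  have hdelta : ∀ i j : Fin n, (e j) i = if i = j then 1 else 0 := fun i j => by
    simp [he]
  have hterm : ∀ i j, fderiv ℝ (fun x => x i * X x j) x (x i • e j - x j • e i)
      = (x i * x i) * T (e j) j - x j * (x i * T (e i) j) + (if i = j then x i * X x j else 0)
        - x j * X x j := by
    intro i j
    rw [hd]
    simp only [map_sub, map_smul, PiLp.sub_apply, PiLp.smul_apply, smul_eq_mul, hdelta]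
    split_ifs <;> simp <;> ring
  simp only [hterm, Finset.sum_add_distrib, Finset.sum_sub_distrib]
  have s1 : ∑ i, ∑ j, x i * x i * T (e j) j = divg X x := by
    rw [divg_eq_sum, ← Finset.sum_mul_sum, hxx, one_mul]
  have s2 : ∑ i, ∑ j, x j * (x i * T (e i) j) = 0 := by
    rw [Finset.sum_comm, ← hTxx]
    refine Finset.sum_congr rfl fun j _ => ?_
    rw [← Finset.mul_sum, hTx]
    simp
  have s3 : ∑ i, ∑ j, (if i = j then x i * X x j else 0) = 0 := by simp [hXx]
  rw [s1, s2, s3]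
  simp [hXx]

/-! ### Radial functions: algebra, gradient and Laplacian -/

namespace RadialFun

variable {n : ℕ} {f g : Euc n → ℝ}

theorem const (r : ℝ) : RadialFun (fun _ : Euc n => r) :=
  ⟨fun _ _ => contDiffAt_const, fun _ _ _ => rfl⟩

theorem add (hf : RadialFun f) (hg : RadialFun g) : RadialFun (fun x => f x + g x) :=
  ⟨fun x hx => (hf.smooth x hx).add (hg.smooth x hx), fun t ht x => by
    rw [hf.hom t ht, hg.hom t ht]⟩

theorem mul (hf : RadialFun f) (hg : RadialFun g) : RadialFun (fun x => f x * g x) :=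
  ⟨fun x hx => (hf.smooth x hx).mul (hg.smooth x hx), fun t ht x => by
    rw [hf.hom t ht, hg.hom t ht]⟩

theorem const_mul (r : ℝ) (hf : RadialFun f) : RadialFun (fun x => r * f x) := (const r).mul hf

theorem sub (hf : RadialFun f) (hg : RadialFun g) : RadialFun (fun x => f x - g x) :=
  ⟨fun x hx => (hf.smooth x hx).sub (hg.smooth x hx), fun t ht x => by
    rw [hf.hom t ht, hg.hom t ht]⟩

theorem pow (hf : RadialFun f) (k : ℕ) : RadialFun (fun x => f x ^ k) :=
  ⟨fun x hx => (hf.smooth x hx).pow k, fun t ht x => by rw [hf.hom t ht]⟩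

theorem exp_comp (hf : RadialFun f) : RadialFun (fun x => Real.exp (f x)) :=
  ⟨fun x hx => (hf.smooth x hx).exp, fun t ht x => by rw [hf.hom t ht]⟩

theorem continuousOn_sphere (hf : RadialFun f) : ContinuousOn f (sphere 0 1) :=
  hf.continuousOn_compl.mono fun _ hx => ne_zero_of_norm_one (by simpa using hx)

theorem contDiffAt_gradient (hf : RadialFun f) {x : Euc n} (hx : x ≠ 0) :
    ContDiffAt ℝ (⊤ : ℕ∞) (gradient f) x := by
  have h1 : ContDiffAt ℝ (⊤ : ℕ∞) (fderiv ℝ f) x := (hf.smooth x hx).fderiv_right (by simp)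
  exact (InnerProductSpace.toDual ℝ (Euc n)).symm.contDiff.contDiffAt.comp x h1

theorem differentiableAt_gradient (hf : RadialFun f) {x : Euc n} (hx : x ≠ 0) :
    DifferentiableAt ℝ (gradient f) x := (hf.contDiffAt_gradient hx).differentiableAt (by simp)

theorem continuousOn_gradient (hf : RadialFun f) : ContinuousOn (gradient f) (sphere 0 1) :=
  fun _ hx => (hf.continuousAt_gradient
    (ne_zero_of_norm_one (by simpa using hx))).continuousWithinAt

end RadialFun

/-- The Hessian, as derivative of the gradient. -/
def hess {n : ℕ} (f : Euc n → ℝ) (x : Euc n) : Euc n →L[ℝ] Euc n := fderiv ℝ (gradient f) x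

/-- The Laplacian. -/
def lap {n : ℕ} (f : Euc n → ℝ) (x : Euc n) : ℝ := divg (gradient f) x

theorem divg_congr {n : ℕ} {X Y : Euc n → Euc n} {x : Euc n} (h : X =ᶠ[𝓝 x] Y) :
    divg X x = divg Y x := by rw [divg, divg, h.fderiv_eq]

theorem divg_smul {n : ℕ} {φ : Euc n → ℝ} {Y : Euc n → Euc n} {x : Euc n}
    (hφ : DifferentiableAt ℝ φ x) (hY : DifferentiableAt ℝ Y x) :
    divg (fun y => φ y • Y y) x = φ x * divg Y x + fderiv ℝ φ x (Y x) := by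
  have h : fderiv ℝ (fun y => φ y • Y y) x = φ x • fderiv ℝ Y x + (fderiv ℝ φ x).smulRight (Y x) :=
    (hφ.hasFDerivAt.smul hY.hasFDerivAt).fderiv
  rw [divg, divg, h]
  have h2 : ((φ x • fderiv ℝ Y x + (fderiv ℝ φ x).smulRight (Y x) : Euc n →L[ℝ] Euc n) :
      Euc n →ₗ[ℝ] Euc n) = φ x • (fderiv ℝ Y x : Euc n →ₗ[ℝ] Euc n)
        + (fderiv ℝ φ x : Euc n →ₗ[ℝ] ℝ).smulRight (Y x) := rfl
  rw [h2, map_add, map_smul, LinearMap.trace_smulRight]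
  rfl

theorem divg_add {n : ℕ} {X Y : Euc n → Euc n} {x : Euc n}
    (hX : DifferentiableAt ℝ X x) (hY : DifferentiableAt ℝ Y x) :
    divg (fun y => X y + Y y) x = divg X x + divg Y x := by
  have h : fderiv ℝ (fun y => X y + Y y) x = fderiv ℝ X x + fderiv ℝ Y x :=
    (hX.hasFDerivAt.add hY.hasFDerivAt).fderiv
  rw [divg, divg, divg, h, ← map_add]
  rfl

theorem divg_id {n : ℕ} (x : Euc n) : divg (fun y : Euc n => y) x = n := by
  have h : fderiv ℝ (fun y : Euc n => y) x = ContinuousLinearMap.id ℝ _ := fderiv_id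
  rw [divg, h]
  have := LinearMap.trace_id ℝ (Euc n)
  rw [finrank_euclideanSpace_fin] at this
  exact this

theorem divg_const {n : ℕ} (a x : Euc n) : divg (fun _ : Euc n => a) x = 0 := by
  simp [divg]

theorem HasFDerivAt.gradient_eq {n : ℕ} {f : Euc n → ℝ} {x v : Euc n}
    (h : HasFDerivAt f (innerSL ℝ v) x) : gradient f x = v := by
  refine ext_inner_right ℝ fun w => ?_
  rw [inner_gradient_eq, h.fderiv]; rfl

theorem gradient_add' {n : ℕ} {f g : Euc n → ℝ} {x : Euc n}
    (hf : DifferentiableAt ℝ f x) (hg : DifferentiableAt ℝ g x) :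
    gradient (fun y => f y + g y) x = gradient f x + gradient g x := by
  refine ext_inner_right ℝ fun w => ?_
  rw [inner_add_left, inner_gradient_eq, inner_gradient_eq, inner_gradient_eq,
    (hf.hasFDerivAt.add hg.hasFDerivAt).fderiv (f := fun y => f y + g y)]
  rfl

theorem gradient_sub' {n : ℕ} {f g : Euc n → ℝ} {x : Euc n}
    (hf : DifferentiableAt ℝ f x) (hg : DifferentiableAt ℝ g x) :
    gradient (fun y => f y - g y) x = gradient f x - gradient g x := by
  refine ext_inner_right ℝ fun w => ?_
  rw [inner_sub_left, inner_gradient_eq, inner_gradient_eq, inner_gradient_eq,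
    (hf.hasFDerivAt.sub hg.hasFDerivAt).fderiv (f := fun y => f y - g y)]
  rfl

theorem gradient_const_mul {n : ℕ} {f : Euc n → ℝ} {x : Euc n} (r : ℝ)
    (hf : DifferentiableAt ℝ f x) : gradient (fun y => r * f y) x = r • gradient f x := by
  refine ext_inner_right ℝ fun w => ?_
  rw [inner_smul_left, inner_gradient_eq, inner_gradient_eq, fderiv_const_mul hf]
  rfl

theorem gradient_pow' {n : ℕ} {f : Euc n → ℝ} {x : Euc n} (hf : DifferentiableAt ℝ f x) (k : ℕ) :
    gradient (fun y => f y ^ k) x = (k * f x ^ (k - 1)) • gradient f x := by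
  refine ext_inner_right ℝ fun w => ?_
  rw [inner_smul_left, inner_gradient_eq, inner_gradient_eq,
    (hf.hasFDerivAt.pow k).fderiv (f := fun y => f y ^ k)]
  simp

theorem eventually_ne_zero {n : ℕ} {x : Euc n} (hx : x ≠ 0) : ∀ᶠ y in 𝓝 x, y ≠ 0 :=
  isOpen_ne.mem_nhds hx

namespace RadialFun

variable {n : ℕ} {f g : Euc n → ℝ}

theorem lap_add (hf : RadialFun f) (hg : RadialFun g) {x : Euc n} (hx : x ≠ 0) :
    lap (fun y => f y + g y) x = lap f x + lap g x := by
  have h : gradient (fun y => f y + g y) =ᶠ[𝓝 x] fun y => gradient f y + gradient g y := by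
    filter_upwards [eventually_ne_zero hx] with y hy
    exact gradient_add' (hf.differentiableAt hy) (hg.differentiableAt hy)
  rw [lap, divg_congr h, divg_add (hf.differentiableAt_gradient hx)
    (hg.differentiableAt_gradient hx)]
  rfl

theorem lap_const_mul (hf : RadialFun f) (r : ℝ) {x : Euc n} (hx : x ≠ 0) :
    lap (fun y => r * f y) x = r * lap f x := by
  have h : gradient (fun y => r * f y) =ᶠ[𝓝 x] fun y => r • gradient f y := by
    filter_upwards [eventually_ne_zero hx] with y hy
    exact gradient_const_mul r (hf.differentiableAt hy)
  rw [lap, divg_congr h, divg_smul (differentiableAt_const r) (hf.differentiableAt_gradient hx)]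
  simp [lap]

theorem lap_pow (hf : RadialFun f) (k : ℕ) {x : Euc n} (hx : x ≠ 0) :
    lap (fun y => f y ^ k) x = k * f x ^ (k - 1) * lap f x
      + k * ((k - 1 : ℕ) * f x ^ (k - 1 - 1)) * ‖gradient f x‖ ^ 2 := by
  have h : gradient (fun y => f y ^ k) =ᶠ[𝓝 x] fun y => (k * f y ^ (k - 1)) • gradient f y := by
    filter_upwards [eventually_ne_zero hx] with y hy
    exact gradient_pow' (hf.differentiableAt hy) k
  have hp := (hf.pow (k - 1)).differentiableAt hx
  rw [lap, divg_congr h, divg_smul (hp.const_mul _) (hf.differentiableAt_gradient hx),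
    fderiv_const_mul hp, smul_apply, ← inner_gradient_eq,
    gradient_pow' (hf.differentiableAt hx), inner_smul_left, real_inner_self_eq_norm_sq, lap]
  simp
  ring

theorem continuousAt_hess (hg : RadialFun g) {x : Euc n} (hx : x ≠ 0) :
    ContinuousAt (hess g) x :=
  ((hg.contDiffAt_gradient hx).fderiv_right (m := 0) (by simp)).continuousAt

theorem continuousOn_lap (hg : RadialFun g) : ContinuousOn (lap g) (sphere 0 1) := fun x hx => by
  have hx0 : x ≠ 0 := ne_zero_of_norm_one (by simpa using hx)
  have h4 : lap g = fun y => ∑ i, hess g y (EuclideanSpace.single i 1) i :=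
    funext fun y => divg_eq_sum _ _
  rw [h4]
  have h5 : ContinuousAt (fun y => ∑ i, hess g y (EuclideanSpace.single i 1) i) x :=
    tendsto_finsetSum _ fun i _ =>
      ((EuclideanSpace.proj i : Euc n →L[ℝ] ℝ).continuous.continuousAt.comp
        ((hg.continuousAt_hess hx0).clm_apply continuousAt_const))
  exact h5.continuousWithinAt

/-- Green's formula on the sphere. -/
theorem green (hn : 1 ≤ n) (hf : RadialFun f) (hg : RadialFun g) :
    ∫ x, ⟪gradient f x, gradient g x⟫ ∂sphM n = - ∫ x, f x * lap g x ∂sphM n := by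
  have h1 := integral_divg_eq_zero hn (X := fun x => f x • gradient g x)
    (fun x hx => (((hf.smooth x hx).smul (hg.contDiffAt_gradient hx)).of_le (by simp)))
    (fun x hx => by rw [inner_smul_left, hg.inner_gradient_self hx, mul_zero])
  have h2 : ∫ x, divg (fun x => f x • gradient g x) x ∂sphM n
      = ∫ x, (f x * lap g x + ⟪gradient f x, gradient g x⟫) ∂sphM n := by
    refine integral_sphM_congr fun x hx => ?_
    have hx0 := ne_zero_of_norm_one hx
    rw [divg_smul (hf.differentiableAt hx0) (hg.differentiableAt_gradient hx0),
      inner_gradient_eq]; rfl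
  have i1 : Integrable (fun x => f x * lap g x) (sphM n) :=
    integrable_sphM hn (hf.continuousOn_sphere.mul hg.continuousOn_lap)
  have i2 : Integrable (fun x => ⟪gradient f x, gradient g x⟫) (sphM n) :=
    integrable_sphM hn (hf.continuousOn_gradient.inner hg.continuousOn_gradient)
  rw [h2, integral_add i1 i2] at h1
  linarith

end RadialFun

/-! ### Spherical polynomials -/

/-- The linear functional `⟪a, x⟫` on the sphere, extended as a radial function. -/
def sphLin {n : ℕ} (a x : Euc n) : ℝ := ⟪a, x⟫ * ‖x‖⁻¹

theorem hasFDerivAt_norm' {n : ℕ} {x : Euc n} (hx : x ≠ 0) :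
    HasFDerivAt (fun y : Euc n => ‖y‖) (innerSL ℝ (‖x‖⁻¹ • x)) x := by
  have h1 := (hasStrictFDerivAt_norm_sq x).hasFDerivAt.sqrt (by simpa using hx)
  have h2 : (fun y : Euc n => √(‖y‖ ^ 2)) = fun y => ‖y‖ := by
    funext y; exact Real.sqrt_sq (norm_nonneg _)
  rw [h2, Real.sqrt_sq (norm_nonneg _)] at h1
  refine h1.congr_fderiv ?_
  ext v
  have : ‖x‖ ≠ 0 := by simpa using hx
  simp
  field_simp

theorem hasFDerivAt_inv_norm {n : ℕ} {x : Euc n} (hx : x ≠ 0) :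
    HasFDerivAt (fun y : Euc n => ‖y‖⁻¹) (innerSL ℝ (-(‖x‖⁻¹ ^ 3) • x)) x := by
  have hx' : ‖x‖ ≠ 0 := by simpa using hx
  have h1 : HasFDerivAt (fun y : Euc n => ‖y‖⁻¹) _ x :=
    (hasDerivAt_inv hx').comp_hasFDerivAt x (hasFDerivAt_norm' hx)
  refine h1.congr_fderiv ?_
  ext v
  simp
  field_simp

theorem radialFun_sphLin {n : ℕ} (a : Euc n) : RadialFun (sphLin a) := by
  refine ⟨fun x hx => ?_, fun t ht x => ?_⟩
  · unfold sphLin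
    exact (contDiffAt_const.inner ℝ contDiffAt_id).mul
      ((contDiffAt_norm ℝ hx).inv (by simpa using hx))
  · unfold sphLin
    rw [inner_smul_right, norm_smul, Real.norm_of_nonneg ht.le]
    field_simp

theorem gradient_sphLin {n : ℕ} (a : Euc n) {x : Euc n} (hx : x ≠ 0) :
    gradient (sphLin a) x = ‖x‖⁻¹ • a + (⟪a, x⟫ * -(‖x‖⁻¹ ^ 3)) • x := by
  have h1 : HasFDerivAt (fun y : Euc n => ⟪a, y⟫) (innerSL ℝ a) x := (innerSL ℝ a).hasFDerivAt
  have h2 : HasFDerivAt (sphLin a) _ x := h1.mul (hasFDerivAt_inv_norm hx)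
  refine HasFDerivAt.gradient_eq (h2.congr_fderiv ?_)
  ext v
  simp
  ring

theorem norm_gradient_sphLin {n : ℕ} (a : Euc n) {x : Euc n} (hx : ‖x‖ = 1) :
    ‖gradient (sphLin a) x‖ ^ 2 = ‖a‖ ^ 2 - sphLin a x ^ 2 := by
  rw [gradient_sphLin a (ne_zero_of_norm_one hx), norm_add_sq_real, norm_smul, norm_smul,
    inner_smul_left, inner_smul_right, hx, sphLin, hx]
  simp
  ring

theorem lap_sphLin {n : ℕ} (a : Euc n) {x : Euc n} (hx : ‖x‖ = 1) :
    lap (sphLin a) x = -((n : ℝ) - 1) * sphLin a x := by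
  have hx0 := ne_zero_of_norm_one hx
  have h : gradient (sphLin a)
      =ᶠ[𝓝 x] fun y => ‖y‖⁻¹ • a + (⟪a, y⟫ * -(‖y‖⁻¹ ^ 3)) • y := by
    filter_upwards [eventually_ne_zero hx0] with y hy using gradient_sphLin a hy
  have h1 : HasFDerivAt (fun y : Euc n => ⟪a, y⟫) (innerSL ℝ a) x := (innerSL ℝ a).hasFDerivAt
  have h2 := hasFDerivAt_inv_norm hx0
  have h3 : HasFDerivAt (fun y : Euc n => ⟪a, y⟫ * -(‖y‖⁻¹ ^ 3)) _ x := h1.mul (h2.pow 3).neg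
  have h4 : DifferentiableAt ℝ (fun y : Euc n => (⟪a, y⟫ * -(‖y‖⁻¹ ^ 3)) • y) x :=
    h3.differentiableAt.smul differentiableAt_fun_id
  rw [lap, divg_congr h, divg_add (h2.differentiableAt.smul_const a) h4,
    divg_smul h2.differentiableAt (differentiableAt_const a),
    divg_smul h3.differentiableAt differentiableAt_fun_id, divg_const, divg_id, h2.fderiv,
    h3.fderiv]
  simp [hx, sphLin, real_inner_comm a x]
  ring

/-- Restrictions to the sphere of polynomials of degree at most `k`. -/
def sphPoly (n k : ℕ) : Submodule ℝ (Euc n → ℝ) :=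
  Submodule.span ℝ {f | ∃ a : Euc n, ∃ j ≤ k, f = fun x => sphLin a x ^ j}

/-- The radial functions, as a linear space. -/
def radialSub (n : ℕ) : Submodule ℝ (Euc n → ℝ) where
  carrier := {f | RadialFun f}
  add_mem' hf hg := hf.add hg
  zero_mem' := RadialFun.zero
  smul_mem' r _ hf := hf.const_mul r

theorem sphPoly_le_radialSub (n k : ℕ) : sphPoly n k ≤ radialSub n := by
  refine Submodule.span_le.2 ?_
  rintro _ ⟨a, j, _, rfl⟩
  exact (radialFun_sphLin a).pow j

theorem sphPoly_mono (n : ℕ) {k l : ℕ} (h : k ≤ l) : sphPoly n k ≤ sphPoly n l := by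
  refine Submodule.span_mono ?_
  rintro _ ⟨a, j, hj, rfl⟩
  exact ⟨a, j, hj.trans h, rfl⟩

theorem sphLin_pow_mem {n k j : ℕ} (a : Euc n) (h : j ≤ k) :
    (fun x => sphLin a x ^ j) ∈ sphPoly n k := Submodule.subset_span ⟨a, j, h, rfl⟩

theorem radialFun_of_mem {n k : ℕ} {f : Euc n → ℝ} (h : f ∈ sphPoly n k) : RadialFun f :=
  sphPoly_le_radialSub n k h

/-- A finite dimensional space containing the `j`-th powers of linear functionals. -/
def sphMon (n : ℕ) : ℕ → Submodule ℝ (Euc n → ℝ)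
  | 0 => Submodule.span ℝ {fun _ => 1}
  | j + 1 => ⨆ i : Fin n, (sphMon n j).map
      (LinearMap.mulLeft ℝ (sphLin (EuclideanSpace.single i (1 : ℝ))))

theorem finiteDimensional_sphMon (n j : ℕ) : FiniteDimensional ℝ (sphMon n j) := by
  induction j with
  | zero =>
    rw [sphMon]
    infer_instance
  | succ j ih =>
    rw [sphMon]
    infer_instance

theorem sphLin_pow_mem_sphMon {n : ℕ} (a : Euc n) : ∀ j, (fun x => sphLin a x ^ j) ∈ sphMon n j
  | 0 => by
    simp only [pow_zero]
    exact Submodule.mem_span_singleton_self _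
  | j + 1 => by
    have h : (fun x => sphLin a x ^ (j + 1)) = ∑ i, a i • (LinearMap.mulLeft ℝ
        (sphLin (EuclideanSpace.single i (1 : ℝ)))) (fun x => sphLin a x ^ j) := by
      funext x
      have h2 : sphLin a x = ∑ i, a i * sphLin (EuclideanSpace.single i (1 : ℝ)) x := by
        simp only [sphLin]
        conv_lhs => rw [euc_eq_sum a]
        simp only [sum_inner, inner_smul_left, Finset.sum_mul]
        simp [mul_assoc]
      simp only [Finset.sum_apply, Pi.smul_apply, smul_eq_mul, LinearMap.mulLeft_apply,
        Pi.mul_apply, ← mul_assoc, ← Finset.sum_mul, ← h2]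
      rw [pow_succ, mul_comm]
    rw [h]
    refine Submodule.sum_mem _ fun i _ => Submodule.smul_mem _ _ ?_
    refine Submodule.mem_iSup_of_mem i ?_
    exact Submodule.mem_map_of_mem (sphLin_pow_mem_sphMon a j)

theorem finiteDimensional_sphPoly (n k : ℕ) : FiniteDimensional ℝ (sphPoly n k) := by
  have := finiteDimensional_sphMon n
  have h : sphPoly n k ≤ ⨆ j : Fin (k + 1), sphMon n j := by
    refine Submodule.span_le.2 ?_
    rintro _ ⟨a, j, hj, rfl⟩
    exact Submodule.mem_iSup_of_mem (⟨j, by omega⟩ : Fin (k + 1)) (sphLin_pow_mem_sphMon a j)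
  exact Submodule.finiteDimensional_of_le h

/-- The eigenvalues of the Laplacian of the sphere. -/
def sphEig (n k : ℕ) : ℝ := k * (k + (n : ℝ) - 2)

theorem lap_sphLin_pow {n : ℕ} (a : Euc n) (j : ℕ) {x : Euc n} (hx : ‖x‖ = 1) :
    -lap (fun y => sphLin a y ^ j) x = sphEig n j * sphLin a x ^ j
      - (j * (j - 1 : ℕ) * ‖a‖ ^ 2) * sphLin a x ^ (j - 2) := by
  rw [(radialFun_sphLin a).lap_pow j (ne_zero_of_norm_one hx), lap_sphLin a hx,
    norm_gradient_sphLin a hx, sphEig]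
  rcases j with _ | _ | j
  · simp
  · simp
    ring
  · simp only [Nat.add_sub_cancel, show j + 1 + 1 - 2 = j by omega]
    push_cast
    ring

theorem exists_lap_sphPoly {n k : ℕ} {f : Euc n → ℝ} (hf : f ∈ sphPoly n k) :
    ∃ h ∈ sphPoly n (k - 1), ∀ x : Euc n, ‖x‖ = 1 → -lap f x = sphEig n k * f x + h x := by
  induction hf using Submodule.span_induction with
  | mem f hf =>
    obtain ⟨a, j, hj, rfl⟩ := hf
    refine ⟨(sphEig n j - sphEig n k) • (fun x => sphLin a x ^ j)
      - (j * (j - 1 : ℕ) * ‖a‖ ^ 2) • (fun x => sphLin a x ^ (j - 2)), ?_, ?_⟩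
    · refine Submodule.sub_mem _ ?_ (Submodule.smul_mem _ _ (sphLin_pow_mem a (by omega)))
      rcases hj.eq_or_lt with rfl | hj
      · simp
      · exact Submodule.smul_mem _ _ (sphLin_pow_mem a (by omega))
    · intro x hx
      rw [lap_sphLin_pow a j hx]
      simp
      ring
  | zero =>
    refine ⟨0, Submodule.zero_mem _, fun x hx => ?_⟩
    have := (RadialFun.zero (n := n)).lap_const_mul 0 (ne_zero_of_norm_one hx)
    simp only [zero_mul, Pi.zero_def, mul_zero] at this ⊢
    rw [this]; simp
  | add f g hf hg ihf ihg =>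
    obtain ⟨a, ha, ha'⟩ := ihf
    obtain ⟨b, hb, hb'⟩ := ihg
    refine ⟨a + b, Submodule.add_mem _ ha hb, fun x hx => ?_⟩
    have := (radialFun_of_mem hf).lap_add (radialFun_of_mem hg) (ne_zero_of_norm_one hx)
    have e1 := ha' x hx
    have e2 := hb' x hx
    have e3 : lap (f + g) x = lap f x + lap g x := this
    simp only [e3, Pi.add_apply]
    linarith
  | smul r f hf ih =>
    obtain ⟨a, ha, ha'⟩ := ih
    refine ⟨r • a, Submodule.smul_mem _ _ ha, fun x hx => ?_⟩
    have e3 : lap (r • f) x = r * lap f x :=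
      (radialFun_of_mem hf).lap_const_mul r (ne_zero_of_norm_one hx)
    have e1 := ha' x hx
    simp only [e3, Pi.smul_apply, smul_eq_mul]
    linear_combination r * e1

/-! ### Spectral gap on the sphere -/

/-- The `L²` inner product on the sphere. -/
def ipS {n : ℕ} (f g : Euc n → ℝ) : ℝ := ∫ x, f x * g x ∂sphM n

/-- The Dirichlet form on the sphere. -/
def dirS {n : ℕ} (f g : Euc n → ℝ) : ℝ := ∫ x, ⟪gradient f x, gradient g x⟫ ∂sphM n

theorem ipS_comm {n : ℕ} (f g : Euc n → ℝ) : ipS f g = ipS g f := by simp [ipS, mul_comm]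

theorem dirS_comm {n : ℕ} (f g : Euc n → ℝ) : dirS f g = dirS g f :=
  integral_congr_ae (Eventually.of_forall fun _ => real_inner_comm _ _)

theorem ipS_self_nonneg {n : ℕ} (f : Euc n → ℝ) : 0 ≤ ipS f f :=
  integral_nonneg fun x => mul_self_nonneg (f x)

theorem dirS_self_nonneg {n : ℕ} (f : Euc n → ℝ) : 0 ≤ dirS f f :=
  integral_nonneg fun _ => real_inner_self_nonneg

theorem ipS_add_left {n : ℕ} (hn : 1 ≤ n) {f g h : Euc n → ℝ} (hf : RadialFun f)
    (hg : RadialFun g) (hh : RadialFun h) : ipS (f + g) h = ipS f h + ipS g h := by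
  rw [ipS, ipS, ipS, ← integral_add (integrable_sphM hn (hf.mul hh).continuousOn_sphere)
    (integrable_sphM hn (hg.mul hh).continuousOn_sphere)]
  refine integral_congr_ae (Eventually.of_forall fun x => ?_)
  simp [add_mul]

theorem ipS_sub_left {n : ℕ} (hn : 1 ≤ n) {f g h : Euc n → ℝ} (hf : RadialFun f)
    (hg : RadialFun g) (hh : RadialFun h) : ipS (f - g) h = ipS f h - ipS g h := by
  rw [ipS, ipS, ipS, ← integral_sub (integrable_sphM hn (hf.mul hh).continuousOn_sphere)
    (integrable_sphM hn (hg.mul hh).continuousOn_sphere)]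
  refine integral_congr_ae (Eventually.of_forall fun x => ?_)
  simp [sub_mul]

theorem ipS_smul_left {n : ℕ} (r : ℝ) (f g : Euc n → ℝ) : ipS (r • f) g = r * ipS f g := by
  rw [ipS, ipS, ← integral_const_mul]
  simp [mul_assoc]

theorem dirS_add_left {n : ℕ} (hn : 1 ≤ n) {f g h : Euc n → ℝ} (hf : RadialFun f)
    (hg : RadialFun g) (hh : RadialFun h) : dirS (f + g) h = dirS f h + dirS g h := by
  rw [dirS, dirS, dirS, ← integral_add
    (integrable_sphM hn (hf.continuousOn_gradient.inner hh.continuousOn_gradient))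
    (integrable_sphM hn (hg.continuousOn_gradient.inner hh.continuousOn_gradient))]
  refine integral_sphM_congr fun x hx => ?_
  have hx := ne_zero_of_norm_one hx
  rw [← inner_add_left, ← gradient_add' (hf.differentiableAt hx) (hg.differentiableAt hx)]
  rfl

theorem RadialFun.pi_add {n : ℕ} {f g : Euc n → ℝ} (hf : RadialFun f) (hg : RadialFun g) :
    RadialFun (f + g) := hf.add hg

theorem RadialFun.pi_sub {n : ℕ} {f g : Euc n → ℝ} (hf : RadialFun f) (hg : RadialFun g) :
    RadialFun (f - g) := hf.sub hg

theorem ipS_add_self {n : ℕ} (hn : 1 ≤ n) {f g : Euc n → ℝ} (hf : RadialFun f)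
    (hg : RadialFun g) : ipS (f + g) (f + g) = ipS f f + 2 * ipS f g + ipS g g := by
  rw [ipS_add_left hn hf hg (hf.pi_add hg), ipS_comm f, ipS_comm g,
    ipS_add_left hn hf hg hf, ipS_add_left hn hf hg hg, ipS_comm g f]
  ring

theorem dirS_add_self {n : ℕ} (hn : 1 ≤ n) {f g : Euc n → ℝ} (hf : RadialFun f)
    (hg : RadialFun g) : dirS (f + g) (f + g) = dirS f f + 2 * dirS f g + dirS g g := by
  rw [dirS_add_left hn hf hg (hf.pi_add hg), dirS_comm f, dirS_comm g,
    dirS_add_left hn hf hg hf, dirS_add_left hn hf hg hg, dirS_comm g f]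
  ring

theorem RadialFun.memLp {n : ℕ} (hn : 1 ≤ n) {f : Euc n → ℝ} (hf : RadialFun f) :
    MemLp f 2 (sphM n) := by
  have := isFiniteMeasure_sphM hn
  obtain ⟨C, hC⟩ := (isCompact_sphere (0 : Euc n) 1).exists_bound_of_continuousOn
    hf.continuousOn_sphere
  exact MemLp.of_bound (integrable_sphM hn hf.continuousOn_sphere).aestronglyMeasurable C
    (ae_sphM fun x hx => hC x (by simpa using hx))

/-- The class of a radial function in `L²` of the sphere. -/
def radialToLp {n : ℕ} (hn : 1 ≤ n) : radialSub n →ₗ[ℝ] Lp ℝ 2 (sphM n) where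
  toFun f := (RadialFun.memLp hn f.2).toLp f.1
  map_add' f g := MemLp.toLp_add (RadialFun.memLp hn f.2) (RadialFun.memLp hn g.2)
  map_smul' r f := MemLp.toLp_const_smul r (RadialFun.memLp hn f.2)

theorem inner_radialToLp {n : ℕ} (hn : 1 ≤ n) (f g : radialSub n) :
    ⟪radialToLp hn f, radialToLp hn g⟫ = ipS f.1 g.1 := by
  rw [L2.inner_def, ipS]
  refine integral_congr_ae ?_
  filter_upwards [(RadialFun.memLp hn f.2).coeFn_toLp, (RadialFun.memLp hn g.2).coeFn_toLp]
    with x h1 h2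
  simp only [radialToLp, LinearMap.coe_mk, AddHom.coe_mk, h1, h2]
  simp [mul_comm]

theorem exists_orthonormal_family {n : ℕ} (hn : 1 ≤ n) (k : ℕ) :
    ∃ (N : ℕ) (Y : Fin N → Euc n → ℝ), (∀ i, Y i ∈ sphPoly n k) ∧ (∀ i, ipS (Y i) (Y i) = 1) ∧
      ∀ u, RadialFun u → ∀ y ∈ sphPoly n k, ipS (u - ∑ i, ipS u (Y i) • Y i) y = 0 := by
  have hfd := finiteDimensional_sphPoly n k
  let ι : sphPoly n k →ₗ[ℝ] radialSub n := Submodule.inclusion (sphPoly_le_radialSub n k)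
  let T := radialToLp hn
  let W : Submodule ℝ (Lp ℝ 2 (sphM n)) := LinearMap.range (T ∘ₗ ι)
  have hW : FiniteDimensional ℝ W := LinearMap.finiteDimensional_range _
  let b := stdOrthonormalBasis ℝ W
  have hb : ∀ i, ∃ y : sphPoly n k, T (ι y) = b i := fun i => (b i).2
  choose y hy using hb
  refine ⟨Module.finrank ℝ W, fun i => (y i).1, fun i => (y i).2, fun i => ?_, ?_⟩
  · have h1 := inner_radialToLp hn (ι (y i)) (ι (y i))
    have h2 : ⟪(b i : Lp ℝ 2 (sphM n)), b i⟫ = (1 : ℝ) := by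
      rw [real_inner_self_eq_norm_sq, show ‖(b i : Lp ℝ 2 (sphM n))‖ = 1 from b.norm_eq_one i]
      norm_num
    rw [show radialToLp hn (ι (y i)) = b i from hy i, h2] at h1
    exact h1.symm
  · intro u hu z hz
    let u' : radialSub n := ⟨u, hu⟩
    let z' : sphPoly n k := ⟨z, hz⟩
    have h1 : ∀ i, ipS u (y i).1 = ⟪T u', (b i : Lp ℝ 2 (sphM n))⟫ := fun i => by
      rw [← hy i]; exact (inner_radialToLp hn u' (ι (y i))).symm
    have h2 : (⟨T (ι z'), z', rfl⟩ : W) = ∑ i, ⟪b i, (⟨T (ι z'), z', rfl⟩ : W)⟫ • b i :=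
      (b.sum_repr' _).symm
    have h3 : T (ι z') = ∑ i, ⟪(b i : Lp ℝ 2 (sphM n)), T (ι z')⟫ • (b i : Lp ℝ 2 (sphM n)) := by
      have := congrArg (fun w : W => (w : Lp ℝ 2 (sphM n))) h2
      simpa [Submodule.coe_inner] using this
    have h4 : ipS (u - ∑ i, ipS u (y i).1 • (y i).1) z
        = ⟪T (u' - ∑ i, ipS u (y i).1 • ι (y i)), T (ι z')⟫ := by
      have := inner_radialToLp hn (u' - ∑ i, ipS u (y i).1 • ι (y i)) (ι z')
      rw [show T = radialToLp hn from rfl, this]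
      congr 1
      simp [u', ι]
    rw [h4, map_sub, map_sum, inner_sub_left, sum_inner]
    conv_lhs => arg 1; rw [h3]
    rw [inner_sum, sub_eq_zero]
    refine Finset.sum_congr rfl fun i _ => ?_
    rw [map_smul, inner_smul_left, inner_smul_right, h1 i, hy i]
    exact mul_comm _ _

theorem dirS_of_orth {n k : ℕ} (hn : 1 ≤ n) {f g : Euc n → ℝ} (hf : RadialFun f)
    (hg : g ∈ sphPoly n k) (h : ∀ y ∈ sphPoly n (k - 1), ipS f y = 0) :
    dirS f g = sphEig n k * ipS f g := by
  obtain ⟨r, hr, hr'⟩ := exists_lap_sphPoly hg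
  have hg' := radialFun_of_mem hg
  have hrr := radialFun_of_mem hr
  have h1 : (∫ x, f x * lap g x ∂sphM n) = -(sphEig n k * ipS f g + ipS f r) := by
    rw [ipS, ipS, ← integral_const_mul, ← integral_add
      (integrable_sphM hn ((hf.mul hg').const_mul _).continuousOn_sphere)
      (integrable_sphM hn (hf.mul hrr).continuousOn_sphere), ← integral_neg]
    refine integral_sphM_congr fun x hx => ?_
    linear_combination (-f x) * hr' x hx
  rw [dirS, RadialFun.green hn hf hg', h1, h r hr]
  ring

theorem sphEig_mono {n : ℕ} (hn : 1 ≤ n) {k l : ℕ} (h : k ≤ l) (hk : 1 ≤ k) :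
    sphEig n k ≤ sphEig n l := by
  have h1 : (k : ℝ) ≤ l := by exact_mod_cast h
  have h2 : (1 : ℝ) ≤ k := by exact_mod_cast hk
  have h3 : (1 : ℝ) ≤ n := by exact_mod_cast hn
  unfold sphEig
  nlinarith [mul_nonneg (sub_nonneg.2 h1) (sub_nonneg.2 h3)]

theorem sphPoly_gap {n : ℕ} (hn : 1 ≤ n) (m N : ℕ) : ∀ f ∈ sphPoly n N,
    (∀ y ∈ sphPoly n m, ipS f y = 0) → sphEig n (m + 1) * ipS f f ≤ dirS f f := by
  induction N with
  | zero =>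
    intro f hf h
    rw [h f (sphPoly_mono n (Nat.zero_le m) hf), mul_zero]
    exact dirS_self_nonneg f
  | succ N ih =>
    intro f hf h
    by_cases hN : N + 1 ≤ m
    · rw [h f (sphPoly_mono n hN hf), mul_zero]
      exact dirS_self_nonneg f
    push Not at hN
    have hfr := radialFun_of_mem hf
    obtain ⟨d, Y, hY, -, hproj⟩ := exists_orthonormal_family hn N
    set g := ∑ i, ipS f (Y i) • Y i with hg
    have hgm : g ∈ sphPoly n N :=
      Submodule.sum_mem _ fun i _ => Submodule.smul_mem _ _ (hY i)
    have hgr := radialFun_of_mem hgm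
    set r := f - g with hr
    have hrr : RadialFun r := hfr.pi_sub hgr
    have hrm : r ∈ sphPoly n (N + 1) :=
      Submodule.sub_mem _ hf (sphPoly_mono n (Nat.le_succ N) hgm)
    have hro : ∀ y ∈ sphPoly n N, ipS r y = 0 := hproj f hfr
    have hfg : f = r + g := by simp [hr]
    have hgo : ∀ y ∈ sphPoly n m, ipS g y = 0 := fun y hy => by
      have := h y hy
      rw [hfg, ipS_add_left hn hrr hgr (radialFun_of_mem hy),
        hro y (sphPoly_mono n (by omega) hy), zero_add] at this
      exact this
    have e1 := ih g hgm hgo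
    have e2 : dirS r r = sphEig n (N + 1) * ipS r r := dirS_of_orth hn hrr hrm hro
    have e3 : dirS r g = 0 := by
      rw [dirS_of_orth hn hrr hgm fun y hy => hro y (sphPoly_mono n (by omega) hy), hro g hgm,
        mul_zero]
    have e4 := sphEig_mono hn (k := m + 1) (l := N + 1) (by omega) (by omega)
    rw [hfg, ipS_add_self hn hrr hgr, dirS_add_self hn hrr hgr, e3, hro g hgm, e2]
    nlinarith [ipS_self_nonneg r, mul_le_mul_of_nonneg_right e4 (ipS_self_nonneg r)]

/-- Linear functionals on the sphere, as continuous functions. -/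
def sphLinC {n : ℕ} (a : Euc n) : C(sphere (0 : Euc n) 1, ℝ) :=
  ⟨fun x => ⟪a, (x : Euc n)⟫, by fun_prop⟩

theorem sphLinC_add {n : ℕ} (a b : Euc n) : sphLinC (a + b) = sphLinC a + sphLinC b := by
  ext x; simp [sphLinC, inner_add_left]

theorem exp_sphLinC_apply {n : ℕ} (a : Euc n) (x : sphere (0 : Euc n) 1) :
    NormedSpace.exp (sphLinC a) x = Real.exp ⟪a, (x : Euc n)⟫ := by
  have h := NormedSpace.map_exp (ContinuousMap.evalAlgHom ℝ ℝ x)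
    (continuous_eval_const x) (sphLinC a)
  rw [Real.exp_eq_exp_ℝ]
  exact h

theorem span_pow_dense (n : ℕ) :
    (Submodule.span ℝ {f | ∃ (a : Euc n) (j : ℕ), f = sphLinC a ^ j}).topologicalClosure = ⊤ := by
  set M := Submodule.span ℝ {f | ∃ (a : Euc n) (j : ℕ), f = sphLinC a ^ j} with hM
  let E : Submonoid C(sphere (0 : Euc n) 1, ℝ) :=
    { carrier := {f | ∃ a : Euc n, f = NormedSpace.exp (sphLinC a)}
      mul_mem' := by
        rintro _ _ ⟨a, rfl⟩ ⟨b, rfl⟩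
        exact ⟨a + b, by rw [sphLinC_add, NormedSpace.exp_add]⟩
      one_mem' := ⟨0, by
        have : sphLinC (0 : Euc n) = 0 := by ext x; simp [sphLinC]
        rw [this, NormedSpace.exp_zero]⟩ }
  have hE : ∀ f ∈ E, f ∈ M.topologicalClosure := by
    rintro _ ⟨a, rfl⟩
    have h := NormedSpace.exp_series_hasSum_exp' (𝕂 := ℝ) (sphLinC a)
    refine (M.isClosed_topologicalClosure).mem_of_tendsto h (Eventually.of_forall fun s => ?_)
    refine M.le_topologicalClosure (Submodule.sum_mem _ fun j _ => Submodule.smul_mem _ _ ?_)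
    exact Submodule.subset_span ⟨a, j, rfl⟩
  let A := Algebra.adjoin ℝ (E : Set C(sphere (0 : Euc n) 1, ℝ))
  have hA : Subalgebra.toSubmodule A ≤ M.topologicalClosure := by
    rw [Algebra.adjoin_eq_span, Submonoid.closure_eq]
    exact Submodule.span_le.2 hE
  have hsep : A.SeparatesPoints := by
    intro x y hxy
    refine ⟨_, ⟨NormedSpace.exp (sphLinC ((x : Euc n) - y)),
      Algebra.subset_adjoin ⟨_, rfl⟩, rfl⟩, fun h => hxy ?_⟩
    simp only [exp_sphLinC_apply, Real.exp_eq_exp] at h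
    rw [← sub_eq_zero, ← inner_sub_right, inner_self_eq_zero, sub_eq_zero] at h
    exact Subtype.ext h
  have hdense := ContinuousMap.subalgebra_topologicalClosure_eq_top_of_separatesPoints A hsep
  rw [eq_top_iff]
  intro f _
  have hf : f ∈ A.topologicalClosure := by rw [hdense]; trivial
  have hf' : f ∈ closure (A : Set C(sphere (0 : Euc n) 1, ℝ)) := hf
  exact closure_minimal hA M.isClosed_topologicalClosure hf'

theorem exists_sphPoly_near {n : ℕ} {u : Euc n → ℝ} (hu : RadialFun u) {δ : ℝ} (hδ : 0 < δ) :
    ∃ N, ∃ y ∈ sphPoly n N, ∀ x : Euc n, ‖x‖ = 1 → |u x - y x| ≤ δ := by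
  let uC : C(sphere (0 : Euc n) 1, ℝ) :=
    ⟨fun x => u x, continuousOn_iff_continuous_domRestrict.1 hu.continuousOn_sphere⟩
  have h : uC ∈ (Submodule.span ℝ
      {f | ∃ (a : Euc n) (j : ℕ), f = sphLinC a ^ j}).topologicalClosure := by
    rw [span_pow_dense]; trivial
  obtain ⟨g, hg, hug⟩ := Metric.mem_closure_iff.1 h δ hδ
  have h2 : ∀ g ∈ Submodule.span ℝ {f | ∃ (a : Euc n) (j : ℕ), f = sphLinC a ^ j},
      ∃ N, ∃ y ∈ sphPoly n N, ∀ x : sphere (0 : Euc n) 1, g x = y x := by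
    intro g hg
    induction hg using Submodule.span_induction with
    | mem g hg =>
      obtain ⟨a, j, rfl⟩ := hg
      refine ⟨j, _, sphLin_pow_mem a le_rfl, fun x => ?_⟩
      have : ‖(x : Euc n)‖ = 1 := by simp
      simp [sphLinC, sphLin, this]
    | zero => exact ⟨0, 0, Submodule.zero_mem _, fun x => rfl⟩
    | add f g _ _ ihf ihg =>
      obtain ⟨N, y, hy, hy'⟩ := ihf
      obtain ⟨N', z, hz, hz'⟩ := ihg
      refine ⟨max N N', y + z, Submodule.add_mem _ (sphPoly_mono n (le_max_left _ _) hy)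
        (sphPoly_mono n (le_max_right _ _) hz), fun x => ?_⟩
      simp [hy', hz']
    | smul r f _ ih =>
      obtain ⟨N, y, hy, hy'⟩ := ih
      exact ⟨N, r • y, Submodule.smul_mem _ _ hy, fun x => by simp [hy']⟩
  obtain ⟨N, y, hy, hy'⟩ := h2 g hg
  refine ⟨N, y, hy, fun x hx => ?_⟩
  have hx' : x ∈ sphere (0 : Euc n) 1 := by simpa using hx
  have h3 := (ContinuousMap.dist_lt_iff hδ).1 hug ⟨x, hx'⟩
  rw [hy', Real.dist_eq] at h3
  exact h3.le

/-- The Poincaré inequality for functions orthogonal to polynomials of degree at most `m`. -/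
theorem spectral_gap {n : ℕ} (hn : 1 ≤ n) (m : ℕ) {w : Euc n → ℝ} (hw : RadialFun w)
    (h : ∀ y ∈ sphPoly n m, ipS w y = 0) : sphEig n (m + 1) * ipS w w ≤ dirS w w := by
  have hA := sphereArea_pos hn
  have hL : 0 ≤ sphEig n (m + 1) := by
    have : (1 : ℝ) ≤ n := by exact_mod_cast hn
    unfold sphEig
    push_cast
    have : (0 : ℝ) ≤ m := by positivity
    apply mul_nonneg <;> linarith
  refine le_of_forall_pos_le_add fun η hη => ?_
  obtain ⟨δ, hδ, hδη⟩ : ∃ δ > 0, sphEig n (m + 1) * (sphereArea n * δ ^ 2) ≤ η := by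
    have h1 : Tendsto (fun δ : ℝ => sphEig n (m + 1) * (sphereArea n * δ ^ 2)) (𝓝[>] 0) (𝓝 0) := by
      have : Continuous fun δ : ℝ => sphEig n (m + 1) * (sphereArea n * δ ^ 2) := by fun_prop
      simpa using (this.tendsto 0).mono_left nhdsWithin_le_nhds
    obtain ⟨δ, h2, h3⟩ := ((h1.eventually (gt_mem_nhds hη)).and self_mem_nhdsWithin).exists
    exact ⟨δ, h3, h2.le⟩
  obtain ⟨N, y, hy, hyw⟩ := exists_sphPoly_near hw hδ
  have hy := sphPoly_mono n (le_max_left N m) hy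
  set N' := max N m
  obtain ⟨d, Y, hY, -, hproj⟩ := exists_orthonormal_family hn N'
  set g := ∑ i, ipS w (Y i) • Y i with hg
  have hgm : g ∈ sphPoly n N' :=
    Submodule.sum_mem _ fun i _ => Submodule.smul_mem _ _ (hY i)
  have hgr := radialFun_of_mem hgm
  set r := w - g with hr
  have hrr : RadialFun r := hw.pi_sub hgr
  have hro : ∀ y ∈ sphPoly n N', ipS r y = 0 := hproj w hw
  have hfg : w = r + g := by simp [hr]
  have hgo : ∀ y ∈ sphPoly n m, ipS g y = 0 := fun y hy => by
    have := h y hy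
    rw [hfg, ipS_add_left hn hrr hgr (radialFun_of_mem hy),
      hro y (sphPoly_mono n (le_max_right _ _) hy), zero_add] at this
    exact this
  have e1 := sphPoly_gap hn m N' g hgm hgo
  have e3 : dirS r g = 0 := by
    rw [dirS_of_orth hn hrr hgm fun y hy => hro y (sphPoly_mono n (by omega) hy), hro g hgm,
      mul_zero]
  have e5 : ipS r r ≤ sphereArea n * δ ^ 2 := by
    have hz : g - y ∈ sphPoly n N' := Submodule.sub_mem _ hgm hy
    have hzr := radialFun_of_mem hz
    have h1 : ipS (r + (g - y)) (r + (g - y)) ≤ sphereArea n * δ ^ 2 := by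
      rw [← integral_sphM_const]
      refine integral_sphM_mono hn
        ((hrr.pi_add hzr).mul (hrr.pi_add hzr)).continuousOn_sphere continuousOn_const
        fun x hx => ?_
      have := hyw x hx
      have h2 : (r + (g - y)) x = w x - y x := by simp [hr]
      rw [h2, ← sq, ← sq_abs]
      exact pow_le_pow_left₀ (abs_nonneg _) this 2
    rw [ipS_add_self hn hrr hzr, hro _ hz] at h1
    linarith [ipS_self_nonneg (g - y)]
  rw [hfg, ipS_add_self hn hrr hgr, dirS_add_self hn hrr hgr, e3, hro g hgm]
  nlinarith [dirS_self_nonneg r, mul_le_mul_of_nonneg_left e5 hL]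

theorem gradient_sum {n : ℕ} {ι : Type*} (s : Finset ι) (c : ι → ℝ) (Y : ι → Euc n → ℝ) {x : Euc n}
    (hY : ∀ i, DifferentiableAt ℝ (Y i) x) :
    gradient (∑ i ∈ s, c i • Y i) x = ∑ i ∈ s, c i • gradient (Y i) x := by
  refine ext_inner_right ℝ fun w => ?_
  rw [inner_gradient_eq, sum_inner, fderiv_sum fun i _ => (hY i).const_smul (c i)]
  simp only [sum_apply, inner_smul_left, inner_gradient_eq,
    fderiv_const_smul (hY _)]
  rfl

theorem hess_sum {n : ℕ} {ι : Type*} (s : Finset ι) (c : ι → ℝ) (Y : ι → Euc n → ℝ) {x : Euc n}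
    (hx : x ≠ 0) (hY : ∀ i, RadialFun (Y i)) :
    hess (∑ i ∈ s, c i • Y i) x = ∑ i ∈ s, c i • hess (Y i) x := by
  have h : gradient (∑ i ∈ s, c i • Y i) =ᶠ[𝓝 x] ∑ i ∈ s, c i • gradient (Y i) := by
    filter_upwards [eventually_ne_zero hx] with y hy
    rw [gradient_sum s c Y fun i => (hY i).differentiableAt hy]
    simp
  rw [hess, h.fderiv_eq,
    fderiv_sum fun i _ => ((hY i).differentiableAt_gradient hx).const_smul (c i)]
  exact Finset.sum_congr rfl fun i _ =>
    fderiv_const_smul ((hY i).differentiableAt_gradient hx) (c i)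

/-- Projection onto spherical polynomials, with derivative bounds. -/
theorem exists_proj {n : ℕ} (hn : 1 ≤ n) (k : ℕ) : ∃ C : ℝ, 0 ≤ C ∧ ∀ u : Euc n → ℝ, RadialFun u →
    ∃ v ∈ sphPoly n k, (∀ y ∈ sphPoly n k, ipS (u - v) y = 0) ∧
      ∀ M, 0 ≤ M → ipS u u ≤ M ^ 2 → ∀ x : Euc n, ‖x‖ = 1 →
        ‖gradient v x‖ ≤ C * M ∧ ‖hess v x‖ ≤ C * M := by
  obtain ⟨N, Y, hY, hY1, hproj⟩ := exists_orthonormal_family hn k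
  have hYr := fun i => radialFun_of_mem (hY i)
  have h1 := fun i => (isCompact_sphere (0 : Euc n) 1).exists_bound_of_continuousOn
    (hYr i).continuousOn_gradient
  have h2 := fun i => (isCompact_sphere (0 : Euc n) 1).exists_bound_of_continuousOn
    (f := hess (Y i)) fun x hx => ((hYr i).continuousAt_hess
      (ne_zero_of_norm_one (by simpa using hx))).continuousWithinAt
  choose B hB using h1
  choose B' hB' using h2
  refine ⟨∑ i, (|B i| + |B' i|), by positivity, fun u hu => ?_⟩
  refine ⟨∑ i, ipS u (Y i) • Y i, Submodule.sum_mem _ fun i _ => Submodule.smul_mem _ _ (hY i),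
    hproj u hu, fun M hM huM x hx => ?_⟩
  have hx0 := ne_zero_of_norm_one hx
  have hxs : x ∈ sphere (0 : Euc n) 1 := by simpa using hx
  have hc : ∀ i, |ipS u (Y i)| ≤ M := fun i => by
    have hcY : RadialFun ((-ipS u (Y i)) • Y i) := (hYr i).const_mul _
    have h := ipS_self_nonneg (u + (-ipS u (Y i)) • Y i)
    rw [ipS_add_self hn hu hcY, ipS_smul_left, ipS_comm (Y i), ipS_comm u (_ • _),
      ipS_smul_left, ipS_smul_left, hY1 i, ipS_comm (Y i) u] at h
    refine abs_le_of_sq_le_sq (by nlinarith) hM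
  constructor
  · rw [gradient_sum _ _ _ fun i => (hYr i).differentiableAt hx0, Finset.sum_mul]
    refine (norm_sum_le _ _).trans (Finset.sum_le_sum fun i _ => ?_)
    rw [norm_smul, Real.norm_eq_abs, mul_comm]
    have := hB i x hxs
    refine mul_le_mul ?_ (hc i) (abs_nonneg _) (by positivity)
    linarith [le_abs_self (B i), abs_nonneg (B' i)]
  · rw [hess_sum _ _ _ hx0 hYr, Finset.sum_mul]
    refine (norm_sum_le _ _).trans (Finset.sum_le_sum fun i _ => ?_)
    rw [norm_smul, Real.norm_eq_abs, mul_comm]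
    have := hB' i x hxs
    refine mul_le_mul ?_ (hc i) (abs_nonneg _) (by positivity)
    linarith [le_abs_self (B' i), abs_nonneg (B i)]

theorem sphPoly_one_form {n : ℕ} {y : Euc n → ℝ} (hy : y ∈ sphPoly n 1) :
    ∃ (r : ℝ) (a : Euc n), ∀ x : Euc n, ‖x‖ = 1 → y x = r + ⟪a, x⟫ := by
  induction hy using Submodule.span_induction with
  | mem f hf =>
    obtain ⟨a, j, hj, rfl⟩ := hf
    obtain rfl | rfl : j = 0 ∨ j = 1 := by omega
    · exact ⟨1, 0, fun x _ => by simp⟩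
    · exact ⟨0, a, fun x hx => by simp [sphLin, hx]⟩
  | zero => exact ⟨0, 0, fun x _ => by simp⟩
  | add f g _ _ hf hg =>
    obtain ⟨r, a, h⟩ := hf
    obtain ⟨r', a', h'⟩ := hg
    exact ⟨r + r', a + a', fun x hx => by simp [h x hx, h' x hx, inner_add_left]; ring⟩
  | smul c f _ hf =>
    obtain ⟨r, a, h⟩ := hf
    exact ⟨c * r, c • a, fun x hx => by simp [h x hx, inner_smul_left]; ring⟩

theorem integral_smul_inner {n : ℕ} (hn : 1 ≤ n) {u : Euc n → ℝ} (hu : ContinuousOn u (sphere 0 1))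
    (a : Euc n) : ∫ x, u x * ⟪a, x⟫ ∂sphM n = ⟪a, ∫ x, u x • x ∂sphM n⟫ := by
  have h := integral_inner (𝕜 := ℝ)
    (integrable_sphM hn (f := fun x => u x • x) (hu.smul continuousOn_id)) a
  rw [← h]
  simp [inner_smul_right]

/-- The projection onto first order spherical polynomials is controlled by the first moments. -/
theorem exists_proj_one {n : ℕ} (hn : 1 ≤ n) : ∃ C : ℝ, 0 ≤ C ∧ ∀ u : Euc n → ℝ, RadialFun u →
    (∫ x, u x ∂sphM n) = 0 → ∃ v ∈ sphPoly n 1, (∀ y ∈ sphPoly n 1, ipS (u - v) y = 0) ∧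
      ipS v v ≤ C * ‖∫ x, u x • x ∂sphM n‖ ^ 2 := by
  obtain ⟨N, Y, hY, -, hproj⟩ := exists_orthonormal_family hn 1
  have hYr := fun i => radialFun_of_mem (hY i)
  choose r a h using fun i => sphPoly_one_form (hY i)
  refine ⟨∑ i, ‖a i‖ ^ 2, by positivity, fun u hu hu0 => ?_⟩
  have hvm : ∑ i, ipS u (Y i) • Y i ∈ sphPoly n 1 :=
    Submodule.sum_mem _ fun i _ => Submodule.smul_mem _ _ (hY i)
  refine ⟨_, hvm, hproj u hu, ?_⟩
  have hc : ∀ i, ipS u (Y i) = ⟪a i, ∫ x, u x • x ∂sphM n⟫ := fun i => by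
    rw [← integral_smul_inner hn hu.continuousOn_sphere, ipS]
    have h1 : ∫ x, u x * Y i x ∂sphM n = ∫ x, (u x * r i + u x * ⟪a i, x⟫) ∂sphM n :=
      integral_sphM_congr fun x hx => by rw [h i x hx]; ring
    have i1 : Integrable (fun x => u x * r i) (sphM n) :=
      integrable_sphM hn (hu.continuousOn_sphere.mul continuousOn_const)
    have i2 : Integrable (fun x => u x * ⟪a i, x⟫) (sphM n) := integrable_sphM hn
      (hu.continuousOn_sphere.mul (continuousOn_const.inner continuousOn_id))
    rw [h1, integral_add i1 i2, integral_mul_const, hu0]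
    simp
  have h1 := hproj u hu _ hvm
  rw [ipS_sub_left hn hu (radialFun_of_mem hvm) (radialFun_of_mem hvm), sub_eq_zero] at h1
  have h2 : ∀ s : Finset (Fin N), ipS (∑ i ∈ s, ipS u (Y i) • Y i) u
      = ∑ i ∈ s, ipS u (Y i) ^ 2 := fun s => by
    induction s using Finset.induction_on with
    | empty => simp [ipS]
    | insert i s hi ih =>
      have hcY : RadialFun (ipS u (Y i) • Y i) := (hYr i).const_mul _
      rw [Finset.sum_insert hi, Finset.sum_insert hi, ipS_add_left hn hcY
        (radialFun_of_mem (Submodule.sum_mem _ fun i _ => Submodule.smul_mem _ _ (hY i))) hu, ih,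
        ipS_smul_left, ipS_comm (Y i)]
      ring
  rw [← h1, ipS_comm, h2, Finset.sum_mul]
  refine Finset.sum_le_sum fun i _ => ?_
  rw [hc i, ← mul_pow, ← sq_abs]
  exact pow_le_pow_left₀ (abs_nonneg _) (abs_real_inner_le_norm _ _) 2

/-! ### A cubic integration by parts -/

theorem contDiffAt_gradient_of {n : ℕ} {f : Euc n → ℝ} {x : Euc n}
    (hf : ContDiffAt ℝ (⊤ : ℕ∞) f x) : ContDiffAt ℝ (⊤ : ℕ∞) (gradient f) x := by
  have h1 : ContDiffAt ℝ (⊤ : ℕ∞) (fderiv ℝ f) x := hf.fderiv_right (by simp)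
  exact (InnerProductSpace.toDual ℝ (Euc n)).symm.contDiff.contDiffAt.comp x h1

theorem inner_fderiv_gradient_comm {n : ℕ} {f : Euc n → ℝ} {x : Euc n}
    (hf : ContDiffAt ℝ (⊤ : ℕ∞) f x) (v w : Euc n) :
    ⟪fderiv ℝ (gradient f) x v, w⟫ = ⟪fderiv ℝ (gradient f) x w, v⟫ := by
  have h1 : ∀ v w : Euc n, ⟪fderiv ℝ (gradient f) x v, w⟫ = fderiv ℝ (fderiv ℝ f) x v w :=
      fun v w => by
    have h2 : (fun y => ⟪gradient f y, w⟫) = fun y => fderiv ℝ f y w := by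
      funext y; exact inner_gradient_eq f y w
    have h3 := fderiv_inner_apply ℝ ((contDiffAt_gradient_of hf).differentiableAt (by simp))
      (differentiableAt_const w) v
    have h4 : DifferentiableAt ℝ (fderiv ℝ f) x :=
      (hf.fderiv_right (m := 1) (by norm_cast)).differentiableAt (by simp)
    have h5 := (h4.hasFDerivAt.clm_apply (hasFDerivAt_const w x)).fderiv
    rw [h2, h5] at h3
    simpa using h3.symm
  rw [h1, h1]
  exact (hf.isSymmSndFDerivAt
    (by simpa using WithTop.coe_le_coe.2 (le_top (a := (2 : ℕ∞))))).eq v w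

theorem inner_hess_comm {n : ℕ} {f : Euc n → ℝ} (hf : RadialFun f) {x : Euc n} (hx : x ≠ 0)
    (v w : Euc n) : ⟪hess f x v, w⟫ = ⟪hess f x w, v⟫ :=
  inner_fderiv_gradient_comm (hf.smooth x hx) v w

/-- The cubic part of the curvature integrand. -/
def cubicC {n : ℕ} (U v : Euc n → ℝ) (x : Euc n) : ℝ :=
  ⟪hess U x (gradient U x), gradient U x⟫ +
    (‖gradient U x - gradient v x‖ ^ 2 * lap U x
      - ⟪hess U x (gradient U x - gradient v x), gradient U x - gradient v x⟫) / 3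

/-- The remainder left by the cubic part after integration by parts. -/
def cubicR {n : ℕ} (U v : Euc n → ℝ) (x : Euc n) : ℝ :=
  let p := gradient U x
  let q := gradient v x
  let r := p - q
  ⟪hess v x p, p⟫ + (‖r‖ ^ 2 * lap v x - ⟪hess v x r, r⟫) / 3
    - ⟪q, r⟫ * (((n : ℝ) - 2) * ⟪p, q⟫ + lap v x) - ⟪hess v x q, r⟫
    - ‖r‖ ^ 2 * (((n : ℝ) - 2) * ⟪p, q⟫ + lap v x) - ‖r‖ ^ 2 / 3 * (((n : ℝ) - 2) * ⟪p, r⟫)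

theorem divg_sub {n : ℕ} {X Y : Euc n → Euc n} {x : Euc n}
    (hX : DifferentiableAt ℝ X x) (hY : DifferentiableAt ℝ Y x) :
    divg (fun y => X y - Y y) x = divg X x - divg Y x := by
  have h : fderiv ℝ (fun y => X y - Y y) x = fderiv ℝ X x - fderiv ℝ Y x :=
    (hX.hasFDerivAt.sub hY.hasFDerivAt).fderiv
  rw [divg, divg, divg, h]
  exact map_sub (LinearMap.trace ℝ (Euc n)) _ _

theorem continuousOn_hess {n : ℕ} {f : Euc n → ℝ} (hf : RadialFun f) :
    ContinuousOn (hess f) (sphere 0 1) := fun x hx =>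
  (hf.continuousAt_hess (ne_zero_of_norm_one (by simpa using hx))).continuousWithinAt

theorem continuousOn_cubicC {n : ℕ} {U v : Euc n → ℝ} (hU : RadialFun U) (hv : RadialFun v) :
    ContinuousOn (cubicC U v) (sphere 0 1) := by
  have h1 := hU.continuousOn_gradient
  have h2 := hv.continuousOn_gradient
  have h3 := continuousOn_hess hU
  have h5 := hU.continuousOn_lap
  have h6 := h1.sub h2
  exact ((h3.clm_apply h1).inner h1).add ((((h6.norm.pow 2).mul h5).sub
    ((h3.clm_apply h6).inner h6)).div_const 3)

theorem continuousOn_cubicR {n : ℕ} {U v : Euc n → ℝ} (hU : RadialFun U) (hv : RadialFun v) :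
    ContinuousOn (cubicR U v) (sphere 0 1) := by
  have h1 := hU.continuousOn_gradient
  have h2 := hv.continuousOn_gradient
  have h3 := continuousOn_hess hv
  have h5 := hv.continuousOn_lap
  have h6 := h1.sub h2
  have h7 : ContinuousOn (fun x => ((n : ℝ) - 2) * ⟪gradient U x, gradient v x⟫ + lap v x)
    (sphere 0 1) := (continuousOn_const.mul (h1.inner h2)).add h5
  exact (((((h3.clm_apply h1).inner h1).add ((((h6.norm.pow 2).mul h5).sub
    ((h3.clm_apply h6).inner h6)).div_const 3)).sub ((h2.inner h6).mul h7)).sub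
    ((h3.clm_apply h2).inner h6)).sub ((h6.norm.pow 2).mul h7) |>.sub
    (((h6.norm.pow 2).div_const 3).mul (continuousOn_const.mul (h1.inner h6)))

theorem integral_cubicC {n : ℕ} (hn : 1 ≤ n) {U v : Euc n → ℝ} (hU : RadialFun U)
    (hv : RadialFun v) :
    ∫ x, Real.exp (((n : ℝ) - 2) * U x) * cubicC U v x ∂sphM n
      = ∫ x, Real.exp (((n : ℝ) - 2) * U x) * cubicR U v x ∂sphM n := by
  set a : ℝ := (n : ℝ) - 2 with ha
  let q := gradient v
  let r := fun y => gradient U y - gradient v y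
  let g := fun y => Real.exp (a * U y)
  let Y := fun y => ⟪q y, r y⟫ • q y + (⟪r y, r y⟫ • q y + (3⁻¹ * ⟪r y, r y⟫) • r y)
  have cq : ∀ x : Euc n, x ≠ 0 → ContDiffAt ℝ (⊤ : ℕ∞) q x := fun x hx =>
    hv.contDiffAt_gradient hx
  have cr : ∀ x : Euc n, x ≠ 0 → ContDiffAt ℝ (⊤ : ℕ∞) r x := fun x hx =>
    (hU.contDiffAt_gradient hx).sub (hv.contDiffAt_gradient hx)
  have cg : ∀ x : Euc n, x ≠ 0 → ContDiffAt ℝ (⊤ : ℕ∞) g x :=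
    (hU.const_mul a).exp_comp.smooth
  have cY : ∀ x : Euc n, x ≠ 0 → ContDiffAt ℝ (⊤ : ℕ∞) Y x := fun x hx =>
    (((cq x hx).inner ℝ (cr x hx)).smul (cq x hx)).add
      ((((cr x hx).inner ℝ (cr x hx)).smul (cq x hx)).add
        ((contDiffAt_const.mul ((cr x hx).inner ℝ (cr x hx))).smul (cr x hx)))
  have ht : ∀ x : Euc n, x ≠ 0 → ⟪g x • Y x, x⟫ = 0 := fun x hx => by
    have h1 : ⟪q x, x⟫ = 0 := hv.inner_gradient_self hx
    have h2 : ⟪r x, x⟫ = 0 := by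
      rw [inner_sub_left, hU.inner_gradient_self hx, hv.inner_gradient_self hx, sub_zero]
    simp [Y, inner_smul_left, inner_add_left, h1, h2]
  have h0 := integral_divg_eq_zero hn (X := fun x => g x • Y x)
    (fun x hx => ((cg x hx).smul (cY x hx)).of_le (by norm_cast)) ht
  have key : ∀ x : Euc n, ‖x‖ = 1 →
      divg (fun x => g x • Y x) x = g x * cubicC U v x - g x * cubicR U v x := by
    intro x hx
    have hx0 := ne_zero_of_norm_one hx
    have dq := (cq x hx0).differentiableAt (by simp)
    have dr := (cr x hx0).differentiableAt (by simp)
    have dg := (cg x hx0).differentiableAt (by simp)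
    have dY := (cY x hx0).differentiableAt (by simp)
    have dqr : DifferentiableAt ℝ (fun y => ⟪q y, r y⟫) x := dq.inner ℝ dr
    have drr : DifferentiableAt ℝ (fun y => ⟪r y, r y⟫) x := dr.inner ℝ dr
    have drr3 : DifferentiableAt ℝ (fun y => 3⁻¹ * ⟪r y, r y⟫) x := drr.const_mul _
    have fr : fderiv ℝ r x = hess U x - hess v x :=
      ((hU.differentiableAt_gradient hx0).hasFDerivAt.sub
        (hv.differentiableAt_gradient hx0).hasFDerivAt).fderiv
    have fq : fderiv ℝ q x = hess v x := rfl
    have er : divg r x = lap U x - lap v x :=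
      divg_sub (hU.differentiableAt_gradient hx0) (hv.differentiableAt_gradient hx0)
    have eq : divg q x = lap v x := rfl
    have fg : ∀ y, fderiv ℝ g x y = g x * (a * ⟪gradient U x, y⟫) := fun y => by
      have := (((hU.differentiableAt hx0).hasFDerivAt.const_mul a).exp).fderiv
      rw [show fderiv ℝ g x = _ from this, inner_gradient_eq]
      rfl
    rw [divg_smul dg dY, fg]
    have eY : divg Y x = _ := divg_add (dqr.smul dq) ((drr.smul dq).add (drr3.smul dr))
    rw [eY, divg_smul dqr dq]
    have eY2 := divg_add (X := fun y => ⟪r y, r y⟫ • q y) (drr.smul dq)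
      (Y := fun y => (3⁻¹ * ⟪r y, r y⟫) • r y) (drr3.smul dr)
    rw [eY2, divg_smul drr dq, divg_smul drr3 dr, fderiv_const_mul drr,
      smul_apply, fderiv_inner_apply ℝ dq dr, fderiv_inner_apply ℝ dr dr,
      fderiv_inner_apply ℝ dr dr, fr, fq, er, eq]
    have hp : gradient U x = q x + r x := by simp [q, r]
    have s1 := inner_hess_comm hU hx0 (q x) (r x)
    have s2 := inner_hess_comm hv hx0 (q x) (r x)
    have hq' : gradient v x = q x := rfl
    simp only [cubicC, cubicR, hq', hp, add_sub_cancel_left, ← real_inner_self_eq_norm_sq]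
    simp only [Y, map_add, inner_add_left, inner_add_right, inner_smul_right,
      sub_apply, inner_sub_left, inner_sub_right, smul_eq_mul, ← ha]
    simp only [real_inner_comm (hess U x _), real_inner_comm (hess v x _),
      real_inner_comm (q x) (r x), s1, s2]
    ring
  have i1 : Integrable (fun x => g x * cubicC U v x) (sphM n) := integrable_sphM hn
    (((hU.const_mul a).exp_comp.continuousOn_sphere).mul (continuousOn_cubicC hU hv))
  have i2 : Integrable (fun x => g x * cubicR U v x) (sphM n) := integrable_sphM hn
    (((hU.const_mul a).exp_comp.continuousOn_sphere).mul (continuousOn_cubicR hU hv))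
  rw [integral_sphM_congr key, integral_sub i1 i2, sub_eq_zero] at h0
  exact h0

theorem integral_exp_lap {n : ℕ} (hn : 1 ≤ n) {U : Euc n → ℝ} (hU : RadialFun U) (a : ℝ) :
    ∫ x, Real.exp (a * U x) * lap U x ∂sphM n
      = -(a * ∫ x, Real.exp (a * U x) * ‖gradient U x‖ ^ 2 ∂sphM n) := by
  have h := RadialFun.green hn (hU.const_mul a).exp_comp hU
  rw [← neg_eq_iff_eq_neg] at h
  rw [← h, ← integral_const_mul]
  congr 1
  refine integral_sphM_congr fun x hx => ?_
  have hx0 := ne_zero_of_norm_one hx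
  have := (((hU.differentiableAt hx0).hasFDerivAt.const_mul a).exp).fderiv
  rw [inner_gradient_eq, this, ← real_inner_self_eq_norm_sq, inner_gradient_eq]
  simp
  ring

theorem abs_lap_le {n : ℕ} (f : Euc n → ℝ) (x : Euc n) : |lap f x| ≤ n * ‖hess f x‖ := by
  rw [lap, divg_eq_sum]
  refine (Finset.abs_sum_le_sum_abs _ _).trans ?_
  have h : ∀ i ∈ (Finset.univ : Finset (Fin n)),
      |fderiv ℝ (gradient f) x (EuclideanSpace.single i 1) i| ≤ ‖hess f x‖ := fun i _ => by
    refine (PiLp.norm_apply_le (fderiv ℝ (gradient f) x (EuclideanSpace.single i 1)) i).trans ?_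
    refine ((hess f x).le_opNorm _).trans ?_
    simp
  refine (Finset.sum_le_sum h).trans ?_
  simp

theorem abs_cubicR_le {n : ℕ} (hn : 2 ≤ n) {U v : Euc n → ℝ} {x : Euc n} {δ : ℝ} (hδ : δ ≤ 1)
    (h1 : ‖gradient U x‖ ≤ δ) (h2 : ‖gradient v x‖ ≤ δ) (h3 : ‖hess v x‖ ≤ δ) :
    |cubicR U v x| ≤ 100 * n * δ * (‖gradient U x‖ ^ 2 + ‖gradient v x‖ ^ 2) := by
  have hn' : (2 : ℝ) ≤ n := by exact_mod_cast hn
  have hL : |lap v x| ≤ n * δ := (abs_lap_le v x).trans (by gcongr)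
  unfold cubicR
  set p := gradient U x
  set q := gradient v x
  set r := p - q
  change |⟪hess v x p, p⟫ + (‖r‖ ^ 2 * lap v x - ⟪hess v x r, r⟫) / 3
    - ⟪q, r⟫ * (((n : ℝ) - 2) * ⟪p, q⟫ + lap v x) - ⟪hess v x q, r⟫
    - ‖r‖ ^ 2 * (((n : ℝ) - 2) * ⟪p, q⟫ + lap v x) - ‖r‖ ^ 2 / 3 * (((n : ℝ) - 2) * ⟪p, r⟫)| ≤ _
  have hδ0 : 0 ≤ δ := (norm_nonneg _).trans h1
  have hH : ∀ y z : Euc n, |⟪hess v x y, z⟫| ≤ δ * (‖y‖ * ‖z‖) := fun y z => by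
    refine (abs_real_inner_le_norm _ _).trans ?_
    rw [← mul_assoc]
    gcongr
    exact ((hess v x).le_opNorm y).trans (by gcongr)
  have hr : ‖r‖ ≤ ‖p‖ + ‖q‖ := norm_sub_le p q
  have eP := norm_nonneg p
  have eQ := norm_nonneg q
  have eR := norm_nonneg r
  set S := ‖p‖ ^ 2 + ‖q‖ ^ 2 with hS
  have hS0 : 0 ≤ S := by positivity
  have hRR : ‖r‖ * ‖r‖ ≤ 2 * S := by nlinarith [sq_nonneg (‖p‖ - ‖q‖)]
  have hQR : ‖q‖ * ‖r‖ ≤ 2 * S := by nlinarith [sq_nonneg (‖p‖ - ‖q‖)]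
  have hPP : ‖p‖ * ‖p‖ ≤ S := by nlinarith
  have hPQ : |⟪p, q⟫| ≤ δ := by
    refine (abs_real_inner_le_norm _ _).trans ?_
    calc ‖p‖ * ‖q‖ ≤ δ * 1 := by gcongr; linarith
      _ = δ := mul_one _
  have hPR : |⟪p, r⟫| ≤ 2 * δ := by
    refine (abs_real_inner_le_norm _ _).trans ?_
    calc ‖p‖ * ‖r‖ ≤ δ * 2 := by gcongr; linarith
      _ = 2 * δ := mul_comm _ _
  have hE : |((n : ℝ) - 2) * ⟪p, q⟫ + lap v x| ≤ 2 * n * δ := by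
    refine (abs_add_le _ _).trans ?_
    rw [abs_mul, abs_of_nonneg (by linarith : (0 : ℝ) ≤ n - 2)]
    nlinarith [mul_le_mul_of_nonneg_left hPQ (by linarith : (0 : ℝ) ≤ n - 2)]
  have hδS : 0 ≤ δ * S := by positivity
  have t1 : |⟪hess v x p, p⟫| ≤ δ * S := (hH p p).trans (by gcongr)
  have t2 : |‖r‖ ^ 2 * lap v x| ≤ (2 * S) * (n * δ) := by
    rw [abs_mul, abs_of_nonneg (by positivity), sq]
    gcongr
  have t3 : |⟪hess v x r, r⟫| ≤ δ * (2 * S) := (hH r r).trans (by gcongr)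
  have t4 : |⟪q, r⟫ * (((n : ℝ) - 2) * ⟪p, q⟫ + lap v x)| ≤ (2 * S) * (2 * n * δ) := by
    rw [abs_mul]
    gcongr
    exact (abs_real_inner_le_norm _ _).trans hQR
  have t5 : |⟪hess v x q, r⟫| ≤ δ * (2 * S) := (hH q r).trans (by gcongr)
  have t6 : |‖r‖ ^ 2 * (((n : ℝ) - 2) * ⟪p, q⟫ + lap v x)| ≤ (2 * S) * (2 * n * δ) := by
    rw [abs_mul, abs_of_nonneg (by positivity), sq]
    gcongr
  have t7 : |‖r‖ ^ 2 / 3 * (((n : ℝ) - 2) * ⟪p, r⟫)| ≤ (2 * S / 3) * (n * (2 * δ)) := by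
    rw [abs_mul, abs_mul, abs_of_nonneg (by positivity), sq,
      abs_of_nonneg (by linarith : (0 : ℝ) ≤ n - 2)]
    gcongr
    linarith
  rw [abs_le] at t1 t2 t3 t4 t5 t6 t7 ⊢
  have hnn : 2 * (δ * S) ≤ n * (δ * S) := mul_le_mul_of_nonneg_right hn' hδS
  constructor <;> linarith

/-! ### The nuclear norm of a symmetric operator -/

/-- The sum of the absolute values of the eigenvalues of a symmetric operator. -/
def nuc {n : ℕ} (S : Euc n →ₗ[ℝ] Euc n) : ℝ :=
  let M := LinearMap.toMatrix (EuclideanSpace.basisFun (Fin n) ℝ).toBasis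
      (EuclideanSpace.basisFun (Fin n) ℝ).toBasis S
  if h : M.IsHermitian then ∑ i, |h.eigenvalues i| else 0

theorem exists_eigenbasis {n : ℕ} {S : Euc n →ₗ[ℝ] Euc n} (hS : ∀ v w, ⟪S v, w⟫ = ⟪S w, v⟫) :
    ∃ (b : OrthonormalBasis (Fin n) ℝ (Euc n)) (l : Fin n → ℝ),
      (∀ i, S (b i) = l i • b i) ∧ nuc S = ∑ i, |l i| := by
  have hent : ∀ i j, LinearMap.toMatrix (EuclideanSpace.basisFun (Fin n) ℝ).toBasis
      (EuclideanSpace.basisFun (Fin n) ℝ).toBasis S i j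
      = S (EuclideanSpace.single j 1) i := fun i j => by
    simp [LinearMap.toMatrix_apply]
  have h : (LinearMap.toMatrix (EuclideanSpace.basisFun (Fin n) ℝ).toBasis
      (EuclideanSpace.basisFun (Fin n) ℝ).toBasis S).IsHermitian := by
    refine Matrix.IsHermitian.ext fun i j => ?_
    rw [hent, hent]
    have := hS (EuclideanSpace.single i 1) (EuclideanSpace.single j 1)
    simpa [EuclideanSpace.inner_single_right] using this
  refine ⟨h.eigenvectorBasis, h.eigenvalues, fun i => ?_, ?_⟩
  · have h1 := h.mulVec_eigenvectorBasis i
    have h2 := LinearMap.toMatrix_mulVec_repr (EuclideanSpace.basisFun (Fin n) ℝ).toBasis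
      (EuclideanSpace.basisFun (Fin n) ℝ).toBasis S (h.eigenvectorBasis i)
    ext j
    have h3 := congrFun h2 j
    have h4 := congrFun h1 j
    have h5 : ⇑((EuclideanSpace.basisFun (Fin n) ℝ).toBasis.repr (h.eigenvectorBasis i))
      = ⇑(h.eigenvectorBasis i) := by ext k; simp
    rw [h5, h4] at h3
    simpa using h3.symm
  · simp only [nuc]
    rw [dif_pos h]

theorem nuclearNormII_eq_nuc {n : ℕ} (K : SmoothBody n) (x : Euc n) :
    K.nuclearNormII x = nuc (K.shapeOp x) := rfl

theorem inner_eq_sum_eigen {n : ℕ} {S : Euc n →ₗ[ℝ] Euc n}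
    {b : OrthonormalBasis (Fin n) ℝ (Euc n)} {l : Fin n → ℝ} (hb : ∀ i, S (b i) = l i • b i)
    (a : Euc n) : ⟪S a, a⟫ = ∑ i, l i * ⟪b i, a⟫ ^ 2 := by
  conv_lhs => arg 2; rw [← b.sum_repr' a, map_sum]
  rw [sum_inner]
  refine Finset.sum_congr rfl fun i _ => ?_
  rw [map_smul, hb, inner_smul_left, inner_smul_left]
  simp
  ring

/-- Duality between the nuclear norm and the operator norm. -/
theorem sum_le_nuc {n : ℕ} {S : Euc n →ₗ[ℝ] Euc n} (hS : ∀ v w, ⟪S v, w⟫ = ⟪S w, v⟫)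
    {ι : Type*} [Fintype ι] (c : ι → ℝ) (a : ι → Euc n)
    (h : ∀ t : Euc n, |∑ k, c k * ⟪a k, t⟫ ^ 2| ≤ ‖t‖ ^ 2) :
    ∑ k, c k * ⟪S (a k), a k⟫ ≤ nuc S := by
  obtain ⟨b, l, hb, hl⟩ := exists_eigenbasis hS
  have h1 : ∑ k, c k * ⟪S (a k), a k⟫ = ∑ i, l i * ∑ k, c k * ⟪a k, b i⟫ ^ 2 := by
    simp only [inner_eq_sum_eigen hb, Finset.mul_sum]
    rw [Finset.sum_comm]
    refine Finset.sum_congr rfl fun i _ => Finset.sum_congr rfl fun k _ => ?_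
    rw [real_inner_comm]
    ring
  rw [h1, hl]
  refine Finset.sum_le_sum fun i _ => ?_
  have := h (b i)
  rw [b.norm_eq_one, one_pow] at this
  refine (le_abs_self _).trans ?_
  rw [abs_mul]
  exact mul_le_of_le_one_right (abs_nonneg _) this

theorem nuc_le_add {n : ℕ} {S T : Euc n →L[ℝ] Euc n} (hS : ∀ v w, ⟪S v, w⟫ = ⟪S w, v⟫)
    (hT : ∀ v w, ⟪T v, w⟫ = ⟪T w, v⟫) :
    nuc (S : Euc n →ₗ[ℝ] Euc n) ≤ nuc (T : Euc n →ₗ[ℝ] Euc n) + n * ‖S - T‖ := by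
  obtain ⟨b, l, hb, hl⟩ := exists_eigenbasis (S := (S : Euc n →ₗ[ℝ] Euc n)) hS
  let c : Fin n → ℝ := fun i => if 0 ≤ l i then 1 else -1
  have hc : ∀ i, |c i| = 1 := fun i => by by_cases h : 0 ≤ l i <;> simp [c, h]
  have h1 : ∀ i, |l i| = c i * ⟪S (b i), b i⟫ := fun i => by
    have : S (b i) = l i • b i := hb i
    rw [this, inner_smul_left, real_inner_self_eq_norm_sq, b.norm_eq_one]
    by_cases h : 0 ≤ l i
    · simp [c, h, abs_of_nonneg h]
    · simp [c, h, abs_of_neg (not_le.1 h)]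
  have h2 : ∑ k, c k * ⟪T (b k), b k⟫ ≤ nuc (T : Euc n →ₗ[ℝ] Euc n) := by
    refine sum_le_nuc (S := (T : Euc n →ₗ[ℝ] Euc n)) hT c b fun t => ?_
    rw [← b.sum_sq_inner_right t]
    refine (Finset.abs_sum_le_sum_abs _ _).trans (Finset.sum_le_sum fun i _ => ?_)
    rw [abs_mul, hc, one_mul, abs_of_nonneg (sq_nonneg _)]
  have h3 : ∀ i, c i * ⟪S (b i), b i⟫ ≤ c i * ⟪T (b i), b i⟫ + ‖S - T‖ := fun i => by
    have h4 : |c i * ⟪(S - T) (b i), b i⟫| ≤ ‖S - T‖ := by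
      rw [abs_mul, hc, one_mul]
      refine (abs_real_inner_le_norm _ _).trans ?_
      have := (S - T).le_opNorm (b i)
      simpa [b.norm_eq_one] using this
    have h5 := (abs_le.1 h4).2
    rw [sub_apply, inner_sub_left] at h5
    linarith
  rw [hl, Finset.sum_congr rfl fun i _ => h1 i]
  refine (Finset.sum_le_sum fun i _ => h3 i).trans ?_
  rw [Finset.sum_add_distrib]
  simpa using h2

theorem continuousOn_nuc {n : ℕ} {s : Set (Euc n)} {S : Euc n → Euc n →L[ℝ] Euc n}
    (hS : ∀ x ∈ s, ∀ v w, ⟪S x v, w⟫ = ⟪S x w, v⟫) (hc : ContinuousOn S s) :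
    ContinuousOn (fun x => nuc (S x : Euc n →ₗ[ℝ] Euc n)) s := by
  intro x hx
  have h1 : Tendsto (fun y => (n : ℝ) * ‖S y - S x‖) (𝓝[s] x) (𝓝 0) := by
    have : Tendsto (fun y => (n : ℝ) * ‖S y - S x‖) (𝓝[s] x) (𝓝 (n * ‖S x - S x‖)) :=
      (((hc x hx).sub tendsto_const_nhds).norm).const_mul _
    simpa using this
  refine tendsto_iff_dist_tendsto_zero.2 (squeeze_zero' (Eventually.of_forall fun _ => dist_nonneg)
    ?_ h1)
  filter_upwards [self_mem_nhdsWithin] with y hy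
  rw [Real.dist_eq, abs_sub_le_iff]
  have h2 := nuc_le_add (hS y hy) (hS x hx)
  have h3 := nuc_le_add (hS x hx) (hS y hy)
  rw [norm_sub_rev] at h3
  constructor <;> linarith

/-- The quadratic form used to test the nuclear norm of the second fundamental form. -/
theorem test_form_bound {n : ℕ} {p r θ : Euc n} (hθ : ‖θ‖ = 1)
    (h : ‖p‖ ^ 2 + ‖r‖ ^ 2 / 3 ≤ 1) (t : Euc n) :
    |(1 - ‖r‖ ^ 2 / 3) * ‖t - ⟪θ, t⟫ • θ + ⟪θ, t⟫ • p‖ ^ 2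
      - ⟪p, t - ⟪θ, t⟫ • θ + ⟪θ, t⟫ • p⟫ ^ 2
      + 3⁻¹ * ⟪r, t - ⟪θ, t⟫ • θ + ⟪θ, t⟫ • p⟫ ^ 2| ≤ ‖t‖ ^ 2 := by
  set s := ⟪θ, t⟫
  set ξ := t - s • θ with hξ
  have hξθ : ⟪ξ, θ⟫ = 0 := by
    rw [hξ, inner_sub_left, inner_smul_left, real_inner_self_eq_norm_sq, hθ, real_inner_comm]
    simp [s]
  have ht : ‖t‖ ^ 2 = ‖ξ‖ ^ 2 + s ^ 2 := by
    have : t = ξ + s • θ := by simp [hξ]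
    rw [this, norm_add_sq_real, inner_smul_right, hξθ, norm_smul, hθ]
    simp
  set η := ξ + s • p
  have hη : ‖η‖ ^ 2 = ‖ξ‖ ^ 2 + 2 * s * ⟪p, ξ⟫ + s ^ 2 * ‖p‖ ^ 2 := by
    rw [norm_add_sq_real, inner_smul_right, norm_smul, mul_pow, real_inner_comm]
    simp
    ring
  have hpη : ⟪p, η⟫ = ⟪p, ξ⟫ + s * ‖p‖ ^ 2 := by
    rw [inner_add_right, inner_smul_right, real_inner_self_eq_norm_sq]
  have c1 : ⟪p, η⟫ ^ 2 ≤ ‖p‖ ^ 2 * ‖η‖ ^ 2 := by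
    rw [← mul_pow, ← sq_abs]
    exact pow_le_pow_left₀ (abs_nonneg _) (abs_real_inner_le_norm _ _) 2
  have c2 : ⟪r, η⟫ ^ 2 ≤ ‖r‖ ^ 2 * ‖η‖ ^ 2 := by
    rw [← mul_pow, ← sq_abs]
    exact pow_le_pow_left₀ (abs_nonneg _) (abs_real_inner_le_norm _ _) 2
  have c3 : 0 ≤ (1 - (‖p‖ ^ 2 + ‖r‖ ^ 2 / 3)) * ‖η‖ ^ 2 :=
    mul_nonneg (by linarith) (sq_nonneg _)
  rw [abs_le]
  constructor
  · nlinarith [sq_nonneg ⟪r, η⟫, sq_nonneg ‖t‖]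
  · have : ‖η‖ ^ 2 - ⟪p, η⟫ ^ 2 ≤ ‖t‖ ^ 2 := by
      rw [hη, hpη, ht]
      nlinarith [sq_nonneg (⟪p, ξ⟫ - s * (1 - ‖p‖ ^ 2)), mul_nonneg (sq_nonneg s) (sq_nonneg ‖p‖)]
    nlinarith

/-- The tangent map of a radial graph, up to a conformal factor. -/
def tanJ {n : ℕ} (θ p e : Euc n) : Euc n := e - ⟪θ, e⟫ • θ + ⟪p, e⟫ • θ

theorem nuc_ge {n : ℕ} {S : Euc n →ₗ[ℝ] Euc n} (hS : ∀ v w, ⟪S v, w⟫ = ⟪S w, v⟫)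
    {p r θ : Euc n} (hθ : ‖θ‖ = 1) (hp : ⟪p, θ⟫ = 0) (hr : ⟪r, θ⟫ = 0)
    (h : ‖p‖ ^ 2 + ‖r‖ ^ 2 / 3 ≤ 1) {κ : ℝ} {H : Euc n →L[ℝ] Euc n}
    (hH : ∀ v w, ⟪H v, w⟫ = ⟪H w, v⟫) (hHθ : H θ = -p)
    (hSJ : ∀ e, ⟪e, θ⟫ = 0 → ⟪S (tanJ θ p e), tanJ θ p e⟫
      = κ * (‖e‖ ^ 2 - ⟪H e, e⟫ + ⟪p, e⟫ ^ 2)) :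
    κ * ((n - 1) - ((n : ℝ) - 2) * ‖r‖ ^ 2 / 3 - ‖p‖ ^ 4 - ‖r‖ ^ 2 * ‖p‖ ^ 2 / 3 + ⟪p, r⟫ ^ 2 / 3
      - LinearMap.trace ℝ (Euc n) H.toLinearMap + (⟪H p, p⟫
      + (‖r‖ ^ 2 * LinearMap.trace ℝ (Euc n) H.toLinearMap - ⟪H r, r⟫) / 3)) ≤ nuc S := by
  let b := EuclideanSpace.basisFun (Fin n) ℝ
  let pr : Euc n → Euc n := fun e => e - ⟪θ, e⟫ • θ
  have hθθ : ⟪θ, θ⟫ = (1 : ℝ) := by rw [real_inner_self_eq_norm_sq, hθ, one_pow]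
  have hθp : ⟪θ, p⟫ = 0 := by rw [real_inner_comm, hp]
  have hprθ : ∀ e, ⟪pr e, θ⟫ = 0 := fun e => by
    simp only [pr, inner_sub_left, inner_smul_left, hθθ, real_inner_comm e θ]
    simp
  have hppr : ∀ e, ⟪p, pr e⟫ = ⟪p, e⟫ := fun e => by
    simp only [pr, inner_sub_right, inner_smul_right, hp, mul_zero, sub_zero]
  have hJpr : ∀ e, tanJ θ p (pr e) = tanJ θ p e := fun e => by
    have h1 : ⟪θ, pr e⟫ = 0 := by rw [real_inner_comm, hprθ]
    rw [tanJ, h1, hppr, zero_smul, sub_zero]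
    rfl
  have hJt : ∀ e t, ⟪tanJ θ p e, t⟫ = ⟪e, t - ⟪θ, t⟫ • θ + ⟪θ, t⟫ • p⟫ := fun e t => by
    simp only [tanJ, inner_sub_left, inner_add_left, inner_smul_left, inner_sub_right,
      inner_add_right, inner_smul_right, conj_trivial, real_inner_comm e θ, real_inner_comm e p]
    ring
  have key := sum_le_nuc hS (ι := Option (Option (Fin n)))
    (fun k => k.elim (-1) fun k => k.elim 3⁻¹ fun _ => 1 - ‖r‖ ^ 2 / 3)
    (fun k => k.elim (tanJ θ p p) fun k => k.elim (tanJ θ p r) fun i => tanJ θ p (b i))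
    (fun t => by
      simp only [Fintype.sum_option, Option.elim, hJt, ← Finset.mul_sum, b.sum_sq_inner_right]
      refine le_trans (le_of_eq ?_) (test_form_bound hθ h t)
      congr 1
      ring)
  have hsum1 : ∑ i, ‖pr (b i)‖ ^ 2 = (n : ℝ) - 1 := by
    have h1 : ∀ i, ‖pr (b i)‖ ^ 2 = 1 - ⟪θ, b i⟫ ^ 2 := fun i => by
      simp only [pr]
      rw [norm_sub_sq_real, norm_smul, hθ, inner_smul_right, b.norm_eq_one, real_inner_comm]
      simp
      ring
    rw [Finset.sum_congr rfl fun i _ => h1 i, Finset.sum_sub_distrib, b.sum_sq_inner_left, hθ]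
    simp
  have hsum2 : ∑ i, ⟪p, b i⟫ ^ 2 = ‖p‖ ^ 2 := b.sum_sq_inner_left p
  have hsum3 : ∑ i, ⟪H (pr (b i)), pr (b i)⟫ = LinearMap.trace ℝ (Euc n) H.toLinearMap := by
    have h1 : ∀ i, ⟪H (pr (b i)), pr (b i)⟫ = ⟪b i, H (b i)⟫ + 2 * (⟪θ, b i⟫ * ⟪b i, p⟫) := by
      intro i
      have h2 : ⟪H (b i), θ⟫ = -⟪b i, p⟫ := by rw [hH, hHθ, inner_neg_left, real_inner_comm]
      simp only [pr, map_sub, map_smul, inner_sub_left, inner_sub_right, inner_smul_left,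
        inner_smul_right, conj_trivial, hHθ, h2, inner_neg_left, hp, real_inner_comm (b i) p,
        real_inner_comm (b i) (H (b i))]
      ring
    rw [Finset.sum_congr rfl fun i _ => h1 i, Finset.sum_add_distrib, ← Finset.mul_sum,
      b.sum_inner_mul_inner, hθp, LinearMap.trace_eq_sum_inner _ b]
    simp
  have hb : ∀ i, ⟪S (tanJ θ p (b i)), tanJ θ p (b i)⟫
      = κ * (‖pr (b i)‖ ^ 2 - ⟪H (pr (b i)), pr (b i)⟫ + ⟪p, b i⟫ ^ 2) := fun i => by
    rw [← hJpr (b i), hSJ _ (hprθ _), hppr]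
  have hsum : ∑ i, ⟪S (tanJ θ p (b i)), tanJ θ p (b i)⟫
      = κ * ((n : ℝ) - 1 - LinearMap.trace ℝ (Euc n) H.toLinearMap + ‖p‖ ^ 2) := by
    rw [Finset.sum_congr rfl fun i _ => hb i, ← Finset.mul_sum, Finset.sum_add_distrib,
      Finset.sum_sub_distrib, hsum1, hsum2, hsum3]
  simp only [Fintype.sum_option, Option.elim, ← Finset.mul_sum, hsum] at key
  rw [hSJ p hp, hSJ r hr, real_inner_self_eq_norm_sq] at key
  refine le_trans (le_of_eq ?_) key
  ring

/-! ### The shape operator of a radial graph -/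

/-- The boundary of `K` is the radial graph of `exp U` centred at `c`. -/
structure IsRadialGraph {n : ℕ} (K : SmoothBody n) (c : Euc n) (U : Euc n → ℝ) : Prop where
  radial : RadialFun U
  bdry_eq : K.bdry = radialMap c U '' sphere 0 1
  normal_eq : ∀ x : Euc n, ‖x‖ = 1 → K.normal (radialMap c U x)
    = (√(1 + ‖gradient U x‖ ^ 2))⁻¹ • (x - gradient U x)

namespace SmoothBody

variable {n : ℕ} (K : SmoothBody n)

theorem tangentProj_apply (ν v : Euc n) : tangentProj ν v = v - ⟪ν, v⟫ • ν := by
  simp [tangentProj]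

theorem norm_normal {x : Euc n} (hx : x ∈ K.bdry) : ‖K.normal x‖ = 1 := by
  have h := norm_pos_iff.2 (K.regular x hx)
  rw [normal, norm_smul, norm_inv, norm_norm, inv_mul_cancel₀ h.ne']

theorem contDiffAt_normal {x : Euc n} (hx : x ∈ K.bdry) :
    ContDiffAt ℝ (⊤ : ℕ∞) K.normal x := by
  have h := K.regular x hx
  have h1 : ContDiffAt ℝ (⊤ : ℕ∞) (gradient K.F) x := contDiffAt_gradient_of K.smooth.contDiffAt
  exact ((h1.norm ℝ h).inv (norm_ne_zero_iff.2 h)).smul h1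

theorem inner_tangentProj {ν : Euc n} (v w : Euc n) :
    ⟪tangentProj ν v, w⟫ = ⟪v, tangentProj ν w⟫ := by
  rw [tangentProj_apply, tangentProj_apply, inner_sub_left, inner_sub_right, inner_smul_left,
    inner_smul_right, real_inner_comm v ν]
  simp [mul_comm]

theorem inner_shapeOp (x v w : Euc n) : ⟪K.shapeOp x v, w⟫
    = ⟪fderiv ℝ K.normal x (tangentProj (K.normal x) v), tangentProj (K.normal x) w⟫ := by
  rw [← inner_tangentProj]; rfl

theorem inner_shapeOp_comm {x : Euc n} (hx : x ∈ K.bdry) (v w : Euc n) :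
    ⟪K.shapeOp x v, w⟫ = ⟪K.shapeOp x w, v⟫ := by
  have h := K.regular x hx
  have hg0 := norm_ne_zero_iff.2 h
  have hd : DifferentiableAt ℝ (gradient K.F) x :=
    (contDiffAt_gradient_of K.smooth.contDiffAt).differentiableAt (by simp)
  have hi : DifferentiableAt ℝ (fun y => ‖gradient K.F y‖⁻¹) x :=
    (hd.norm ℝ h).inv hg0
  have hν := (hi.hasFDerivAt.smul hd.hasFDerivAt).fderiv
  have hν1 := K.norm_normal hx
  have hP : ∀ w, ⟪gradient K.F x, tangentProj (K.normal x) w⟫ = 0 := by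
    intro w
    have h1 : gradient K.F x = ‖gradient K.F x‖ • K.normal x := by
      rw [normal, smul_smul, mul_inv_cancel₀ hg0, one_smul]
    rw [h1, inner_smul_left, tangentProj_apply, inner_sub_right, inner_smul_right,
      real_inner_self_eq_norm_sq, hν1]
    simp
  have key : ∀ v w, ⟪K.shapeOp x v, w⟫ = ‖gradient K.F x‖⁻¹ *
      ⟪fderiv ℝ (gradient K.F) x (tangentProj (K.normal x) v), tangentProj (K.normal x) w⟫ := by
    intro v w
    rw [inner_shapeOp]
    have h2 : fderiv ℝ K.normal x = _ := hν
    rw [h2]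
    simp [inner_add_left, inner_smul_left, hP]
  rw [key, key, inner_fderiv_gradient_comm K.smooth.contDiffAt]

end SmoothBody

theorem RadialFun.inner_hess_self {n : ℕ} {U : Euc n → ℝ} (hU : RadialFun U) {x : Euc n}
    (hx : x ≠ 0) : hess U x x = -gradient U x := by
  refine ext_inner_right ℝ fun w => ?_
  have h1 := (hU.differentiableAt_gradient hx).hasFDerivAt.inner ℝ (hasFDerivAt_id x)
  have h2 : HasFDerivAt (fun y => ⟪gradient U y, y⟫) (0 : Euc n →L[ℝ] ℝ) x := by
    refine (hasFDerivAt_const (0 : ℝ) x).congr_of_eventuallyEq ?_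
    filter_upwards [eventually_ne_nhds hx] with y hy using hU.inner_gradient_self hy
  have h3 := congrArg (fun L : Euc n →L[ℝ] ℝ => L w) (h1.unique h2)
  simp at h3
  rw [← inner_gradient_eq] at h3
  rw [inner_hess_comm hU hx, inner_neg_left]
  have : ⟪hess U x w, x⟫ = ⟪fderiv ℝ (gradient U) x w, x⟫ := rfl
  linarith

theorem IsRadialGraph.mem_bdry {n : ℕ} {K : SmoothBody n} {c : Euc n} {U : Euc n → ℝ}
    (h : IsRadialGraph K c U) {x : Euc n} (hx : ‖x‖ = 1) : radialMap c U x ∈ K.bdry := by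
  rw [h.bdry_eq]; exact mem_image_of_mem _ (by simpa using hx)

theorem IsRadialGraph.fderiv_normal {n : ℕ} {K : SmoothBody n} {c : Euc n} {U : Euc n → ℝ}
    (h : IsRadialGraph K c U) {x : Euc n} (hx : ‖x‖ = 1) {e : Euc n} (he : ⟪e, x⟫ = 0) :
    ∃ b : ℝ, exp (U x) • fderiv ℝ K.normal (radialMap c U x) (tanJ x (gradient U x) e)
      = (√(1 + ‖gradient U x‖ ^ 2))⁻¹ • (e - hess U x e) + b • (x - gradient U x) := by
  have hU := h.radial
  have hx0 := ne_zero_of_norm_one hx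
  have hex : ⟪x, e⟫ = 0 := by rw [real_inner_comm, he]
  let ρ : Euc n → Euc n := fun y => ‖y‖⁻¹ • y
  have hρx : ρ x = x := by simp [ρ, hx]
  have hρ : HasFDerivAt ρ (fderiv ℝ ρ x) x := by
    refine DifferentiableAt.hasFDerivAt ?_
    exact (((hasFDerivAt_id x).differentiableAt.norm ℝ hx0).inv (by simp [hx])).smul
      (hasFDerivAt_id x).differentiableAt
  have hρe : fderiv ℝ ρ x e = e := by
    have h1 := (hasFDerivAt_inv_norm hx0).smul (hasFDerivAt_id x)
    have h2 := h1.fderiv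
    have h3 : fderiv ℝ ρ x = _ := h2
    rw [h3]
    simp [hx, hex]
  have hG : HasFDerivAt (fun y => gradient U (ρ y)) ((hess U x).comp (fderiv ℝ ρ x)) x := by
    have h1 : HasFDerivAt (gradient U) (hess U x) (ρ x) := by
      rw [hρx]; exact (hU.differentiableAt_gradient hx0).hasFDerivAt
    exact h1.comp x hρ
  let a : Euc n → ℝ := fun y => (√(1 + ‖gradient U (ρ y)‖ ^ 2))⁻¹
  have ha : DifferentiableAt ℝ a x := by
    have h1 : DifferentiableAt ℝ (fun y => 1 + ‖gradient U (ρ y)‖ ^ 2) x :=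
      (hG.differentiableAt.norm_sq ℝ).const_add 1
    have h2 : (1 + ‖gradient U (ρ x)‖ ^ 2) ≠ 0 := by positivity
    exact (h1.sqrt h2).inv (by positivity)
  have hN := ha.hasFDerivAt.smul (hρ.sub hG)
  have hΨ : HasFDerivAt (fun y => radialMap c U (ρ y))
      ((exp (U x) • (ContinuousLinearMap.id ℝ (Euc n))
        + (exp (U x) • fderiv ℝ U x).smulRight x).comp (fderiv ℝ ρ x)) x := by
    have h1 := (hasStrictFDerivAt_radialMap c hU hx0).hasFDerivAt
    have h2 : HasFDerivAt (radialMap c U) (exp (U x) • (ContinuousLinearMap.id ℝ (Euc n))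
        + (exp (U x) • fderiv ℝ U x).smulRight x) (ρ x) := by rw [hρx]; exact h1
    exact h2.comp x hρ
  have hν : HasFDerivAt (fun y => K.normal (radialMap c U (ρ y)))
      ((fderiv ℝ K.normal (radialMap c U x)).comp
        ((exp (U x) • (ContinuousLinearMap.id ℝ (Euc n))
          + (exp (U x) • fderiv ℝ U x).smulRight x).comp (fderiv ℝ ρ x))) x := by
    have h1 : HasFDerivAt K.normal (fderiv ℝ K.normal (radialMap c U x))
      (radialMap c U (ρ x)) := by
      rw [hρx]
      exact ((K.contDiffAt_normal (h.mem_bdry hx)).differentiableAt (by simp)).hasFDerivAt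
    exact h1.comp x hΨ
  have heq : (fun y => K.normal (radialMap c U (ρ y)))
      =ᶠ[𝓝 x] (fun y => a y • (ρ y - gradient U (ρ y))) := by
    filter_upwards [eventually_ne_nhds hx0] with y hy
    have : ‖ρ y‖ = 1 := by simp [ρ, norm_smul, hy]
    exact h.normal_eq _ this
  have hu := congrArg (fun L : Euc n →L[ℝ] Euc n => L e)
    (hν.unique (hN.congr_of_eventuallyEq heq))
  simp [hρx, hρe] at hu
  refine ⟨fderiv ℝ a x e, ?_⟩
  rw [← inner_gradient_eq] at hu
  rw [tanJ, hex, zero_smul, sub_zero, map_add, map_smul, smul_add, smul_smul, hu]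
  simp [a, hρx]

theorem IsRadialGraph.inner_shapeOp {n : ℕ} {K : SmoothBody n} {c : Euc n} {U : Euc n → ℝ}
    (h : IsRadialGraph K c U) {x : Euc n} (hx : ‖x‖ = 1) {e : Euc n} (he : ⟪e, x⟫ = 0) :
    ⟪K.shapeOp (radialMap c U x) (tanJ x (gradient U x) e), tanJ x (gradient U x) e⟫
      = ((exp (U x))⁻¹ * (√(1 + ‖gradient U x‖ ^ 2))⁻¹)
        * (‖e‖ ^ 2 - ⟪hess U x e, e⟫ + ⟪gradient U x, e⟫ ^ 2) := by
  have hU := h.radial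
  have hx0 := ne_zero_of_norm_one hx
  have hex : ⟪x, e⟫ = 0 := by rw [real_inner_comm, he]
  have hpx := hU.inner_gradient_self hx0
  have hxx : ⟪x, x⟫ = (1 : ℝ) := by rw [real_inner_self_eq_norm_sq, hx, one_pow]
  have hJ : tanJ x (gradient U x) e = e + ⟪gradient U x, e⟫ • x := by
    rw [tanJ, hex, zero_smul, sub_zero]
  have h0 : ⟪x - gradient U x, tanJ x (gradient U x) e⟫ = 0 := by
    rw [hJ, inner_sub_left, inner_add_right, inner_add_right, inner_smul_right, inner_smul_right,
      hpx, hxx, hex]; ring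
  have hP : SmoothBody.tangentProj (K.normal (radialMap c U x)) (tanJ x (gradient U x) e)
      = tanJ x (gradient U x) e := by
    rw [SmoothBody.tangentProj_apply, h.normal_eq x hx, inner_smul_left, h0]; simp
  rw [K.inner_shapeOp, hP]
  obtain ⟨b, hb⟩ := h.fderiv_normal hx he
  have hb' : fderiv ℝ K.normal (radialMap c U x) (tanJ x (gradient U x) e)
      = (exp (U x))⁻¹ • ((√(1 + ‖gradient U x‖ ^ 2))⁻¹ • (e - hess U x e)
        + b • (x - gradient U x)) := by
    rw [← hb, smul_smul, inv_mul_cancel₀ (exp_pos _).ne', one_smul]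
  have hHx : ⟪hess U x e, x⟫ = -⟪gradient U x, e⟫ := by
    rw [inner_hess_comm hU hx0, hU.inner_hess_self hx0, inner_neg_left]
  rw [hb', inner_smul_left, inner_add_left, inner_smul_left, inner_smul_left, h0, hJ,
    inner_sub_left, inner_add_right, inner_add_right, inner_smul_right, inner_smul_right, hHx, he,
    real_inner_self_eq_norm_sq]
  simp only [conj_trivial]
  ring

/-- Pointwise lower bound for the nuclear norm of a radial graph. -/
theorem IsRadialGraph.nuclearNorm_ge {n : ℕ} (hn : 2 ≤ n) {K : SmoothBody n} {c : Euc n}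
    {U V : Euc n → ℝ} (h : IsRadialGraph K c U) (hV : RadialFun V) {x : Euc n} (hx : ‖x‖ = 1)
    (hs : ‖gradient U x‖ ^ 2 + ‖gradient U x - gradient V x‖ ^ 2 / 3 ≤ 1) :
    exp (((n : ℝ) - 2) * U x) * ((n - 1) - ((n : ℝ) - 2) * ‖gradient U x - gradient V x‖ ^ 2 / 3
      - ‖gradient U x‖ ^ 4 - ‖gradient U x - gradient V x‖ ^ 2 * ‖gradient U x‖ ^ 2 / 3
      - lap U x + cubicC U V x)
    ≤ radialJac U x * K.nuclearNormII (radialMap c U x) := by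
  have hU := h.radial
  have hx0 := ne_zero_of_norm_one hx
  have hpx := hU.inner_gradient_self hx0
  have hrx : ⟪gradient U x - gradient V x, x⟫ = 0 := by
    rw [inner_sub_left, hpx, hV.inner_gradient_self hx0, sub_zero]
  have := nuc_ge (S := K.shapeOp (radialMap c U x))
    (K.inner_shapeOp_comm (h.mem_bdry hx)) hx hpx hrx hs
    (inner_hess_comm hU hx0) (hU.inner_hess_self hx0) (fun e he => h.inner_shapeOp hx he)
  rw [nuclearNormII_eq_nuc]
  have hJ := radialJac_pos U x
  refine le_trans ?_ (mul_le_mul_of_nonneg_left this hJ.le)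
  have hE : radialJac U x * ((exp (U x))⁻¹ * (√(1 + ‖gradient U x‖ ^ 2))⁻¹)
      = exp (((n : ℝ) - 2) * U x) := by
    have h1 : √(1 + ‖gradient U x‖ ^ 2) ≠ 0 := by positivity
    obtain ⟨m, rfl⟩ : ∃ m, n = m + 2 := ⟨n - 2, by omega⟩
    have h2 : exp (((m + 2 : ℕ) - 2 : ℝ) * U x) = exp (U x) ^ m := by
      rw [← exp_nat_mul]; push_cast; ring_nf
    rw [h2, radialJac, show m + 2 - 1 = m + 1 by omega]
    field_simp
    ring
  rw [← mul_assoc, hE]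
  refine mul_le_mul_of_nonneg_left ?_ (exp_pos _).le
  have hl : LinearMap.trace ℝ (Euc n) (hess U x).toLinearMap = lap U x := rfl
  rw [hl, cubicC]
  nlinarith [sq_nonneg ⟪gradient U x, gradient U x - gradient V x⟫]

theorem IsRadialGraph.continuousOn_nuclearNorm {n : ℕ} {K : SmoothBody n} {c : Euc n}
    {U : Euc n → ℝ} (h : IsRadialGraph K c U) :
    ContinuousOn (fun x => K.nuclearNormII (radialMap c U x)) (sphere 0 1) := by
  let P : Euc n → Euc n →L[ℝ] Euc n := fun ν =>
    ContinuousLinearMap.id ℝ (Euc n) - (innerSL ℝ ν).smulRight ν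
  have hP : Continuous P := by
    refine continuous_const.sub ?_
    have h1 : Continuous fun ν : Euc n => (innerSL ℝ ν).smulRight ν := by
      exact ((ContinuousLinearMap.smulRightL ℝ (Euc n) (Euc n)).continuous₂).comp
        ((innerSL ℝ).continuous.prodMk continuous_id)
    exact h1
  let T : Euc n → Euc n →L[ℝ] Euc n := fun x =>
    (P (K.normal x)) ∘L (fderiv ℝ K.normal x) ∘L (P (K.normal x))
  have hT : ∀ x, (T x : Euc n →ₗ[ℝ] Euc n) = K.shapeOp x := fun x => rfl
  have hmem : ∀ x ∈ sphere (0 : Euc n) 1, radialMap c U x ∈ K.bdry := fun x hx =>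
    h.mem_bdry (by simpa using hx)
  have hc : ContinuousOn T K.bdry := by
    have h1 : ContinuousOn K.normal K.bdry := fun x hx =>
      (K.contDiffAt_normal hx).continuousAt.continuousWithinAt
    have h2 : ContinuousOn (fderiv ℝ K.normal) K.bdry := fun x hx =>
      ((K.contDiffAt_normal hx).fderiv_right (m := 0) (by simp)).continuousAt.continuousWithinAt
    have h3 : ContinuousOn (fun x => P (K.normal x)) K.bdry := hP.comp_continuousOn h1
    exact h3.clm_comp (h2.clm_comp h3)
  have hr : ContinuousOn (radialMap c U) (sphere 0 1) :=
    (h.radial.continuousOn_radialMap c).mono fun x hx =>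
      ne_zero_of_norm_one (by simpa using hx)
  exact continuousOn_nuc (S := fun x => T (radialMap c U x))
    (fun x hx v w => K.inner_shapeOp_comm (hmem x hx) v w)
    (hc.comp hr hmem)

/-! ### The nuclear norm integral of a radial graph -/

theorem RadialFun.gradient_smul {n : ℕ} {U : Euc n → ℝ} (hU : RadialFun U) {x : Euc n}
    (hx : x ≠ 0) {t : ℝ} (ht : 0 < t) : gradient U (t • x) = t⁻¹ • gradient U x := by
  refine ext_inner_right ℝ fun w => ?_
  rw [inner_smul_left, inner_gradient_eq, inner_gradient_eq]
  have h1 : HasFDerivAt (fun y : Euc n => U (t • y))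
      ((fderiv ℝ U (t • x)).comp (t • ContinuousLinearMap.id ℝ (Euc n))) x :=
    (hU.differentiableAt (smul_ne_zero ht.ne' hx)).hasFDerivAt.comp x
      ((hasFDerivAt_id x).const_smul t)
  have h2 : (fun y : Euc n => U (t • y)) = U := funext fun y => hU.hom t ht y
  rw [h2] at h1
  rw [h1.fderiv]
  simp [ht.ne']

theorem RadialFun.dist_le_of_inner_nonneg {n : ℕ} {U : Euc n → ℝ} (hU : RadialFun U) {δ : ℝ}
    (hδ : ∀ x : Euc n, ‖x‖ = 1 → ‖gradient U x‖ ≤ δ) {x y : Euc n} (hx : ‖x‖ = 1) (hy : ‖y‖ = 1)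
    (hxy : 0 ≤ ⟪x, y⟫) : |U x - U y| ≤ 4 * δ := by
  have hδ0 : 0 ≤ δ := (norm_nonneg _).trans (hδ x hx)
  have hseg : ∀ z ∈ segment ℝ y x, 1 / 2 ≤ ‖z‖ := by
    rintro z ⟨a, b, ha, hb, hab, rfl⟩
    refine (pow_le_pow_iff_left₀ (by norm_num) (norm_nonneg _) two_ne_zero).1 ?_
    rw [norm_add_sq_real, norm_smul, norm_smul, hx, hy, inner_smul_left, inner_smul_right,
      Real.norm_of_nonneg ha, Real.norm_of_nonneg hb, real_inner_comm]
    simp only [conj_trivial]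
    have : 0 ≤ 2 * (a * (b * ⟪x, y⟫)) := by positivity
    nlinarith [sq_nonneg (a - b)]
  have h := (convex_segment y x).norm_image_sub_le_of_norm_fderiv_le (𝕜 := ℝ) (f := U)
    (C := 2 * δ) (fun z hz => hU.differentiableAt (norm_pos_iff.1 (by linarith [hseg z hz])))
    (fun z hz => ?_) (left_mem_segment ℝ y x) (right_mem_segment ℝ y x)
  · rw [Real.norm_eq_abs] at h
    refine h.trans ?_
    have : ‖x - y‖ ≤ 2 := (norm_sub_le _ _).trans (by rw [hx, hy]; norm_num)
    nlinarith
  · have hz2 := hseg z hz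
    have hz0 : 0 < ‖z‖ := by linarith
    have h1 : gradient U z = ‖z‖⁻¹ • gradient U (‖z‖⁻¹ • z) := by
      conv_lhs => rw [show z = ‖z‖ • (‖z‖⁻¹ • z) by
        rw [smul_smul, mul_inv_cancel₀ hz0.ne', one_smul]]
      exact hU.gradient_smul (smul_ne_zero (inv_ne_zero hz0.ne') (norm_pos_iff.1 hz0)) hz0
    have h2 : ‖fderiv ℝ U z‖ = ‖gradient U z‖ := by rw [gradient, LinearIsometryEquiv.norm_map]
    have h3 : ‖gradient U (‖z‖⁻¹ • z)‖ ≤ δ := hδ _ (by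
      rw [norm_smul, norm_inv, norm_norm, inv_mul_cancel₀ hz0.ne'])
    rw [h2, h1, norm_smul, norm_inv, norm_norm]
    have h4 : ‖z‖⁻¹ ≤ 2 := by
      rw [inv_le_comm₀ hz0 two_pos]; linarith
    gcongr

theorem exists_unit_orthogonal {n : ℕ} (hn : 2 ≤ n) {x : Euc n} (hx : ‖x‖ = 1) :
    ∃ z : Euc n, ‖z‖ = 1 ∧ ⟪x, z⟫ = 0 := by
  have h := finrank_hyper (by omega : 1 ≤ n) hx
  have : Nontrivial (hyper x) := Module.nontrivial_of_finrank_pos (R := ℝ) (by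
    have : (2 : ℝ) ≤ n := by exact_mod_cast hn
    have h' : (0 : ℝ) < Module.finrank ℝ (hyper x) := by linarith
    exact_mod_cast h')
  obtain ⟨z, hz⟩ := exists_norm_eq (hyper x) zero_le_one
  exact ⟨z, hz, mem_hyper.1 z.2⟩

theorem RadialFun.osc_le {n : ℕ} (hn : 2 ≤ n) {U : Euc n → ℝ} (hU : RadialFun U) {δ : ℝ}
    (hδ : ∀ x : Euc n, ‖x‖ = 1 → ‖gradient U x‖ ≤ δ) {x y : Euc n} (hx : ‖x‖ = 1)
    (hy : ‖y‖ = 1) : |U x - U y| ≤ 8 * δ := by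
  obtain ⟨z, hz, hxz⟩ := exists_unit_orthogonal hn hx
  obtain ⟨z', hz', hxz', hzy⟩ : ∃ z' : Euc n, ‖z'‖ = 1 ∧ ⟪x, z'⟫ = 0 ∧ 0 ≤ ⟪z', y⟫ := by
    rcases le_total 0 ⟪z, y⟫ with h | h
    · exact ⟨z, hz, hxz, h⟩
    · exact ⟨-z, by rwa [norm_neg], by rw [inner_neg_right, hxz, neg_zero], by
        rw [inner_neg_left]; linarith⟩
  have h1 := hU.dist_le_of_inner_nonneg hδ hx hz' hxz'.ge
  have h2 := hU.dist_le_of_inner_nonneg hδ hz' hy hzy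
  have := abs_sub_le (U x) (U z') (U y)
  linarith

theorem IsRadialGraph.integral_nuclearNorm_ge {n : ℕ} (hn : 2 ≤ n) {K : SmoothBody n} {c : Euc n}
    {U V : Euc n → ℝ} (h : IsRadialGraph K c U) (hV : RadialFun V) {δ : ℝ} (hδ : δ ≤ 1 / 2)
    (h1 : ∀ x : Euc n, ‖x‖ = 1 → ‖gradient U x‖ ≤ δ)
    (h2 : ∀ x : Euc n, ‖x‖ = 1 → ‖gradient V x‖ ≤ δ)
    (h3 : ∀ x : Euc n, ‖x‖ = 1 → ‖hess V x‖ ≤ δ) :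
    ∫ x, exp (((n : ℝ) - 2) * U x) * ((n - 1) + ((n : ℝ) - 2) * (‖gradient U x‖ ^ 2
      - ‖gradient U x - gradient V x‖ ^ 2 / 3)
      - 103 * n * δ * (‖gradient U x‖ ^ 2 + ‖gradient V x‖ ^ 2)) ∂sphM n
    ≤ ∫ x in K.bdry, K.nuclearNormII x ∂μH[(n : ℝ) - 1] := by
  have hn1 : 1 ≤ n := by omega
  have hn' : (2 : ℝ) ≤ n := by exact_mod_cast hn
  have hU := h.radial
  have cU := hU.continuousOn_gradient
  have cV := hV.continuousOn_gradient
  have cu : ContinuousOn U (sphere 0 1) := hU.continuousOn_sphere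
  have ce : ContinuousOn (fun x => exp (((n : ℝ) - 2) * U x)) (sphere 0 1) :=
    (continuousOn_const.mul cu).rexp
  have cl := hU.continuousOn_lap
  have cR := continuousOn_cubicR hU hV
  have cC := continuousOn_cubicC hU hV
  have cJ : ContinuousOn (radialJac U) (sphere 0 1) := fun x hx =>
    (hU.continuousAt_radialJac (ne_zero_of_norm_one (by simpa using hx))).continuousWithinAt
  rw [h.bdry_eq, hU.setIntegral_image hn1 c]
  let L : Euc n → ℝ := fun x => exp (((n : ℝ) - 2) * U x)
    * ((n - 1) - ((n : ℝ) - 2) * ‖gradient U x - gradient V x‖ ^ 2 / 3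
      - ‖gradient U x‖ ^ 4 - ‖gradient U x - gradient V x‖ ^ 2 * ‖gradient U x‖ ^ 2 / 3)
  have cL : ContinuousOn L (sphere 0 1) := by
    fun_prop
  have cE : ContinuousOn (fun x => exp (((n : ℝ) - 2) * U x) * ‖gradient U x‖ ^ 2)
    (sphere 0 1) := by fun_prop
  have cEl : ContinuousOn (fun x => exp (((n : ℝ) - 2) * U x) * lap U x)
    (sphere 0 1) := by fun_prop
  have cEC : ContinuousOn (fun x => exp (((n : ℝ) - 2) * U x) * cubicC U V x)
    (sphere 0 1) := by fun_prop
  have cER : ContinuousOn (fun x => exp (((n : ℝ) - 2) * U x) * cubicR U V x)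
    (sphere 0 1) := by fun_prop
  have key : ∫ x, L x + ((n : ℝ) - 2) * (exp (((n : ℝ) - 2) * U x) * ‖gradient U x‖ ^ 2)
        + exp (((n : ℝ) - 2) * U x) * cubicR U V x ∂sphM n
      = ∫ x, L x - exp (((n : ℝ) - 2) * U x) * lap U x
        + exp (((n : ℝ) - 2) * U x) * cubicC U V x ∂sphM n := by
    have i1 := integrable_sphM hn1 cL
    have i2 := integrable_sphM hn1 cE
    have i3 := integrable_sphM hn1 cEl
    have i4 := integrable_sphM hn1 cEC
    have i5 := integrable_sphM hn1 cER
    have i6 := i2.const_mul ((n : ℝ) - 2)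
    have i7 : Integrable (fun x => L x
        + ((n : ℝ) - 2) * (exp (((n : ℝ) - 2) * U x) * ‖gradient U x‖ ^ 2)) (sphM n) := i1.add i6
    have i8 : Integrable (fun x => L x - exp (((n : ℝ) - 2) * U x) * lap U x) (sphM n) := i1.sub i3
    rw [integral_add i7 i5, integral_add i1 i6, integral_add i8 i4, integral_sub i1 i3,
      integral_cubicC hn1 hU hV,
      integral_exp_lap hn1 hU, integral_const_mul]
    ring
  have hL : ∫ x, L x - exp (((n : ℝ) - 2) * U x) * lap U x
        + exp (((n : ℝ) - 2) * U x) * cubicC U V x ∂sphM n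
      ≤ ∫ x, radialJac U x • K.nuclearNormII (radialMap c U x) ∂sphM n := by
    refine integral_sphM_mono hn1 (by fun_prop) (cJ.smul h.continuousOn_nuclearNorm)
      fun x hx => ?_
    have a1 := h1 x hx
    have a2 := h2 x hx
    have a3 : ‖gradient U x - gradient V x‖ ≤ 1 := by
      linarith [norm_sub_le (gradient U x) (gradient V x)]
    have := h.nuclearNorm_ge hn hV hx (by
      nlinarith [norm_nonneg (gradient U x), norm_nonneg (gradient U x - gradient V x)])
    refine le_trans (le_of_eq ?_) this
    simp only [L]
    ring
  refine le_trans ?_ hL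
  rw [← key]
  refine integral_sphM_mono hn1 (by fun_prop) (by fun_prop) fun x hx => ?_
  have a1 := h1 x hx
  have a2 := h2 x hx
  have hδ0 : 0 ≤ δ := (norm_nonneg _).trans a1
  have b1 := abs_cubicR_le hn (by linarith) a1 a2 (h3 x hx)
  have b2 := neg_abs_le (cubicR U V x)
  simp only [L]
  rw [← sub_nonneg]
  have : exp (((n : ℝ) - 2) * U x) * ((103 * n * δ * (‖gradient U x‖ ^ 2 + ‖gradient V x‖ ^ 2)
      - ‖gradient U x‖ ^ 4 - ‖gradient U x - gradient V x‖ ^ 2 * ‖gradient U x‖ ^ 2 / 3)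
      + cubicR U V x) ≥ 0 := by
    refine mul_nonneg (exp_pos _).le ?_
    have c1 : ‖gradient U x‖ ^ 4 ≤ δ * ‖gradient U x‖ ^ 2 := by
      have : ‖gradient U x‖ ^ 2 ≤ δ := by nlinarith [norm_nonneg (gradient U x)]
      nlinarith [sq_nonneg ‖gradient U x‖]
    have c2 : ‖gradient U x - gradient V x‖ ^ 2 * ‖gradient U x‖ ^ 2 / 3
        ≤ δ * ‖gradient U x‖ ^ 2 := by
      have d1 : ‖gradient U x - gradient V x‖ ≤ 2 * δ := by
        linarith [norm_sub_le (gradient U x) (gradient V x)]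
      have : ‖gradient U x - gradient V x‖ ^ 2 ≤ 2 * δ := by
        nlinarith [norm_nonneg (gradient U x - gradient V x)]
      nlinarith [sq_nonneg ‖gradient U x‖, mul_nonneg hδ0 (sq_nonneg ‖gradient U x‖)]
    have c3 : 0 ≤ δ * ‖gradient V x‖ ^ 2 := by positivity
    have c4 : 0 ≤ δ * ‖gradient U x‖ ^ 2 := by positivity
    nlinarith
  refine this.le.trans (le_of_eq ?_)
  ring

/-! ### The quadratic form of the second variation -/

theorem ipS_sphPoly_zero {n : ℕ} (hn : 1 ≤ n) {u y : Euc n → ℝ} (hu : RadialFun u)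
    (h : ∫ x, u x ∂sphM n = 0)
    (hy : y ∈ sphPoly n 0) : ipS u y = 0 := by
  induction hy using Submodule.span_induction with
  | mem f hf =>
    obtain ⟨a, j, hj, rfl⟩ := hf
    obtain rfl : j = 0 := by omega
    simpa [ipS] using h
  | zero => simp [ipS]
  | add f g hf hg hf' hg' =>
    rw [ipS_comm] at hf' hg' ⊢
    rw [ipS_add_left hn (radialFun_of_mem hf) (radialFun_of_mem hg) hu, hf', hg', add_zero]
  | smul r f _ hf => rw [ipS_comm, ipS_smul_left, ipS_comm, hf, mul_zero]

theorem poincare_sphere {n : ℕ} (hn : 2 ≤ n) {u : Euc n → ℝ} (hu : RadialFun u)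
    (h : ∫ x, u x ∂sphM n = 0) : ((n : ℝ) - 1) * ipS u u ≤ dirS u u := by
  have := spectral_gap (by omega : 1 ≤ n) 0 hu fun y hy => ipS_sphPoly_zero (by omega) hu h hy
  convert this using 2
  simp [sphEig]
  ring

theorem exists_quadForm_ge {n : ℕ} (hn : 2 ≤ n) : ∃ C : ℝ, 0 ≤ C ∧ ∀ u v : Euc n → ℝ,
    RadialFun u → (∫ x, u x ∂sphM n) = 0 → v ∈ sphPoly n 2 →
    (∀ y ∈ sphPoly n 2, ipS (u - v) y = 0) →
      dirS v v ≤ dirS u u ∧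
      (1 / (3 * ((n : ℝ) + 1))) * dirS u u - C * ‖∫ x, u x • x ∂sphM n‖ ^ 2
        ≤ 1 / 2 * dirS u u - 1 / 3 * dirS (u - v) (u - v) - ((n : ℝ) - 1) / 2 * ipS u u := by
  have hn1 : 1 ≤ n := by omega
  have hn' : (2 : ℝ) ≤ n := by exact_mod_cast hn
  obtain ⟨C, hC, hproj⟩ := exists_proj_one hn1
  refine ⟨((n : ℝ) - 1) * C, mul_nonneg (by linarith) hC, fun u v hu hu0 hv hw => ?_⟩
  obtain ⟨v₁, hv₁, ho₁, hb⟩ := hproj u hu hu0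
  have hvr := radialFun_of_mem hv
  have hv₁r := radialFun_of_mem hv₁
  have hwr := hu.pi_sub hvr
  have hv₁2 : v₁ ∈ sphPoly n 2 := sphPoly_mono n (by norm_num) hv₁
  set z := v - v₁ with hz
  have hz2 : z ∈ sphPoly n 2 := Submodule.sub_mem _ hv hv₁2
  have hzr := radialFun_of_mem hz2
  set w := u - v with hwdef
  have hzo : ∀ y ∈ sphPoly n 1, ipS z y = 0 := fun y hy => by
    have hyr := radialFun_of_mem hy
    have : z = (u - v₁) - w := by rw [hz, hwdef]; abel
    rw [this, ipS_sub_left hn1 (hu.pi_sub hv₁r) hwr hyr, ho₁ y hy,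
      hw y (sphPoly_mono n (by norm_num) hy), sub_zero]
  have hv₁0 : ∀ y ∈ sphPoly n 0, ipS v₁ y = 0 := fun y hy => by
    have hyr := radialFun_of_mem hy
    have h1 := ho₁ y (sphPoly_mono n (by norm_num) hy)
    rw [ipS_sub_left hn1 hu hv₁r hyr, ipS_sphPoly_zero hn1 hu hu0 hy] at h1
    linarith
  have hwo : ∀ y ∈ sphPoly n 1, ipS w y = 0 := fun y hy => hw y (sphPoly_mono n (by norm_num) hy)
  have e1 : dirS v₁ v₁ = sphEig n 1 * ipS v₁ v₁ := dirS_of_orth hn1 hv₁r hv₁ hv₁0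
  have e2 : dirS z z = sphEig n 2 * ipS z z := dirS_of_orth hn1 hzr hz2 hzo
  have e3 : dirS z v₁ = sphEig n 1 * ipS z v₁ := dirS_of_orth hn1 hzr hv₁ fun y hy =>
    hzo y (sphPoly_mono n (by norm_num) hy)
  have e4 : dirS w v = sphEig n 2 * ipS w v := dirS_of_orth hn1 hwr hv hwo
  have e5 : sphEig n 3 * ipS w w ≤ dirS w w := spectral_gap hn1 2 hwr hw
  rw [hzo _ hv₁, mul_zero] at e3
  rw [hw _ hv, mul_zero] at e4
  have hvz : v = z + v₁ := by rw [hz]; abel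
  have huw : u = w + v := by rw [hwdef]; abel
  have f1 : ipS v v = ipS z z + ipS v₁ v₁ := by
    rw [hvz, ipS_add_self hn1 hzr hv₁r, hzo _ hv₁]; ring
  have f2 : dirS v v = dirS z z + dirS v₁ v₁ := by
    rw [hvz, dirS_add_self hn1 hzr hv₁r, e3]; ring
  have f3 : ipS u u = ipS w w + ipS v v := by
    conv_lhs => rw [huw, ipS_add_self hn1 hwr hvr, hw _ hv]
    ring
  have f4 : dirS u u = dirS w w + dirS v v := by
    conv_lhs => rw [huw, dirS_add_self hn1 hwr hvr, e4]
    ring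
  have g1 : sphEig n 1 = (n : ℝ) - 1 := by simp [sphEig]; ring
  have g2 : sphEig n 2 = 2 * (n : ℝ) := by simp [sphEig]
  have g3 : sphEig n 3 = 3 * ((n : ℝ) + 1) := by simp [sphEig]; ring
  rw [g1] at e1
  rw [g2] at e2
  rw [g3] at e5
  have p1 := ipS_self_nonneg z
  have p2 := ipS_self_nonneg v₁
  have p3 := ipS_self_nonneg w
  have p4 := dirS_self_nonneg w
  refine ⟨by linarith, ?_⟩
  have q1 : ((n : ℝ) - 1) * ipS v₁ v₁ ≤ ((n : ℝ) - 1) * C * ‖∫ x, u x • x ∂sphM n‖ ^ 2 := by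
    rw [mul_assoc]; exact mul_le_mul_of_nonneg_left hb (by linarith)
  rw [f4, f2, f3, f1, e1, e2]
  have q2 : 1 / (3 * ((n : ℝ) + 1)) ≤ 1 := by
    rw [div_le_one (by positivity)]; linarith
  have q3 : 1 / (3 * ((n : ℝ) + 1)) * (((n : ℝ) - 1) * ipS v₁ v₁) ≤ ((n : ℝ) - 1) * ipS v₁ v₁ :=
    mul_le_of_le_one_left (mul_nonneg (by linarith) p2) q2
  have q4 : ((n : ℝ) - 1) / 2 * ipS w w ≤ (((n : ℝ) - 1) / (6 * (n + 1))) * dirS w w := by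
    have : 0 ≤ ((n : ℝ) - 1) / (6 * (n + 1)) := div_nonneg (by linarith) (by positivity)
    refine le_trans (le_of_eq ?_) (mul_le_mul_of_nonneg_left e5 this)
    field_simp
    ring
  have q5 : (1 / 6 - ((n : ℝ) - 1) / (6 * (n + 1))) = 1 / (3 * ((n : ℝ) + 1)) := by
    field_simp; ring
  have q6 : 1 / (3 * ((n : ℝ) + 1)) * (2 * n * ipS z z) ≤ (n - (((n : ℝ) - 1) / 2)) * ipS z z := by
    rw [← mul_assoc]
    refine mul_le_mul_of_nonneg_right ?_ p1
    rw [div_mul_eq_mul_div, div_le_iff₀ (by positivity)]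
    nlinarith
  nlinarith

/-! ### Second order expansion around the sphere -/

theorem abs_exp_sub_quadratic_le {t : ℝ} (ht : |t| ≤ 1) :
    |exp t - (1 + t + t ^ 2 / 2)| ≤ |t| ^ 3 := by
  have h := Real.exp_bound ht (n := 3) (by norm_num)
  simp [Finset.sum_range_succ, Nat.factorial] at h
  refine h.trans ?_
  have : 0 ≤ |t| ^ 3 := by positivity
  nlinarith

theorem sqrt_one_add_le (s : ℝ) (hs : 0 ≤ s) : √(1 + s) ≤ 1 + s / 2 := by
  rw [Real.sqrt_le_left (by linarith)]
  nlinarith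

theorem abs_exp_mul_sub_one_le {k n u η : ℝ} (hk : 0 ≤ k) (hkn : k ≤ n) (hu : |u| ≤ η)
    (hη : n * η ≤ 1) : |exp (k * u) - 1| ≤ 2 * (n * η) := by
  have hku : |k * u| ≤ n * η := by
    rw [abs_mul, abs_of_nonneg hk]
    exact mul_le_mul hkn hu (abs_nonneg _) (hk.trans hkn)
  exact (Real.abs_exp_sub_one_le (hku.trans hη)).trans (by linarith)

theorem abs_exp_mul_sub_quadratic_le {k n u η : ℝ} (hk : 0 ≤ k) (hkn : k ≤ n) (hu : |u| ≤ η)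
    (hη : n * η ≤ 1) :
    |exp (k * u) - (1 + k * u + (k * u) ^ 2 / 2)| ≤ n ^ 3 * η * u ^ 2 := by
  have hn : 0 ≤ n := hk.trans hkn
  have hku : |k * u| ≤ n * η := by
    rw [abs_mul, abs_of_nonneg hk]
    exact mul_le_mul hkn hu (abs_nonneg _) hn
  refine (abs_exp_sub_quadratic_le (hku.trans hη)).trans ?_
  have h2 : k ^ 3 ≤ n ^ 3 := pow_le_pow_left₀ hk hkn 3
  rw [abs_mul, abs_of_nonneg hk, mul_pow]
  have h3 : |u| ^ 3 ≤ η * u ^ 2 := by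
    rw [← sq_abs u]
    have := mul_le_mul_of_nonneg_right hu (sq_nonneg |u|)
    nlinarith
  calc k ^ 3 * |u| ^ 3 ≤ n ^ 3 * (η * u ^ 2) :=
        mul_le_mul h2 h3 (by positivity) (by positivity)
    _ = _ := by ring

theorem nuclear_integrand_ge {n u s q r η : ℝ} (hn : 2 ≤ n) (hu : |u| ≤ η) (hη : n * η ≤ 1)
    (hs : 0 ≤ s) (hq : 0 ≤ q) (hr : 0 ≤ r) (hrs : r ≤ 2 * s + 2 * q) :
    (n - 1) + (n - 1) * (n - 2) * u + (n - 1) * (n - 2) ^ 2 / 2 * u ^ 2 + (n - 2) * (s - r / 3)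
      - 400 * n ^ 4 * η * (u ^ 2 + s + q)
    ≤ exp ((n - 2) * u) * ((n - 1) + (n - 2) * (s - r / 3) - 103 * n * η * (s + q)) := by
  have hη0 : 0 ≤ η := (abs_nonneg u).trans hu
  have h1 := abs_le.1 (abs_exp_mul_sub_one_le (k := n - 2) (by linarith) (by linarith) hu hη)
  have h2 := abs_le.1 (abs_exp_mul_sub_quadratic_le (k := n - 2) (by linarith) (by linarith) hu hη)
  set E := exp ((n - 2) * u)
  have hE0 : 0 ≤ E := (exp_pos _).le
  have a1 : (n - 1) * (1 + (n - 2) * u + ((n - 2) * u) ^ 2 / 2 - n ^ 3 * η * u ^ 2)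
      ≤ (n - 1) * E := mul_le_mul_of_nonneg_left (by linarith [h2.1]) (by linarith)
  have a2 : -(2 * (n * η) * (n * (2 * (s + q)))) ≤ (E - 1) * ((n - 2) * (s - r / 3)) := by
    refine neg_le_of_abs_le ?_
    rw [abs_mul]
    refine mul_le_mul (abs_le.2 h1) ?_ (abs_nonneg _) (by positivity)
    rw [abs_mul, abs_of_nonneg (by linarith : (0 : ℝ) ≤ n - 2)]
    refine mul_le_mul (by linarith) (abs_le.2 ⟨by linarith, by linarith⟩) (abs_nonneg _)
      (by linarith)
  have a3 : E * (103 * n * η * (s + q)) ≤ 3 * (103 * n * η * (s + q)) :=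
    mul_le_mul_of_nonneg_right (by linarith [h1.2]) (by positivity)
  have a4 : n ^ 3 * η * u ^ 2 * (n - 1) ≤ n ^ 4 * η * u ^ 2 := by
    have : 0 ≤ n ^ 3 * η * u ^ 2 := by positivity
    nlinarith
  have a5 : n * (η * (s + q)) ≤ n ^ 4 * (η * (s + q)) :=
    mul_le_mul_of_nonneg_right (le_self_pow₀ (by linarith) (by norm_num)) (by positivity)
  have a6 : n ^ 2 * (η * (s + q)) ≤ n ^ 4 * (η * (s + q)) :=
    mul_le_mul_of_nonneg_right (pow_le_pow_right₀ (by linarith) (by norm_num)) (by positivity)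
  have a7 : 0 ≤ n ^ 4 * η * u ^ 2 := by positivity
  have a8 : 0 ≤ n ^ 4 * (η * (s + q)) := by positivity
  nlinarith

theorem perimeter_integrand_le {n u s η : ℝ} (hn : 2 ≤ n) (hu : |u| ≤ η) (hη : n * η ≤ 1)
    (hs : 0 ≤ s) : exp ((n - 1) * u) * √(1 + s)
      ≤ 1 + (n - 1) * u + (n - 1) ^ 2 / 2 * u ^ 2 + s / 2 + n ^ 3 * η * (u ^ 2 + s) := by
  have hη0 : 0 ≤ η := (abs_nonneg u).trans hu
  have h1 := abs_le.1 (abs_exp_mul_sub_one_le (k := n - 1) (by linarith) (by linarith) hu hη)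
  have h2 := abs_le.1 (abs_exp_mul_sub_quadratic_le (k := n - 1) (by linarith) (by linarith) hu hη)
  have h3 := mul_le_mul_of_nonneg_left (sqrt_one_add_le s hs) (exp_pos ((n - 1) * u)).le
  have a1 : (exp ((n - 1) * u) - 1) * (s / 2) ≤ 2 * (n * η) * (s / 2) :=
    mul_le_mul_of_nonneg_right h1.2 (by positivity)
  have a5 : n * (η * s) ≤ n ^ 3 * (η * s) :=
    mul_le_mul_of_nonneg_right (le_self_pow₀ (by linarith) (by norm_num)) (by positivity)
  nlinarith

theorem moment_integrand_le {n u s η : ℝ} (hn : 2 ≤ n) (hu : |u| ≤ η) (hη : n * η ≤ 1)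
    (hs : 0 ≤ s) : |exp (n * u) * √(1 + s) - 1 - n * u| ≤ 2 * n ^ 2 * (u ^ 2 + s) := by
  have h1 := abs_le.1 (abs_exp_mul_sub_one_le (k := n) (by linarith) le_rfl hu hη)
  have hnu : |n * u| ≤ 1 := by
    rw [abs_mul, abs_of_nonneg (by linarith)]
    exact (mul_le_mul_of_nonneg_left hu (by linarith)).trans hη
  have h2 := abs_le.1 (Real.abs_exp_sub_one_sub_id_le hnu)
  have h3 := mul_le_mul_of_nonneg_left (sqrt_one_add_le s hs) (exp_pos (n * u)).le
  have h4 : exp (n * u) * 1 ≤ exp (n * u) * √(1 + s) :=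
    mul_le_mul_of_nonneg_left (by rw [Real.one_le_sqrt]; linarith) (exp_pos _).le
  have h5 : exp (n * u) * (s / 2) ≤ 3 * (s / 2) :=
    mul_le_mul_of_nonneg_right (by linarith [h1.2]) (by positivity)
  have h6 : 0 ≤ n ^ 2 * u ^ 2 := by positivity
  have h7 : 4 * s ≤ n ^ 2 * s := mul_le_mul_of_nonneg_right (by nlinarith) hs
  rw [abs_le]
  constructor <;> nlinarith

theorem integral_sphere_id {n : ℕ} (hn : 2 ≤ n) : ∫ x : Euc n, x ∂sphM n = 0 := by
  have hn1 : 1 ≤ n := by omega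
  refine ext_inner_left ℝ fun a => ?_
  have h1 := integral_smul_inner hn1 (u := fun _ : Euc n => (1 : ℝ)) continuousOn_const a
  have h2 := RadialFun.green hn1 (RadialFun.const (n := n) 1) (radialFun_sphLin a)
  have h3 : ∀ x : Euc n, gradient (fun _ : Euc n => (1 : ℝ)) x = 0 := fun x => by simp [gradient]
  have h4 : ∫ x, 1 * lap (sphLin a) x ∂sphM n = -((n : ℝ) - 1) * ∫ x, ⟪a, x⟫ ∂sphM n := by
    rw [← integral_const_mul]
    refine integral_sphM_congr fun x hx => ?_
    rw [lap_sphLin a hx]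
    simp [sphLin, hx]
  simp only [h3, inner_zero_left, integral_zero, h4] at h2
  simp only [one_smul, one_mul] at h1
  have hn' : (2 : ℝ) ≤ n := by exact_mod_cast hn
  have h5 : ((n : ℝ) - 1) ≠ 0 := by linarith
  rw [inner_zero_right, ← h1]
  have : ((n : ℝ) - 1) * ∫ x, ⟪a, x⟫ ∂sphM n = 0 := by linarith
  exact (mul_eq_zero.1 this).resolve_left h5

/-! ### The stability estimate -/

theorem dirS_self_eq {n : ℕ} (f : Euc n → ℝ) : dirS f f = ∫ x, ‖gradient f x‖ ^ 2 ∂sphM n := by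
  simp [dirS]

theorem ipS_self_eq {n : ℕ} (f : Euc n → ℝ) : ipS f f = ∫ x, f x ^ 2 ∂sphM n := by
  simp [ipS, sq]

theorem RadialFun.norm_moment_le {n : ℕ} (hn : 2 ≤ n) {u : Euc n → ℝ} (hu : RadialFun u) {η : ℝ}
    (hη : n * η ≤ 1) (h : ∀ x : Euc n, ‖x‖ = 1 → |u x| ≤ η)
    (h0 : ∫ x, (exp (n * u x) * √(1 + ‖gradient u x‖ ^ 2)) • x ∂sphM n = 0) :
    ‖∫ x, u x • x ∂sphM n‖ ≤ 2 * n * (ipS u u + dirS u u) := by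
  have hn1 : 1 ≤ n := by omega
  have hn' : (2 : ℝ) ≤ n := by exact_mod_cast hn
  have cu := hu.continuousOn_sphere
  have cg := hu.continuousOn_gradient
  have cG : ContinuousOn (fun x => exp (n * u x) * √(1 + ‖gradient u x‖ ^ 2)) (sphere 0 1) := by
    fun_prop
  have i1 : Integrable (fun x => (exp (n * u x) * √(1 + ‖gradient u x‖ ^ 2)) • x) (sphM n) :=
    integrable_sphM hn1 (cG.smul continuousOn_id)
  have i2 : Integrable (fun x : Euc n => x) (sphM n) := integrable_sphM hn1 continuousOn_id
  have i3 : Integrable (fun x => u x • x) (sphM n) :=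
    integrable_sphM hn1 (cu.smul continuousOn_id)
  have i4 : Integrable (fun x => (n : ℝ) • (u x • x)) (sphM n) := i3.smul (n : ℝ)
  have i5 : Integrable (fun x => (exp (n * u x) * √(1 + ‖gradient u x‖ ^ 2)) • x - x) (sphM n) :=
    i1.sub i2
  have e : ∫ x, (exp (n * u x) * √(1 + ‖gradient u x‖ ^ 2) - 1 - n * u x) • x ∂sphM n
      = -((n : ℝ) • ∫ x, u x • x ∂sphM n) := by
    have : ∀ x : Euc n, (exp (n * u x) * √(1 + ‖gradient u x‖ ^ 2) - 1 - n * u x) • x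
        = (exp (n * u x) * √(1 + ‖gradient u x‖ ^ 2)) • x - x - (n : ℝ) • (u x • x) := fun x => by
      module
    simp only [this]
    rw [integral_sub i5 i4, integral_sub i1 i2, h0, integral_sphere_id hn, integral_smul]
    simp
  have hle : ‖(n : ℝ) • ∫ x, u x • x ∂sphM n‖ ≤ 2 * n ^ 2 * (ipS u u + dirS u u) := by
    rw [← norm_neg, ← e]
    refine (norm_integral_le_integral_norm _).trans ?_
    have j1 : Integrable (fun x => u x ^ 2) (sphM n) := integrable_sphM hn1 (cu.pow 2)
    have j2 : Integrable (fun x => ‖gradient u x‖ ^ 2) (sphM n) :=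
      integrable_sphM hn1 (cg.norm.pow 2)
    rw [ipS_self_eq, dirS_self_eq, ← integral_add j1 j2, ← integral_const_mul]
    refine integral_sphM_mono hn1 (by fun_prop) (by fun_prop) fun x hx => ?_
    rw [norm_smul, hx, mul_one, Real.norm_eq_abs]
    exact moment_integrand_le hn' (h x hx) hη (by positivity)
  rw [norm_smul, Real.norm_of_nonneg (by positivity)] at hle
  have : (n : ℝ) * ‖∫ x, u x • x ∂sphM n‖ ≤ n * (2 * n * (ipS u u + dirS u u)) := by
    linarith
  exact le_of_mul_le_mul_left this (by linarith)

theorem RadialFun.perimeter_le {n : ℕ} (hn : 2 ≤ n) {u : Euc n → ℝ} (hu : RadialFun u) {η : ℝ}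
    (hη : n * η ≤ 1) (h : ∀ x : Euc n, ‖x‖ = 1 → |u x| ≤ η) (h0 : ∫ x, u x ∂sphM n = 0) :
    ∫ x, exp (((n : ℝ) - 1) * u x) * √(1 + ‖gradient u x‖ ^ 2) ∂sphM n
      ≤ sphereArea n + ((n : ℝ) - 1) ^ 2 / 2 * ipS u u + dirS u u / 2
        + n ^ 3 * η * (ipS u u + dirS u u) := by
  have hn1 : 1 ≤ n := by omega
  have hn' : (2 : ℝ) ≤ n := by exact_mod_cast hn
  have cu := hu.continuousOn_sphere
  have cg := hu.continuousOn_gradient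
  have i0 : Integrable (fun _ : Euc n => (1 : ℝ)) (sphM n) := integrable_sphM hn1 continuousOn_const
  have i1 : Integrable (fun x => ((n : ℝ) - 1) * u x) (sphM n) :=
    integrable_sphM hn1 (by fun_prop)
  have i2 : Integrable (fun x => (((n : ℝ) - 1) ^ 2 / 2 + n ^ 3 * η) * u x ^ 2) (sphM n) :=
    integrable_sphM hn1 (by fun_prop)
  have i3 : Integrable (fun x => (1 / 2 + n ^ 3 * η) * ‖gradient u x‖ ^ 2) (sphM n) :=
    integrable_sphM hn1 (by fun_prop)
  have i4 : Integrable (fun x => 1 + ((n : ℝ) - 1) * u x) (sphM n) := i0.add i1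
  have i5 : Integrable (fun x => 1 + ((n : ℝ) - 1) * u x
    + (((n : ℝ) - 1) ^ 2 / 2 + n ^ 3 * η) * u x ^ 2) (sphM n) := i4.add i2
  have e : ∫ x, (1 + ((n : ℝ) - 1) * u x + (((n : ℝ) - 1) ^ 2 / 2 + n ^ 3 * η) * u x ^ 2
      + (1 / 2 + n ^ 3 * η) * ‖gradient u x‖ ^ 2) ∂sphM n
      = sphereArea n + ((n : ℝ) - 1) ^ 2 / 2 * ipS u u + dirS u u / 2
        + n ^ 3 * η * (ipS u u + dirS u u) := by
    rw [integral_add i5 i3, integral_add i4 i2, integral_add i0 i1, integral_const_mul,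
      integral_const_mul, integral_const_mul, h0, integral_sphM_const, ← ipS_self_eq,
      ← dirS_self_eq]
    ring
  rw [← e]
  refine integral_sphM_mono hn1 (by fun_prop) (by fun_prop) fun x hx => ?_
  refine (perimeter_integrand_le hn' (h x hx) hη (by positivity)).trans (le_of_eq ?_)
  ring

theorem RadialFun.nuclear_ge {n : ℕ} (hn : 2 ≤ n) {u v : Euc n → ℝ} (hu : RadialFun u)
    (hv : RadialFun v) {η : ℝ} (hη : n * η ≤ 1) (h : ∀ x : Euc n, ‖x‖ = 1 → |u x| ≤ η)
    (h0 : ∫ x, u x ∂sphM n = 0) :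
    ((n : ℝ) - 1) * sphereArea n + ((n : ℝ) - 1) * ((n : ℝ) - 2) ^ 2 / 2 * ipS u u
      + ((n : ℝ) - 2) * (dirS u u - dirS (u - v) (u - v) / 3)
      - 400 * n ^ 4 * η * (ipS u u + dirS u u + dirS v v)
    ≤ ∫ x, exp (((n : ℝ) - 2) * u x) * ((n - 1) + ((n : ℝ) - 2) * (‖gradient u x‖ ^ 2
      - ‖gradient u x - gradient v x‖ ^ 2 / 3)
      - 103 * n * η * (‖gradient u x‖ ^ 2 + ‖gradient v x‖ ^ 2)) ∂sphM n := by
  have hn1 : 1 ≤ n := by omega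
  have hn' : (2 : ℝ) ≤ n := by exact_mod_cast hn
  have cu := hu.continuousOn_sphere
  have cg := hu.continuousOn_gradient
  have cv := hv.continuousOn_gradient
  have hw : dirS (u - v) (u - v) = ∫ x, ‖gradient u x - gradient v x‖ ^ 2 ∂sphM n := by
    rw [dirS_self_eq]
    refine integral_sphM_congr fun x hx => ?_
    have hx0 := ne_zero_of_norm_one hx
    have : gradient (u - v) x = gradient u x - gradient v x :=
      gradient_sub' (hu.differentiableAt hx0) (hv.differentiableAt hx0)
    rw [this]
  have i0 : Integrable (fun _ : Euc n => (n : ℝ) - 1) (sphM n) :=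
    integrable_sphM hn1 continuousOn_const
  have i1 : Integrable (fun x => ((n : ℝ) - 1) * ((n : ℝ) - 2) * u x) (sphM n) :=
    integrable_sphM hn1 (by fun_prop)
  have i2 : Integrable (fun x => (((n : ℝ) - 1) * ((n : ℝ) - 2) ^ 2 / 2 - 400 * n ^ 4 * η)
    * u x ^ 2) (sphM n) := integrable_sphM hn1 (by fun_prop)
  have i3 : Integrable (fun x => (((n : ℝ) - 2) - 400 * n ^ 4 * η) * ‖gradient u x‖ ^ 2)
    (sphM n) := integrable_sphM hn1 (by fun_prop)
  have i4 : Integrable (fun x => ((n : ℝ) - 2) / 3 * ‖gradient u x - gradient v x‖ ^ 2)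
    (sphM n) := integrable_sphM hn1 (by fun_prop)
  have i5 : Integrable (fun x => 400 * n ^ 4 * η * ‖gradient v x‖ ^ 2) (sphM n) :=
    integrable_sphM hn1 (by fun_prop)
  have e : ∫ x, ((n : ℝ) - 1 + ((n : ℝ) - 1) * ((n : ℝ) - 2) * u x
      + (((n : ℝ) - 1) * ((n : ℝ) - 2) ^ 2 / 2 - 400 * n ^ 4 * η) * u x ^ 2
      + (((n : ℝ) - 2) - 400 * n ^ 4 * η) * ‖gradient u x‖ ^ 2
      - ((n : ℝ) - 2) / 3 * ‖gradient u x - gradient v x‖ ^ 2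
      - 400 * n ^ 4 * η * ‖gradient v x‖ ^ 2) ∂sphM n
      = ((n : ℝ) - 1) * sphereArea n + ((n : ℝ) - 1) * ((n : ℝ) - 2) ^ 2 / 2 * ipS u u
      + ((n : ℝ) - 2) * (dirS u u - dirS (u - v) (u - v) / 3)
      - 400 * n ^ 4 * η * (ipS u u + dirS u u + dirS v v) := by
    have k1 := i0.add i1
    have k2 := k1.add i2
    have k3 := k2.add i3
    have k4 := k3.sub i4
    refine (integral_sub k4 i5).trans ?_
    have l4 := integral_sub k3 i4
    have l3 := integral_add k2 i3
    have l2 := integral_add k1 i2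
    have l1 := integral_add i0 i1
    simp only [Pi.add_apply, Pi.sub_apply] at l1 l2 l3 l4 ⊢
    rw [l4, l3, l2, l1, integral_const_mul, integral_const_mul, integral_const_mul,
      integral_const_mul, integral_const_mul, h0, integral_sphM_const, ← ipS_self_eq,
      ← dirS_self_eq, ← dirS_self_eq, ← hw]
    ring
  rw [← e]
  refine integral_sphM_mono hn1 (by fun_prop) (by fun_prop) fun x hx => ?_
  refine le_trans (le_of_eq ?_) (nuclear_integrand_ge (s := ‖gradient u x‖ ^ 2)
    (q := ‖gradient v x‖ ^ 2) (r := ‖gradient u x - gradient v x‖ ^ 2) hn' (h x hx) hη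
    (by positivity) (by positivity) (by positivity) ?_)
  · ring
  · have := parallelogram_law_with_norm ℝ (gradient u x) (gradient v x)
    nlinarith [sq_nonneg ‖gradient u x + gradient v x‖]

theorem RadialFun.abs_le_of_integral_eq_zero {n : ℕ} (hn : 2 ≤ n) {u : Euc n → ℝ}
    (hu : RadialFun u) (h0 : ∫ x, u x ∂sphM n = 0) {δ : ℝ}
    (hδ : ∀ x : Euc n, ‖x‖ = 1 → ‖gradient u x‖ ≤ δ) {x : Euc n} (hx : ‖x‖ = 1) :
    |u x| ≤ 8 * δ := by
  have hn1 : 1 ≤ n := by omega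
  have hA := sphereArea_pos hn1
  have cu := hu.continuousOn_sphere
  have h1 := integral_sphM_mono hn1 (f := u) (g := fun _ => u x + 8 * δ) cu continuousOn_const
    fun y hy => by have := (abs_le.1 (hu.osc_le hn hδ hx hy)).1; linarith
  have h2 := integral_sphM_mono hn1 (f := fun _ => u x - 8 * δ) (g := u) continuousOn_const cu
    fun y hy => by have := (abs_le.1 (hu.osc_le hn hδ hx hy)).2; linarith
  rw [integral_sphM_const, h0] at h1 h2
  rw [abs_le]
  constructor
  · by_contra! hc
    nlinarith [mul_pos hA (show 0 < -(u x + 8 * δ) by linarith)]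
  · by_contra! hc
    nlinarith [mul_pos hA (show 0 < u x - 8 * δ by linarith)]

set_option maxHeartbeats 400000 in
theorem exists_core {n : ℕ} (hn : 3 ≤ n) : ∃ δ : ℝ, 0 < δ ∧ ∀ u : Euc n → ℝ, RadialFun u →
    (∫ x, u x ∂sphM n) = 0 → (∀ x : Euc n, ‖x‖ = 1 → ‖gradient u x‖ ≤ δ) →
    (∫ x, (exp (n * u x) * √(1 + ‖gradient u x‖ ^ 2)) • x ∂sphM n) = 0 →
    ∃ v : Euc n → ℝ, RadialFun v ∧ ∃ η : ℝ, η ≤ 1 / 2 ∧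
      (∀ x : Euc n, ‖x‖ = 1 → ‖gradient u x‖ ≤ η ∧ ‖gradient v x‖ ≤ η ∧ ‖hess v x‖ ≤ η) ∧
      ((n : ℝ) - 1) * sphereArea n + ((n : ℝ) - 2) *
        ((∫ x, exp (((n : ℝ) - 1) * u x) * √(1 + ‖gradient u x‖ ^ 2) ∂sphM n) - sphereArea n)
      ≤ ∫ x, exp (((n : ℝ) - 2) * u x) * ((n - 1) + ((n : ℝ) - 2) * (‖gradient u x‖ ^ 2
        - ‖gradient u x - gradient v x‖ ^ 2 / 3)
        - 103 * n * η * (‖gradient u x‖ ^ 2 + ‖gradient v x‖ ^ 2)) ∂sphM n := by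
  have hn1 : 1 ≤ n := by omega
  have hn2 : 2 ≤ n := by omega
  have hn' : (3 : ℝ) ≤ n := by exact_mod_cast hn
  have hA := sphereArea_pos hn1
  set A := sphereArea n with hAdef
  obtain ⟨Cp, hCp, hproj⟩ := exists_proj hn1 2
  obtain ⟨C, hC, hquad⟩ := exists_quadForm_ge hn2
  set κ : ℝ := 1 / (3 * ((n : ℝ) + 1)) with hκdef
  have hκ : 0 < κ := by positivity
  set Z : ℝ := 16 * n ^ 2 * A * C + 1202 * n ^ 4 with hZdef
  have hZ : 0 < Z := by positivity
  obtain ⟨η, hη, hηn, hηZ⟩ : ∃ η : ℝ, 0 < η ∧ n * η ≤ 1 ∧ Z * η ≤ κ := by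
    refine ⟨min (1 / n) (κ / Z), by positivity, ?_, ?_⟩
    · have := min_le_left (1 / (n : ℝ)) (κ / Z)
      rw [le_div_iff₀ (by positivity)] at this
      linarith
    · have := min_le_right (1 / (n : ℝ)) (κ / Z)
      rw [le_div_iff₀ (by positivity)] at this
      linarith
  have hη1 : η ≤ 1 / 2 := by nlinarith
  have hsA : 0 ≤ √A := Real.sqrt_nonneg _
  obtain ⟨δ, hδ, hδ8, hδC⟩ : ∃ δ : ℝ, 0 < δ ∧ 8 * δ ≤ η ∧ Cp * (√A * (8 * δ)) ≤ η := by
    have hden : 0 < 8 + 8 * (Cp * √A) := by positivity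
    have e : (8 + 8 * (Cp * √A)) * (η / (8 + 8 * (Cp * √A))) = η := by field_simp
    have hp : 0 < η / (8 + 8 * (Cp * √A)) := by positivity
    have hq : 0 ≤ Cp * √A * (η / (8 + 8 * (Cp * √A))) := by positivity
    exact ⟨_, hp, by nlinarith, by nlinarith⟩
  refine ⟨δ, hδ, fun u hu h0 hgu hmom => ?_⟩
  have hu8 : ∀ x : Euc n, ‖x‖ = 1 → |u x| ≤ 8 * δ :=
    fun x hx => hu.abs_le_of_integral_eq_zero hn2 h0 hgu hx
  have huη : ∀ x : Euc n, ‖x‖ = 1 → |u x| ≤ η := fun x hx => (hu8 x hx).trans hδ8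
  have cu := hu.continuousOn_sphere
  have cg := hu.continuousOn_gradient
  obtain ⟨v, hv, horth, hvb⟩ := hproj u hu
  have hvr := radialFun_of_mem hv
  have hM : ipS u u ≤ (√A * (8 * δ)) ^ 2 := by
    rw [ipS_self_eq, mul_pow, Real.sq_sqrt hA.le, hAdef, ← integral_sphM_const]
    refine integral_sphM_mono hn1 (cu.pow 2) continuousOn_const fun x hx => ?_
    rw [← sq_abs]
    exact pow_le_pow_left₀ (abs_nonneg _) (hu8 x hx) 2
  have hvb' := hvb _ (by positivity) hM
  refine ⟨v, hvr, η, hη1, fun x hx => ⟨by linarith [hgu x hx], (hvb' x hx).1.trans hδC,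
    (hvb' x hx).2.trans hδC⟩, ?_⟩
  refine le_trans ?_ (hu.nuclear_ge hn2 hvr hηn huη h0)
  have hper := hu.perimeter_le hn2 hηn huη h0
  have hmom' := hu.norm_moment_le hn2 hηn huη hmom
  obtain ⟨hDv, hq⟩ := hquad u v hu h0 hv horth
  have hpoin := poincare_sphere hn2 hu h0
  have hp0 := ipS_self_nonneg u
  have hD0 := dirS_self_nonneg u
  have hDA : dirS u u ≤ A * η := by
    have : dirS u u ≤ A * (η ^ 2) := by
      rw [dirS_self_eq, hAdef, ← integral_sphM_const]
      refine integral_sphM_mono hn1 (cg.norm.pow 2) continuousOn_const fun x hx => ?_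
      exact pow_le_pow_left₀ (norm_nonneg _) (by linarith [hgu x hx]) 2
    refine this.trans (mul_le_mul_of_nonneg_left ?_ hA.le)
    nlinarith
  set D := dirS u u
  set p := ipS u u
  set w := ‖∫ x, u x • x ∂sphM n‖
  set d := dirS (u - v) (u - v)
  have hpD : p ≤ D := by nlinarith
  have hw0 : 0 ≤ w := norm_nonneg _
  have hw : w ^ 2 ≤ 16 * n ^ 2 * A * η * D := by
    have h1 : w ≤ 4 * n * D := by nlinarith
    calc w ^ 2 ≤ (4 * n * D) ^ 2 := pow_le_pow_left₀ hw0 h1 2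
      _ = 16 * n ^ 2 * D * D := by ring
      _ ≤ 16 * n ^ 2 * (A * η) * D := by gcongr
      _ = _ := by ring
  have hCw : C * w ^ 2 ≤ C * (16 * n ^ 2 * A * η * D) := mul_le_mul_of_nonneg_left hw hC
  have hQ : 1202 * n ^ 4 * η * D ≤ 1 / 2 * D - 1 / 3 * d - ((n : ℝ) - 1) / 2 * p := by
    have := mul_le_mul_of_nonneg_right hηZ hD0
    rw [hZdef] at this
    linarith
  have hQ0 : 0 ≤ 1202 * n ^ 4 * η * D := by positivity
  have e1 : 400 * n ^ 4 * η * (p + D + dirS v v) ≤ 1200 * n ^ 4 * η * D := by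
    have : 400 * n ^ 4 * η * (p + D + dirS v v) ≤ 400 * n ^ 4 * η * (3 * D) := by
      gcongr; linarith
    linarith
  have e2 : ((n : ℝ) - 2) * (n ^ 3 * η * (p + D)) ≤ ((n : ℝ) - 2) * (n ^ 3 * η * (2 * D)) := by
    have : (0 : ℝ) ≤ (n : ℝ) - 2 := by linarith
    gcongr; linarith
  have e3 := mul_le_mul_of_nonneg_left hper (by linarith : (0 : ℝ) ≤ (n : ℝ) - 2)
  have e4 := hQ.trans (le_mul_of_one_le_left (hQ0.trans hQ) (by linarith : (1 : ℝ) ≤ (n : ℝ) - 2))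
  have e5 : 0 ≤ (n : ℝ) ^ 3 * η * D := by positivity
  clear_value Z κ
  linarith

theorem rpow_quotient_le {N A P J I m : ℝ} (hN : 3 ≤ N) (hA : 0 < A) (hP : 0 < P)
    (hJ : (N - 1) * A + (N - 2) * (P - A) ≤ J) (hI : exp ((N - 2) * m) * J ≤ I) :
    ((N - 1) * A) ^ (N - 2)⁻¹ / A ^ (N - 1)⁻¹
      ≤ I ^ (N - 2)⁻¹ / (exp ((N - 1) * m) * P) ^ (N - 1)⁻¹ := by
  have h1 : 0 < N - 1 := by linarith
  have h2 : 0 < N - 2 := by linarith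
  have hy : 0 < P / A := by positivity
  have hb := rpow_one_add_le_one_add_mul_self (s := P / A - 1) (p := (N - 2) / (N - 1))
    (by linarith) (by positivity) (by rw [div_le_one h1]; linarith)
  rw [add_sub_cancel] at hb
  have hJ' : (N - 1) * A * (P / A) ^ ((N - 2) / (N - 1)) ≤ J := by
    refine le_trans (mul_le_mul_of_nonneg_left hb (by positivity)) (le_of_eq_of_le ?_ hJ)
    field_simp
  have hI' : exp ((N - 2) * m) * ((N - 1) * A * (P / A) ^ ((N - 2) / (N - 1))) ≤ I :=
    (mul_le_mul_of_nonneg_left hJ' (exp_pos _).le).trans hI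
  have hpow := rpow_le_rpow (by positivity) hI' (inv_pos.2 h2).le
  rw [mul_rpow (by positivity) (by positivity), mul_rpow (by positivity) (by positivity),
    ← rpow_mul hy.le, ← exp_mul] at hpow
  have e1 : (N - 2) * m * (N - 2)⁻¹ = m := by field_simp
  have e2 : (N - 2) / (N - 1) * (N - 2)⁻¹ = (N - 1)⁻¹ := by field_simp
  rw [e1, e2, div_rpow hP.le hA.le] at hpow
  have e3 : (exp ((N - 1) * m) * P) ^ (N - 1)⁻¹ = exp m * P ^ (N - 1)⁻¹ := by
    rw [mul_rpow (by positivity) hP.le, ← exp_mul]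
    congr 2
    field_simp
  rw [e3, le_div_iff₀ (by positivity)]
  refine le_of_eq_of_le ?_ hpow
  field_simp

theorem exists_graph_inequality {n : ℕ} (hn : 3 ≤ n) : ∃ δ : ℝ, 0 < δ ∧
    ∀ (K : SmoothBody n) (c : Euc n) (U : Euc n → ℝ), IsRadialGraph K c U →
    (∀ x : Euc n, ‖x‖ = 1 → ‖gradient U x‖ ≤ δ) →
    (∫ x, radialJac U x • exp (U x) • x ∂sphM n) = 0 →
    (((n : ℝ) - 1) * sphereArea n) ^ (((n : ℝ) - 2)⁻¹) / (sphereArea n) ^ (((n : ℝ) - 1)⁻¹)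
      ≤ (∫ x in K.bdry, K.nuclearNormII x ∂μH[(n : ℝ) - 1]) ^ (((n : ℝ) - 2)⁻¹)
          / K.perim ^ (((n : ℝ) - 1)⁻¹) := by
  have hn1 : 1 ≤ n := by omega
  have hn2 : 2 ≤ n := by omega
  have hn' : (3 : ℝ) ≤ n := by exact_mod_cast hn
  have hA := sphereArea_pos hn1
  obtain ⟨δ, hδ, hcore⟩ := exists_core hn
  refine ⟨δ, hδ, fun K c U hK hgU hmom => ?_⟩
  have hU := hK.radial
  set m : ℝ := (∫ x, U x ∂sphM n) / sphereArea n with hm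
  set u : Euc n → ℝ := fun x => U x - m with hu_def
  have hu : RadialFun u := hU.sub (RadialFun.const m)
  have hgrad : ∀ x, gradient u x = gradient U x := fun x => by
    simp [gradient, hu_def, fderiv_sub_const]
  have hUu : ∀ x, U x = m + u x := fun x => by simp [hu_def]
  have cu := hu.continuousOn_sphere
  have cg := hu.continuousOn_gradient
  have h0 : ∫ x, u x ∂sphM n = 0 := by
    rw [hu_def, integral_sub (integrable_sphM hn1 hU.continuousOn_sphere)
      (integrable_sphM hn1 continuousOn_const), integral_sphM_const, hm]
    field_simp
    simp
  have hm0 : ∫ x, (exp (n * u x) * √(1 + ‖gradient u x‖ ^ 2)) • x ∂sphM n = 0 := by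
    have e : ∀ x, radialJac U x • exp (U x) • x
        = exp (n * m) • ((exp (n * u x) * √(1 + ‖gradient u x‖ ^ 2)) • x) := fun x => by
      rw [smul_smul, smul_smul, radialJac, hgrad, mul_right_comm, ← pow_succ, ← exp_nat_mul,
        hUu, Nat.sub_add_cancel hn1, mul_add, exp_add, mul_assoc]
    simp only [e] at hmom
    rw [integral_smul, smul_eq_zero] at hmom
    exact hmom.resolve_left (exp_pos _).ne'
  obtain ⟨v, hv, η, hη, hb, hmain⟩ := hcore u hu h0 (fun x hx => by rw [hgrad]; exact hgU x hx) hm0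
  have hnuc := hK.integral_nuclearNorm_ge hn2 hv hη (fun x hx => by
    rw [← hgrad]; exact (hb x hx).1) (fun x hx => (hb x hx).2.1) (fun x hx => (hb x hx).2.2)
  have hper : K.perim = exp (((n : ℝ) - 1) * m) *
      ∫ x, exp (((n : ℝ) - 1) * u x) * √(1 + ‖gradient u x‖ ^ 2) ∂sphM n := by
    rw [SmoothBody.perim, hK.bdry_eq, hU.area hn1, ← integral_const_mul]
    refine integral_congr_ae (Eventually.of_forall fun x => ?_)
    simp only
    rw [radialJac, hgrad, ← exp_nat_mul, hUu, Nat.cast_sub hn1, Nat.cast_one, mul_add, exp_add,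
      mul_assoc]
  rw [hper]
  refine rpow_quotient_le hn' hA ?_ hmain (le_of_eq_of_le ?_ hnuc)
  · have h1 : sphereArea n + ((n : ℝ) - 1) * (∫ x, u x ∂sphM n)
        = ∫ x, (1 + ((n : ℝ) - 1) * u x) ∂sphM n := by
      rw [integral_add (integrable_sphM hn1 continuousOn_const)
        (integrable_sphM hn1 (by fun_prop)), integral_const_mul, integral_sphM_const, mul_one]
    rw [h0, mul_zero, add_zero] at h1
    refine hA.trans_le (h1.le.trans
      (integral_sphM_mono hn1 (by fun_prop) (by fun_prop) fun x _ => ?_))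
    have h2 := add_one_le_exp (((n : ℝ) - 1) * u x)
    have h3 : 1 ≤ √(1 + ‖gradient u x‖ ^ 2) :=
      Real.one_le_sqrt.2 (by nlinarith [sq_nonneg ‖gradient u x‖])
    nlinarith [exp_pos (((n : ℝ) - 1) * u x)]
  · rw [← integral_const_mul]
    refine integral_congr_ae (Eventually.of_forall fun x => ?_)
    simp only
    rw [hgrad, hUu, mul_add _ m, exp_add, ← mul_assoc]

/-! ### Radial graphs from the normal condition -/

theorem pos_of_hasDerivAt_pos_at_zeros {g g' : ℝ → ℝ} {a b : ℝ} (hg : ∀ t, HasDerivAt g (g' t) t)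
    (hab : a < b) (h : ∀ t ∈ Icc a b, g t = 0 → 0 < g' t) (ha : 0 ≤ g a) : 0 < g b := by
  have hc : Continuous g := continuous_iff_continuousAt.2 fun t => (hg t).continuousAt
  have h1 : ∀ t ∈ Icc a b, 0 ≤ g t := by
    have := image_le_of_deriv_right_lt_deriv_boundary (f := fun t => -g t) (f' := fun t => -g' t)
      (a := a) (b := b) hc.neg.continuousOn (fun t _ => (hg t).neg.hasDerivWithinAt)
      (B := fun _ => 0) (B' := fun _ => 0) (by simpa using ha) (fun t => hasDerivAt_const _ _)
      (fun t ht h0 => by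
        have := h t ⟨ht.1, ht.2.le⟩ (by linarith)
        linarith)
    intro t ht
    have := this ht
    linarith
  refine lt_of_le_of_ne (h1 b ⟨hab.le, le_rfl⟩) fun h0 => ?_
  have hd := h b ⟨hab.le, le_rfl⟩ h0.symm
  have hs := (hasDerivAt_iff_tendsto_slope.1 (hg b)).eventually (lt_mem_nhds hd)
  have hs' : ∀ᶠ t in 𝓝[<] b, 0 < slope g b t :=
    hs.filter_mono (nhdsWithin_mono _ fun t ht => ne_of_lt ht)
  obtain ⟨t, ht, hta⟩ := (hs'.and (Ioo_mem_nhdsLT hab)).exists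
  have := h1 t ⟨hta.1.le, hta.2.le⟩
  rw [slope_def_field, ← h0, sub_zero, div_pos_iff] at ht
  rcases ht with ht | ht
  · linarith [hta.2]
  · linarith

namespace SmoothBody

variable {n : ℕ} {K : SmoothBody n} {c : Euc n} {ε : ℝ}

theorem hasDerivAt_ray (K : SmoothBody n) (c y : Euc n) (t : ℝ) :
    HasDerivAt (fun t : ℝ => K.F (c + t • y)) ⟪gradient K.F (c + t • y), y⟫ t := by
  have h1 : HasFDerivAt K.F (fderiv ℝ K.F (c + t • y)) (c + t • y) :=
    (K.smooth.differentiable (by simp) _).hasFDerivAt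
  have h2 : HasDerivAt (fun t : ℝ => c + t • y) y t := by
    simpa using ((hasDerivAt_id t).smul_const y).const_add c
  rw [inner_gradient_eq]
  exact h1.comp_hasDerivAt t h2

theorem ne_center (hε : ε ≤ 1 / 2)
    (h : ∀ x ∈ K.bdry, ‖K.normal x - ‖x - c‖⁻¹ • (x - c)‖ ≤ ε) {x : Euc n} (hx : x ∈ K.bdry) :
    x ≠ c := by
  rintro rfl
  have := h x hx
  rw [sub_self, smul_zero, sub_zero, K.norm_normal hx] at this
  linarith

theorem inner_normal_ge (hε : ε ≤ 1 / 2)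
    (h : ∀ x ∈ K.bdry, ‖K.normal x - ‖x - c‖⁻¹ • (x - c)‖ ≤ ε) {x : Euc n} (hx : x ∈ K.bdry) :
    1 - ε ^ 2 / 2 ≤ ⟪K.normal x, ‖x - c‖⁻¹ • (x - c)⟫ := by
  have h0 : x - c ≠ 0 := sub_ne_zero.2 (ne_center hε h hx)
  have h1 : ‖‖x - c‖⁻¹ • (x - c)‖ = 1 := norm_smul_inv_norm (𝕜 := ℝ) h0
  have h2 := pow_le_pow_left₀ (norm_nonneg _) (h x hx) 2
  rw [norm_sub_sq_real, K.norm_normal hx, h1] at h2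
  linarith

theorem inner_gradient_pos (hε0 : 0 ≤ ε) (hε : ε ≤ 1 / 2)
    (h : ∀ x ∈ K.bdry, ‖K.normal x - ‖x - c‖⁻¹ • (x - c)‖ ≤ ε) {y : Euc n} {t : ℝ} (ht : 0 ≤ t)
    (hx : K.F (c + t • y) = 0) : 0 < ⟪gradient K.F (c + t • y), y⟫ := by
  have hx' : c + t • y ∈ K.bdry := hx
  have h1 := inner_normal_ge hε h hx'
  have h2 := ne_center hε h hx'
  have ht' : 0 < t := lt_of_le_of_ne ht fun h0 => h2 (by rw [← h0]; simp)
  have h3 : 0 < ⟪K.normal (c + t • y), ‖c + t • y - c‖⁻¹ • (c + t • y - c)⟫ := by nlinarith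
  rw [normal, add_sub_cancel_left, inner_smul_left, inner_smul_right, inner_smul_right] at h3
  have h4 : 0 < ‖gradient K.F (c + t • y)‖⁻¹ := inv_pos.2 (norm_pos_iff.2 (K.regular _ hx))
  have h5 : 0 ≤ ‖t • y‖⁻¹ := by positivity
  by_contra! hneg
  simp only [conj_trivial] at h3
  have h6 : 0 ≤ ‖gradient K.F (c + t • y)‖⁻¹ * (‖t • y‖⁻¹ * t) := by positivity
  nlinarith [mul_nonpos_of_nonneg_of_nonpos h6 hneg]

theorem ray_pos (hε0 : 0 ≤ ε) (hε : ε ≤ 1 / 2)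
    (h : ∀ x ∈ K.bdry, ‖K.normal x - ‖x - c‖⁻¹ • (x - c)‖ ≤ ε) {y : Euc n} {s t : ℝ} (hs : 0 ≤ s)
    (hst : s < t) (hx : 0 ≤ K.F (c + s • y)) : 0 < K.F (c + t • y) :=
  pos_of_hasDerivAt_pos_at_zeros (g := fun t => K.F (c + t • y)) (K.hasDerivAt_ray c y) hst
    (fun _ hr h0 => inner_gradient_pos hε0 hε h (hs.trans hr.1) h0) hx

theorem center_neg (hε0 : 0 ≤ ε) (hε : ε ≤ 1 / 2)
    (h : ∀ x ∈ K.bdry, ‖K.normal x - ‖x - c‖⁻¹ • (x - c)‖ ≤ ε) : K.F c < 0 := by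
  by_contra! hc
  obtain ⟨z, hz⟩ := K.connected.nonempty
  have := ray_pos hε0 hε h (y := z - c) le_rfl zero_lt_one (by simpa using hc)
  rw [one_smul, add_sub_cancel] at this
  exact lt_asymm this hz

theorem exists_ray_pos (K : SmoothBody n) (c : Euc n) {y : Euc n} (hy : y ≠ 0) :
    ∃ t : ℝ, 0 < t ∧ 0 < K.F (c + t • y) := by
  obtain ⟨r, hr⟩ := K.bounded.subset_closedBall 0
  have hy' := norm_pos_iff.2 hy
  refine ⟨(|r| + ‖c‖ + 1) / ‖y‖, by positivity, ?_⟩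
  by_contra! hneg
  have := hr hneg
  rw [mem_closedBall_zero_iff] at this
  have h2 : ‖((|r| + ‖c‖ + 1) / ‖y‖) • y‖ = |r| + ‖c‖ + 1 := by
    rw [norm_smul, Real.norm_of_nonneg (by positivity)]
    field_simp
  have h3 := norm_sub_le (c + ((|r| + ‖c‖ + 1) / ‖y‖) • y) c
  rw [add_sub_cancel_left, h2] at h3
  linarith [le_abs_self r]

theorem exists_ray_zero (hε0 : 0 ≤ ε) (hε : ε ≤ 1 / 2)
    (h : ∀ x ∈ K.bdry, ‖K.normal x - ‖x - c‖⁻¹ • (x - c)‖ ≤ ε) {y : Euc n} (hy : y ≠ 0) :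
    ∃ t : ℝ, 0 < t ∧ K.F (c + t • y) = 0 := by
  obtain ⟨T, hT, hTpos⟩ := K.exists_ray_pos c hy
  have hc := center_neg hε0 hε h
  have hcont : Continuous fun t : ℝ => K.F (c + t • y) :=
    continuous_iff_continuousAt.2 fun t => (K.hasDerivAt_ray c y t).continuousAt
  obtain ⟨t, ht, ht0⟩ := intermediate_value_Icc hT.le hcont.continuousOn
    (show (0 : ℝ) ∈ Icc _ _ from ⟨by simpa using hc.le, hTpos.le⟩)
  refine ⟨t, lt_of_le_of_ne ht.1 ?_, ht0⟩
  rintro rfl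
  simp only [zero_smul, add_zero] at ht0
  exact hc.ne ht0

theorem ray_zero_unique (hε0 : 0 ≤ ε) (hε : ε ≤ 1 / 2)
    (h : ∀ x ∈ K.bdry, ‖K.normal x - ‖x - c‖⁻¹ • (x - c)‖ ≤ ε) {y : Euc n} {s t : ℝ} (hs : 0 ≤ s)
    (ht : 0 ≤ t) (hs0 : K.F (c + s • y) = 0) (ht0 : K.F (c + t • y) = 0) : s = t := by
  rcases lt_trichotomy s t with hlt | heq | hlt
  · exact absurd ht0 (ray_pos hε0 hε h hs hlt hs0.ge).ne'
  · exact heq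
  · exact absurd hs0 (ray_pos hε0 hε h ht hlt ht0.ge).ne'

/-- The radius function of `K` seen from `c`: smooth and positively homogeneous of degree `-1`. -/
theorem exists_radius (hε0 : 0 ≤ ε) (hε : ε ≤ 1 / 2)
    (h : ∀ x ∈ K.bdry, ‖K.normal x - ‖x - c‖⁻¹ • (x - c)‖ ≤ ε) :
    ∃ R : Euc n → ℝ, (∀ y, y ≠ 0 → 0 < R y ∧ K.F (c + R y • y) = 0) ∧
      ∀ y, y ≠ 0 → ContDiffAt ℝ (⊤ : ℕ∞) R y := by
  have hex : ∀ y : Euc n, ∃ t : ℝ, y ≠ 0 → 0 < t ∧ K.F (c + t • y) = 0 := fun y => by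
    by_cases hy : y = 0
    · exact ⟨0, fun h => absurd hy h⟩
    · obtain ⟨t, ht⟩ := exists_ray_zero hε0 hε h hy
      exact ⟨t, fun _ => ht⟩
  choose R hR using hex
  refine ⟨R, hR, fun y hy => ?_⟩
  obtain ⟨hRy, hRy0⟩ := hR y hy
  let f : Euc n × ℝ → ℝ := fun p => K.F (c + p.2 • p.1)
  have cdf : ContDiffAt ℝ (⊤ : ℕ∞) f (y, R y) :=
    (K.smooth.comp (contDiff_const.add (contDiff_snd.smul contDiff_fst))).contDiffAt
  have hder : HasDerivAt (fun t : ℝ => f (y, t)) (fderiv ℝ f (y, R y) (0, 1)) (R y) := by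
    have h1 : HasDerivAt (fun t : ℝ => ((y, t) : Euc n × ℝ)) (0, 1) (R y) :=
      (hasDerivAt_const _ _).prodMk (hasDerivAt_id _)
    exact ((cdf.differentiableAt (by simp)).hasFDerivAt).comp_hasDerivAt (R y) h1
  have hpos : 0 < fderiv ℝ f (y, R y) (0, 1) := by
    rw [hder.unique (K.hasDerivAt_ray c y (R y))]
    exact inner_gradient_pos hε0 hε h hRy.le hRy0
  have inv : (fderiv ℝ f (y, R y) ∘L .inr ℝ (Euc n) ℝ).IsInvertible := by
    refine ⟨ContinuousLinearEquiv.unitsEquivAut ℝ (Units.mk0 _ hpos.ne'), ?_⟩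
    ext
    simp
  have hφ := cdf.contDiffAt_implicitFunction (by simp) inv
  refine hφ.congr_of_eventuallyEq ?_
  have e1 := cdf.eventually_apply_implicitFunction (by simp) inv
  have e2 : ∀ᶠ z in 𝓝 y, 0 < cdf.implicitFunction (by simp) inv z := by
    refine hφ.continuousAt.eventually (lt_mem_nhds ?_)
    rw [cdf.implicitFunction_apply_self]
    exact hRy
  filter_upwards [e1, e2, isOpen_ne.mem_nhds hy] with z hz1 hz2 hz3
  exact ray_zero_unique hε0 hε h (hR z hz3).1.le hz2.le (hR z hz3).2 (hz1.trans hRy0)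

end SmoothBody

namespace SmoothBody

variable {n : ℕ} {K : SmoothBody n} {c : Euc n} {ε : ℝ}

theorem norm_gradient_le_of_normal {x p ν : Euc n} (hx : ‖x‖ = 1) (hxp : ⟪x, p⟫ = 0)
    (hν : ν = (√(1 + ‖p‖ ^ 2))⁻¹ • (x - p)) (hε0 : 0 ≤ ε) (hε : ε ≤ 1 / 2) (h : ‖ν - x‖ ≤ ε) :
    ‖p‖ ≤ 2 * ε := by
  set s := √(1 + ‖p‖ ^ 2) with hs
  have hs2 : s ^ 2 = 1 + ‖p‖ ^ 2 := Real.sq_sqrt (by positivity)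
  have hs0 : 0 < s := Real.sqrt_pos.2 (by positivity)
  have hs1 : 1 ≤ s := Real.one_le_sqrt.2 (by nlinarith [sq_nonneg ‖p‖])
  have h1 : ⟪ν, x⟫ = s⁻¹ := by
    rw [hν, inner_smul_left, inner_sub_left, real_inner_self_eq_norm_sq, hx, real_inner_comm, hxp]
    simp
  have h2 : ‖ν‖ ^ 2 = 1 := by
    rw [hν, norm_smul, mul_pow, norm_sub_sq_real, hxp, hx, norm_inv, Real.norm_of_nonneg hs0.le,
      inv_pow, hs2]
    field_simp
    ring
  have h3 := pow_le_pow_left₀ (norm_nonneg _) h 2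
  rw [norm_sub_sq_real, h1, h2, hx] at h3
  have h4 : s * s⁻¹ = 1 := mul_inv_cancel₀ hs0.ne'
  have h5 : s * (1 - ε ^ 2 / 2) ≤ 1 := by nlinarith
  have h6 : ‖p‖ ^ 2 ≤ (2 * ε) ^ 2 := by
    have e1 : s - 1 ≤ s * (ε ^ 2 / 2) := by linarith
    have e0 : ε ^ 2 / 2 ≤ 1 / 8 := by nlinarith
    have e2 : s ≤ 8 / 7 := by nlinarith
    have e3 : ‖p‖ ^ 2 = (s - 1) * (s + 1) := by nlinarith
    have e4 : (s - 1) * (s + 1) ≤ (s * (ε ^ 2 / 2)) * (s + 1) :=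
      mul_le_mul_of_nonneg_right e1 (by linarith)
    have e5 : s * (s + 1) ≤ 8 := by nlinarith
    nlinarith [sq_nonneg ε]
  exact le_of_sq_le_sq h6 (by positivity)

theorem exists_isRadialGraph (hε0 : 0 ≤ ε) (hε : ε ≤ 1 / 2)
    (h : ∀ x ∈ K.bdry, ‖K.normal x - ‖x - c‖⁻¹ • (x - c)‖ ≤ ε) :
    ∃ U : Euc n → ℝ, IsRadialGraph K c U ∧ ∀ x : Euc n, ‖x‖ = 1 → ‖gradient U x‖ ≤ 2 * ε := by
  obtain ⟨R, hR, hRs⟩ := exists_radius hε0 hε h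
  let U : Euc n → ℝ := fun y => log (R y) + log (‖y‖ ^ 2) / 2
  have hUr : RadialFun U := by
    refine ⟨fun y hy => ?_, fun t ht y => ?_⟩
    · exact ((hRs y hy).log (hR y hy).1.ne').add
        (((contDiff_norm_sq ℝ).contDiffAt.log (by simpa using hy)).div_const 2)
    · by_cases hy : y = 0
      · simp [hy]
      have hty : t • y ≠ 0 := smul_ne_zero ht.ne' hy
      obtain ⟨h1, h2⟩ := hR y hy
      obtain ⟨h3, h4⟩ := hR _ hty
      rw [smul_smul] at h4
      have e : R y = R (t • y) * t := ray_zero_unique hε0 hε h h1.le (by positivity) h2 h4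
      have hy' := norm_ne_zero_iff.2 hy
      simp only [U]
      rw [e, norm_smul, Real.norm_of_nonneg ht.le, log_pow, log_pow, log_mul h3.ne' ht.ne',
        log_mul ht.ne' hy']
      push_cast
      ring
  have hexp : ∀ x : Euc n, ‖x‖ = 1 → exp (U x) = R x := fun x hx => by
    simp only [U, hx]
    simp [exp_log (hR x (ne_zero_of_norm_one hx)).1]
  have hmap : ∀ x : Euc n, ‖x‖ = 1 → radialMap c U x = c + R x • x := fun x hx => by
    rw [radialMap, hexp x hx]
  have hmem : ∀ x : Euc n, ‖x‖ = 1 → c + R x • x ∈ K.bdry := fun x hx =>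
    (hR x (ne_zero_of_norm_one hx)).2
  have hperp : ∀ x : Euc n, ‖x‖ = 1 → ⟪x, gradient U x⟫ = 0 := fun x hx => by
    rw [real_inner_comm]; exact hUr.inner_gradient_self (ne_zero_of_norm_one hx)
  have hnormal : ∀ x : Euc n, ‖x‖ = 1 → K.normal (radialMap c U x)
      = (√(1 + ‖gradient U x‖ ^ 2))⁻¹ • (x - gradient U x) := by
    intro x hx
    have hx0 := ne_zero_of_norm_one hx
    obtain ⟨hRx, hF0⟩ := hR x hx0
    rw [hmap x hx]
    set q := c + R x • x with hq
    have hpos : 0 < ⟪gradient K.F q, x⟫ := inner_gradient_pos hε0 hε h hRx.le hF0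
    have hdR : HasFDerivAt R (fderiv ℝ R x) x :=
      ((hRs x hx0).differentiableAt (by simp)).hasFDerivAt
    have hgU : ∀ v, ⟪gradient U x, v⟫ = (R x)⁻¹ * fderiv ℝ R x v + ⟪x, v⟫ := by
      intro v
      have h1 : HasFDerivAt U _ x := (hdR.log hRx.ne').add
        (((hasFDerivAt_id x).norm_sq.log (by simp [hx0])).mul_const (2 : ℝ)⁻¹)
      rw [inner_gradient_eq, h1.fderiv]
      simp [hx]
    have hgF : ∀ v, fderiv ℝ R x v * ⟪gradient K.F q, x⟫ + R x * ⟪gradient K.F q, v⟫ = 0 := by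
      intro v
      have h1 : HasFDerivAt K.F (fderiv ℝ K.F q) q :=
        (K.smooth.differentiable (by simp) _).hasFDerivAt
      have h2 : HasFDerivAt (fun y => c + R y • y) _ x := (hdR.smul (hasFDerivAt_id x)).const_add c
      have h3 := h1.comp x h2
      have h4 : HasFDerivAt (fun y => K.F (c + R y • y)) (0 : Euc n →L[ℝ] ℝ) x := by
        refine (hasFDerivAt_const (0 : ℝ) x).congr_of_eventuallyEq ?_
        filter_upwards [isOpen_ne.mem_nhds hx0] with y hy using (hR y hy).2
      have h5 := congrArg (fun L : Euc n →L[ℝ] ℝ => L v) (h3.unique h4)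
      simp only [inner_gradient_eq]
      simp at h5
      linarith
    have hgrad : gradient K.F q = ⟪gradient K.F q, x⟫ • (x - gradient U x) := by
      refine ext_inner_right ℝ fun v => ?_
      rw [inner_smul_left, inner_sub_left, hgU]
      have := hgF v
      simp only [conj_trivial]
      field_simp
      linarith
    have hn2 : ‖x - gradient U x‖ = √(1 + ‖gradient U x‖ ^ 2) := by
      rw [eq_comm, Real.sqrt_eq_iff_eq_sq (by positivity) (by positivity), norm_sub_sq_real,
        hperp x hx, hx]
      ring
    rw [normal, hgrad, norm_smul, Real.norm_of_nonneg hpos.le, hn2, smul_smul, mul_inv,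
      mul_right_comm, inv_mul_cancel₀ hpos.ne', one_mul]
  refine ⟨U, ⟨hUr, ?_, hnormal⟩, fun x hx => ?_⟩
  · ext z
    constructor
    · intro hz
      have h0 : z - c ≠ 0 := sub_ne_zero.2 (ne_center hε h hz)
      have h0' := norm_pos_iff.2 h0
      have hx : ‖‖z - c‖⁻¹ • (z - c)‖ = 1 := norm_smul_inv_norm (𝕜 := ℝ) h0
      refine ⟨‖z - c‖⁻¹ • (z - c), by simpa using hx, ?_⟩
      have e : c + ‖z - c‖ • ‖z - c‖⁻¹ • (z - c) = z := by
        rw [smul_inv_smul₀ h0'.ne', add_sub_cancel]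
      obtain ⟨h1, h2⟩ := hR _ (ne_zero_of_norm_one hx)
      rw [hmap _ hx, ray_zero_unique hε0 hε h h1.le h0'.le h2 (by rw [e]; exact hz), e]
    · rintro ⟨x, hx, rfl⟩
      rw [mem_sphere_zero_iff_norm] at hx
      rw [hmap x hx]
      exact hmem x hx
  · refine norm_gradient_le_of_normal hx (hperp x hx) (hnormal x hx) hε0 hε ?_
    have h1 := h _ (hmem x hx)
    rw [add_sub_cancel_left, norm_smul, hx, mul_one,
      Real.norm_of_nonneg (hR x (ne_zero_of_norm_one hx)).1.le,
      inv_smul_smul₀ (hR x (ne_zero_of_norm_one hx)).1.ne'] at h1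
    rw [hmap x hx]
    exact h1

end SmoothBody

/-! ### Recentring at the barycentre of the boundary -/

theorem norm_normalize_sub_le {n : ℕ} (a b : Euc n) (hb : b ≠ 0) :
    ‖‖a‖⁻¹ • a - ‖b‖⁻¹ • b‖ ≤ 2 * ‖a - b‖ / ‖b‖ := by
  have hb' := norm_pos_iff.2 hb
  by_cases ha : a = 0
  · subst ha
    have h1 : ‖‖b‖⁻¹ • b‖ = 1 := norm_smul_inv_norm (𝕜 := ℝ) hb
    rw [smul_zero, zero_sub, norm_neg, h1, zero_sub, norm_neg]
    field_simp
    norm_num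
  · have ha' := norm_pos_iff.2 ha
    have e : ‖a‖⁻¹ • a - ‖b‖⁻¹ • b = (‖a‖⁻¹ - ‖b‖⁻¹) • a + ‖b‖⁻¹ • (a - b) := by
      rw [sub_smul, smul_sub]; abel
    have h1 : ‖(‖a‖⁻¹ - ‖b‖⁻¹) • a‖ = |‖b‖ - ‖a‖| / ‖b‖ := by
      rw [norm_smul, Real.norm_eq_abs, inv_sub_inv ha'.ne' hb'.ne', abs_div,
        abs_of_pos (mul_pos ha' hb')]
      field_simp
    have h2 : |‖b‖ - ‖a‖| ≤ ‖a - b‖ := by rw [norm_sub_rev]; exact abs_norm_sub_norm_le b a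
    rw [e]
    refine (norm_add_le _ _).trans ?_
    rw [h1, norm_smul, norm_inv, norm_norm, two_mul, add_div, inv_mul_eq_div]
    gcongr

theorem SmoothBody.exists_recentred {n : ℕ} (hn : 2 ≤ n) {K : SmoothBody n} {c : Euc n} {ε : ℝ}
    (hε0 : 0 ≤ ε) (hε : 529 * n * ε ≤ 1 / 2)
    (h : ∀ x ∈ K.bdry, ‖K.normal x - ‖x - c‖⁻¹ • (x - c)‖ ≤ ε) :
    ∃ c' : Euc n, (∀ x ∈ K.bdry, ‖K.normal x - ‖x - c'‖⁻¹ • (x - c')‖ ≤ 529 * n * ε) ∧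
      ∫ x in K.bdry, (x - c') ∂μH[(n : ℝ) - 1] = 0 := by
  have hn1 : 1 ≤ n := by omega
  have hn' : (2 : ℝ) ≤ n := by exact_mod_cast hn
  have hA := sphereArea_pos hn1
  have hnε : ε ≤ n * ε := by nlinarith
  obtain ⟨U, hK, hgU⟩ := exists_isRadialGraph hε0 (by linarith) h
  have hU := hK.radial
  obtain ⟨x0, hx0, -⟩ := exists_unit_orthogonal hn
    (x := EuclideanSpace.single (⟨0, by omega⟩ : Fin n) (1 : ℝ)) (by simp)
  have hosc : ∀ x : Euc n, ‖x‖ = 1 → |U x - U x0| ≤ 16 * ε := fun x hx => by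
    have := hU.osc_le hn hgU hx hx0
    linarith
  obtain ⟨ρ, hρ0, hUρ⟩ : ∃ ρ : ℝ, 0 < ρ ∧ ∀ x, exp (U x) = ρ * exp (U x - U x0) :=
    ⟨exp (U x0), exp_pos _, fun x => by rw [← exp_add]; congr 1; ring⟩
  have cU := hU.continuousOn_sphere
  have cg := hU.continuousOn_gradient
  have cJ : ContinuousOn (radialJac U) (sphere 0 1) := by unfold radialJac; fun_prop
  set P := ∫ x, radialJac U x ∂sphM n with hP
  set N := ∫ x, radialJac U x • exp (U x) • x ∂sphM n with hN
  have cN : ContinuousOn (fun x => radialJac U x • exp (U x) • x) (sphere 0 1) := by fun_prop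
  have hJ : ∀ x, radialJac U x = ρ ^ (n - 1) * (exp (((n : ℝ) - 1) * (U x - U x0))
      * √(1 + ‖gradient U x‖ ^ 2)) := fun x => by
    rw [radialJac, hUρ, mul_pow, ← exp_nat_mul, Nat.cast_sub hn1, Nat.cast_one, mul_assoc]
  have hs1 : ∀ x, 1 ≤ √(1 + ‖gradient U x‖ ^ 2) := fun x =>
    Real.one_le_sqrt.2 (by nlinarith [sq_nonneg ‖gradient U x‖])
  have hs2 : ∀ x : Euc n, ‖x‖ = 1 → √(1 + ‖gradient U x‖ ^ 2) ≤ 1 + 2 * ε := fun x hx => by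
    rw [Real.sqrt_le_left (by linarith)]
    have := pow_le_pow_left₀ (norm_nonneg _) (hgU x hx) 2
    nlinarith
  have hPge : sphereArea n * (ρ ^ (n - 1) / 2) ≤ P := by
    rw [← integral_sphM_const]
    refine integral_sphM_mono hn1 continuousOn_const cJ fun x hx => ?_
    rw [hJ, div_eq_mul_inv]
    refine mul_le_mul_of_nonneg_left ?_ (by positivity)
    have h1 := add_one_le_exp (((n : ℝ) - 1) * (U x - U x0))
    have h2 := (abs_le.1 (hosc x hx)).1
    have h3 : ((n : ℝ) - 1) * -(16 * ε) ≤ ((n : ℝ) - 1) * (U x - U x0) :=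
      mul_le_mul_of_nonneg_left h2 (by linarith)
    have h4 : (2 : ℝ)⁻¹ ≤ exp (((n : ℝ) - 1) * (U x - U x0)) := by linarith
    nlinarith [hs1 x]
  have hPpos : 0 < P := lt_of_lt_of_le (by positivity) hPge
  have hNle : ‖N‖ ≤ sphereArea n * (ρ ^ n * (66 * n * ε)) := by
    have e : N = ∫ x, (radialJac U x * exp (U x) - ρ ^ n) • x ∂sphM n := by
      have i2 : ∫ x : Euc n, ρ ^ n • x ∂sphM n = 0 := by
        rw [integral_smul, integral_sphere_id hn, smul_zero]
      rw [hN, ← sub_zero (∫ x, radialJac U x • exp (U x) • x ∂sphM n), ← i2, ← integral_sub]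
      · simp only [sub_smul, smul_smul]
      · exact integrable_sphM hn1 cN
      · exact integrable_sphM hn1 (by fun_prop)
    rw [e, ← integral_sphM_const]
    refine (norm_integral_le_integral_norm _).trans ?_
    refine integral_sphM_mono hn1 (by fun_prop) continuousOn_const fun x hx => ?_
    rw [norm_smul, hx, mul_one, Real.norm_eq_abs]
    have e2 : radialJac U x * exp (U x) - ρ ^ n
        = ρ ^ n * (exp (n * (U x - U x0)) * √(1 + ‖gradient U x‖ ^ 2) - 1) := by
      rw [radialJac, mul_right_comm, ← pow_succ, Nat.sub_add_cancel hn1, hUρ, mul_pow,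
        ← exp_nat_mul]
      ring
    rw [e2, abs_mul, abs_of_pos (pow_pos hρ0 n)]
    refine mul_le_mul_of_nonneg_left ?_ (by positivity)
    have ht : |n * (U x - U x0)| ≤ 16 * (n * ε) := by
      rw [abs_mul, Nat.abs_cast]
      nlinarith [hosc x hx]
    have h1 := Real.abs_exp_sub_one_le (ht.trans (by linarith))
    have h2 := hs1 x
    have h3 := hs2 x hx
    generalize √(1 + ‖gradient U x‖ ^ 2) = s at h2 h3
    generalize exp (n * (U x - U x0)) = E at h1
    have h4 : |E * s - 1| ≤ |E - 1| * s + (s - 1) := by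
      rw [show E * s - 1 = (E - 1) * s + (s - 1) by ring]
      refine (abs_add_le _ _).trans ?_
      rw [abs_mul, abs_of_pos (by linarith : 0 < s), abs_of_nonneg (by linarith : 0 ≤ s - 1)]
    have h5 : |E - 1| * s ≤ 32 * (n * ε) * 2 :=
      mul_le_mul (by linarith) (by linarith) (by linarith) (by positivity)
    linarith
  have hb : ‖P⁻¹ • N‖ ≤ 132 * n * ε * ρ := by
    rw [norm_smul, norm_inv, Real.norm_of_nonneg hPpos.le, inv_mul_le_iff₀ hPpos]
    refine hNle.trans ?_
    have := mul_le_mul_of_nonneg_right hPge (by positivity : 0 ≤ 132 * n * ε * ρ)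
    refine le_trans (le_of_eq ?_) this
    rw [show ρ ^ n = ρ ^ (n - 1) * ρ by rw [← pow_succ, Nat.sub_add_cancel hn1]]
    ring
  refine ⟨c + P⁻¹ • N, fun z hz => ?_, ?_⟩
  · have h0 : z - c ≠ 0 := sub_ne_zero.2 (ne_center (by linarith) h hz)
    have h1 := norm_normalize_sub_le (z - (c + P⁻¹ • N)) (z - c) h0
    rw [show z - (c + P⁻¹ • N) - (z - c) = -(P⁻¹ • N) by abel, norm_neg] at h1
    have h2 : ρ / 2 ≤ ‖z - c‖ := by
      rw [hK.bdry_eq] at hz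
      obtain ⟨x, hx, rfl⟩ := hz
      rw [mem_sphere_zero_iff_norm] at hx
      rw [radialMap, add_sub_cancel_left, norm_smul, hx, mul_one,
        Real.norm_of_nonneg (exp_pos _).le, hUρ]
      have h3 := add_one_le_exp (U x - U x0)
      have h4 := (abs_le.1 (hosc x hx)).1
      nlinarith
    have h3 : 2 * ‖P⁻¹ • N‖ / ‖z - c‖ ≤ 528 * n * ε := by
      rw [div_le_iff₀ (by linarith)]
      have : 528 * n * ε * (ρ / 2) ≤ 528 * n * ε * ‖z - c‖ :=
        mul_le_mul_of_nonneg_left h2 (by positivity)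
      linarith
    have h4 := h z hz
    have h5 := norm_sub_le_norm_sub_add_norm_sub (K.normal z) (‖z - c‖⁻¹ • (z - c))
      (‖z - (c + P⁻¹ • N)‖⁻¹ • (z - (c + P⁻¹ • N)))
    rw [norm_sub_rev (‖z - c‖⁻¹ • (z - c))] at h5
    linarith
  · rw [hK.bdry_eq, hU.setIntegral_image hn1]
    have e : ∀ x, radialJac U x • (radialMap c U x - (c + P⁻¹ • N))
        = radialJac U x • exp (U x) • x - radialJac U x • P⁻¹ • N := fun x => by
      rw [radialMap, ← smul_sub]
      congr 1
      abel
    simp only [e]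
    have i2 : Integrable (fun x => radialJac U x • P⁻¹ • N) (sphM n) :=
      integrable_sphM hn1 (by fun_prop)
    rw [integral_sub (integrable_sphM hn1 cN) i2, integral_smul_const, ← hP, ← hN,
      smul_inv_smul₀ hPpos.ne', sub_self]

/-- For every `n ≥ 3` there exists `ε₁ = ε₁(n) > 0` such that for every
`K ⊆ ℝⁿ` which is a `C¹` `ε₁`-perturbation of a ball,
`(∫_{∂K} ‖II‖₁ dH^{n-1})^{1/(n-2)} / Per(K)^{1/(n-1)}
  ≥ ((n-1)·H^{n-1}(S^{n-1}))^{1/(n-2)} / Per(B₁)^{1/(n-1)}`. -/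
theorem minkowski_nuclear_norm (n : ℕ) (hn : 3 ≤ n) :
    ∃ ε₁ : ℝ, 0 < ε₁ ∧ ∀ K : SmoothBody n, K.IsPerturbedBall ε₁ →
      (∫ x in K.bdry, K.nuclearNormII x ∂μH[(n : ℝ) - 1]) ^ (((n : ℝ) - 2)⁻¹)
          / K.perim ^ (((n : ℝ) - 1)⁻¹)
        ≥ (((n : ℝ) - 1) * sphereArea n) ^ (((n : ℝ) - 2)⁻¹)
          / (sphereArea n) ^ (((n : ℝ) - 1)⁻¹) := by
  obtain ⟨δ, hδ, hgraph⟩ := exists_graph_inequality hn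
  have hn' : (3 : ℝ) ≤ n := by exact_mod_cast hn
  obtain ⟨ε, hε, hε1, hε2⟩ : ∃ ε : ℝ, 0 < ε ∧ 529 * n * ε ≤ 1 / 2 ∧ 2 * (529 * n * ε) ≤ δ := by
    refine ⟨min (1 / 2) (δ / 2) / (529 * n), by positivity, ?_, ?_⟩
    · rw [mul_div_cancel₀ _ (by positivity)]
      exact min_le_left _ _
    · rw [mul_div_cancel₀ _ (by positivity)]
      linarith [min_le_right (1 / 2) (δ / 2)]
  refine ⟨ε, hε, fun K ⟨c, hc⟩ => ?_⟩
  obtain ⟨c', hc', hbary⟩ := SmoothBody.exists_recentred (by omega) hε.le hε1 hc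
  obtain ⟨U, hK, hgU⟩ := SmoothBody.exists_isRadialGraph (by positivity) hε1 hc'
  refine hgraph K c' U hK (fun x hx => (hgU x hx).trans hε2) ?_
  rw [hK.bdry_eq, hK.radial.setIntegral_image (by omega)] at hbary
  simpa only [radialMap, add_sub_cancel_left] using hbary
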